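/- arXiv:math/0310029 — 3 statements merged into one kernel-verified Lean document; each statement's English description precedes it below -/
import Mathlib

section
/- Substituting z for both x_ν and y_ν (i.e., restricting to the vectors with x_ν = y_ν) maps every SO(2ν)-invariant polynomial over an algebraically closed field of characteristic 2 to an O(2ν−1)-invariant polynomial, without increasing degree. -/
open MvPolynomial

/-- The standard quadratic form `x₁y₁ + ⋯ + x_ν y_ν (+ z²)` on `n`-space. -/
def stdQ (F : Type*) [CommRing F] (n : ℕ) (v : Fin n → F) : F :=
  (∑ r : Fin (n/2), v ⟨2*r.1, by have := r.2; omega⟩ * v ⟨2*r.1+1, by have := r.2; omega⟩)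
  + if h : n % 2 = 1 then (v ⟨n-1, by omega⟩)^2 else 0


/-- The action of a matrix `g` on polynomials in the coordinates of `m` vectors,
substituting `v ↦ g v` in each vector variable. -/
noncomputable def substAct {k : Type*} [CommSemiring k] {m n : ℕ}
    (g : Matrix (Fin n) (Fin n) k) :
    MvPolynomial (Fin m × Fin n) k →ₐ[k] MvPolynomial (Fin m × Fin n) k :=
  MvPolynomial.aeval fun ic => ∑ c : Fin n, MvPolynomial.C (g ic.2 c) * MvPolynomial.X (ic.1, c)


/-- Membership in the orthogonal group `O(n)`: an invertible matrix preserving `stdQ`. -/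
def inO {k : Type*} [CommRing k] {n : ℕ} (g : Matrix (Fin n) (Fin n) k) : Prop :=
  IsUnit g.det ∧ ∀ v : Fin n → k, stdQ k n (g.mulVec v) = stdQ k n v


/-- Membership in `SO(n)` for `n` even in characteristic 2: an orthogonal matrix whose
Dickson invariant vanishes, i.e. `rank (g − 1)` is even. -/
def inSOeven {k : Type*} [Field k] {n : ℕ} (g : Matrix (Fin n) (Fin n) k) : Prop :=
  inO g ∧ Even (g - 1).rank


/-- The substitution of `z` for both `x_ν` and `y_ν`: polynomials in `m` vectors of `2ν`-space
are mapped to polynomials in `m` vectors of `(2ν−1)`-space by sending both of the last two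
coordinates to the last coordinate `z` of `(2ν−1)`-space. -/
noncomputable def substZ {k : Type*} [CommSemiring k] (m ν : ℕ) (hν : 1 ≤ ν) :
    MvPolynomial (Fin m × Fin (2*ν)) k →ₐ[k] MvPolynomial (Fin m × Fin (2*ν-1)) k :=
  MvPolynomial.aeval fun ic =>
    MvPolynomial.X (ic.1, ⟨min ic.2.1 (2*ν-2), by have := ic.2.2; omega⟩)


/-- Reflection in a fixed vector `r` with `Q r = 1` changes the parity of the rank of `g - 1`. -/
lemma aux_parity {k V : Type*} [Field k] [CharP k 2] [AddCommGroup V] [Module k V]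
    [FiniteDimensional k V] (Q : V → k) (B : V →ₗ[k] V →ₗ[k] k)
    (hQ : ∀ v w, Q (v + w) = Q v + Q w + B v w)
    (hnd : ∀ v, (∀ w, B v w = 0) → v = 0)
    (r : V) (hr : Q r = 1) (g : V →ₗ[k] V) (hg : ∀ v, Q (g v) = Q v) (hgr : g r = r) :
    ∃ g₂ : V →ₗ[k] V, (∀ v, g₂ v = g v + B r v • r) ∧
      (Even (Module.finrank k (LinearMap.range (g - LinearMap.id))) ∨
       Even (Module.finrank k (LinearMap.range (g₂ - LinearMap.id)))) := by
  have hsymm : ∀ v w, B v w = B w v := by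
    intro v w
    have h1 := hQ v w
    have h2 := hQ w v
    rw [add_comm w v] at h2
    linear_combination h2 - h1
  have hBg : ∀ v w, B (g v) (g w) = B v w := by
    intro v w
    have h1 := hQ v w
    have h2 := hQ (g v) (g w)
    rw [← map_add, hg, hg, hg] at h2
    linear_combination h1 - h2
  have two : (2 : k) = 0 := CharTwo.two_eq_zero
  have hneg : ∀ x : V, x + x = 0 := fun x => by
    rw [← two_smul k x, two, zero_smul]
  have hnegk : ∀ x : k, -x = x := fun x => by linear_combination (-x) * two
  have hsurj : Function.Surjective g := by
    apply LinearMap.surjective_of_injective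
    rw [← LinearMap.ker_eq_bot, LinearMap.ker_eq_bot']
    intro v hv
    apply hnd
    intro w
    rw [← hBg, hv]; simp
  set g₂ : V →ₗ[k] V := g + (B r).smulRight r with hg₂
  have hg₂v : ∀ v, g₂ v = g v + B r v • r := fun v => by simp [hg₂]
  refine ⟨g₂, hg₂v, ?_⟩
  set N := g - LinearMap.id with hN
  set N₂ := g₂ - LinearMap.id with hN₂
  have hNv : ∀ v, N v = g v - v := fun v => by simp [hN]
  have hN₂v : ∀ v, N₂ v = N v + B r v • r := fun v => by
    simp [hN₂, hg₂v, hNv]; abel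
  have rn := LinearMap.finrank_range_add_finrank_ker N
  have rn₂ := LinearMap.finrank_range_add_finrank_ker N₂
  have key : ∀ (K L : Submodule k V) (v : V), v ∈ L → v ∉ K → K ≤ L →
      (∀ x ∈ L, ∃ c : k, x - c • v ∈ K) →
      Module.finrank k L = Module.finrank k K + 1 := by
    intro K L v hvL hvK hKL hx
    have hL : L = K ⊔ Submodule.span k {v} := by
      apply le_antisymm
      · intro x hxL
        obtain ⟨c, hc⟩ := hx x hxL
        rw [Submodule.mem_sup]
        exact ⟨_, hc, c • v, Submodule.mem_span_singleton.2 ⟨c, rfl⟩, by abel⟩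
      · refine sup_le hKL ?_
        rw [Submodule.span_singleton_le_iff_mem]; exact hvL
    have hinf : K ⊓ Submodule.span k {v} = ⊥ := by
      rw [eq_bot_iff]
      rintro x ⟨hxK, hxs⟩
      obtain ⟨c, rfl⟩ := Submodule.mem_span_singleton.1 hxs
      by_cases hc : c = 0
      · simp [hc]
      · exact absurd ((Submodule.smul_mem_iff K hc).1 hxK) hvK
    have hv0 : v ≠ 0 := fun h => hvK (h ▸ K.zero_mem)
    have := Submodule.finrank_sup_add_finrank_inf_eq K (Submodule.span k {v})
    rw [← hL, hinf, finrank_bot, finrank_span_singleton hv0] at this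
    simpa using this
  by_cases hcase : r ∈ LinearMap.range N
  · obtain ⟨v0, hv0⟩ := hcase
    have hgv0 : g v0 = v0 + r := by rw [← hv0, hNv]; abel
    have hb : B r v0 = 1 := by
      have h1 := hg v0
      rw [hgv0, hQ, hr] at h1
      rw [hsymm]
      linear_combination h1 - two
    have hk : ∀ w ∈ LinearMap.ker N, B r w = 0 := by
      intro w hw
      have hw' : g w = w := by
        have : N w = 0 := hw
        rw [hNv] at this; exact sub_eq_zero.1 this
      have h1 := hBg v0 w
      rw [hw', hgv0, map_add, LinearMap.add_apply] at h1
      linear_combination h1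
    have := key (LinearMap.ker N) (LinearMap.ker N₂) v0
      (by rw [LinearMap.mem_ker, hN₂v, hv0, hb, one_smul, hneg])
      (fun h => by have := hk _ h; rw [hb] at this; exact one_ne_zero this)
      (fun w hw => by
        rw [LinearMap.mem_ker, hN₂v, hk w hw, LinearMap.mem_ker.1 hw]; simp)
      (fun x hx => ⟨B r x, by
        rw [LinearMap.mem_ker, hN₂v] at hx
        rw [LinearMap.mem_ker, map_sub, map_smul, hv0, eq_neg_of_add_eq_zero_left hx,
          ← neg_add', hneg, neg_zero]⟩)
    by_contra hcon
    rw [not_or, Nat.not_even_iff, Nat.not_even_iff] at hcon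
    omega
  · have hex : ∃ w ∈ LinearMap.ker N, B r w ≠ 0 := by
      by_contra hcon
      push Not at hcon
      have hmem : B r ∈ (LinearMap.ker N).dualAnnihilator := by
        rw [Submodule.mem_dualAnnihilator]; exact hcon
      rw [← LinearMap.range_dualMap_eq_dualAnnihilator_ker] at hmem
      obtain ⟨ψ, hψ⟩ := hmem
      have hBinj : Function.Injective B := by
        rw [← LinearMap.ker_eq_bot, LinearMap.ker_eq_bot']
        intro v hv
        apply hnd
        intro w; rw [hv]; rfl
      have hBs : Function.Surjective B :=
        (LinearMap.injective_iff_surjective_of_finrank_eq_finrank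
          (Subspace.dual_finrank_eq (K := k) (V := V)).symm).1 hBinj
      obtain ⟨u, hu⟩ := hBs ψ
      apply hcase
      refine ⟨u, ?_⟩
      have : ∀ v, B r v = B u (g v) - B u v := by
        intro v
        rw [← hψ, ← hu, LinearMap.dualMap_apply, hNv, map_sub]
      -- r = N u
      rw [hNv, ← sub_eq_zero]
      apply hnd
      intro w
      obtain ⟨v, rfl⟩ := hsurj w
      have h1 := this v
      have h2 := hBg u v
      have h3 := hBg r v
      rw [hgr] at h3
      simp only [map_sub, LinearMap.sub_apply]
      rw [h2, h3, h1]
      linear_combination (B u v - B u (g v)) * two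
    obtain ⟨w, hw, hbw⟩ := hex
    have hN₂ker : ∀ x ∈ LinearMap.ker N₂, B r x = 0 := by
      intro x hx
      by_contra hne
      rw [LinearMap.mem_ker, hN₂v] at hx
      apply hcase
      refine ⟨-(B r x)⁻¹ • x, ?_⟩
      rw [map_smul, eq_neg_of_add_eq_zero_left hx, smul_neg, neg_smul, neg_neg, smul_smul,
        inv_mul_cancel₀ hne, one_smul]
    have := key (LinearMap.ker N₂) (LinearMap.ker N) w hw
      (fun h => hbw (hN₂ker _ h))
      (fun x hx => by
        have h0 := hN₂ker x hx
        rw [LinearMap.mem_ker, hN₂v, h0, zero_smul, add_zero] at hx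
        exact hx)
      (fun x hx => ⟨B r x / B r w, by
        rw [LinearMap.mem_ker, hN₂v, map_sub, map_smul, LinearMap.mem_ker.1 hx,
          LinearMap.mem_ker.1 hw, map_sub, map_smul, smul_eq_mul, div_mul_cancel₀ _ hbw]
        simp⟩)
    by_contra hcon
    rw [not_or, Nat.not_even_iff, Nat.not_even_iff] at hcon
    omega

/-- Extension of an isometry of `W = r^⊥` to an isometry of `V` with even rank of `g - 1`. -/
lemma aux_extend {k V W : Type*} [Field k] [IsAlgClosed k] [CharP k 2]
    [AddCommGroup V] [Module k V] [FiniteDimensional k V]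
    [AddCommGroup W] [Module k W] [FiniteDimensional k W]
    (Q : V → k) (B : V →ₗ[k] V →ₗ[k] k)
    (hQ : ∀ v w, Q (v + w) = Q v + Q w + B v w)
    (hQs : ∀ (c : k) v, Q (c • v) = c ^ 2 * Q v)
    (hnd : ∀ v, (∀ w, B v w = 0) → v = 0)
    (i : W →ₗ[k] V) (π : V →ₗ[k] W) (hπi : ∀ w, π (i w) = w)
    (r₀ : W) (f : V) (hr : Q (i r₀) = 1) (hri : ∀ w, B (i r₀) (i w) = 0)
    (hrf : B (i r₀) f = 1)
    (hiπ : ∀ v, i (π v) = v - B (i r₀) v • f)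
    (h : W →ₗ[k] W) (hinj : Function.Injective h) (hh : ∀ w, Q (i (h w)) = Q (i w)) :
    ∃ g : V →ₗ[k] V, (∀ v, Q (g v) = Q v) ∧ (∀ w, g (i w) = i (h w)) ∧
      Even (Module.finrank k (LinearMap.range (g - LinearMap.id))) := by
  have two : (2 : k) = 0 := CharTwo.two_eq_zero
  have hsymm : ∀ v w, B v w = B w v := by
    intro v w
    have h1 := hQ v w
    have h2 := hQ w v
    rw [add_comm w v] at h2
    linear_combination h2 - h1
  have hBh : ∀ v w, B (i (h v)) (i (h w)) = B (i v) (i w) := by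
    intro v w
    have h1 := hQ (i v) (i w)
    have h2 := hQ (i (h v)) (i (h w))
    rw [← map_add, ← map_add, hh, hh, hh, map_add] at h2
    linear_combination h1 - h2
  have hsurj : Function.Surjective h := LinearMap.surjective_of_injective hinj
  set r := i r₀ with hrdef
  -- `h` fixes `r`
  have hhr : i (h r₀) = r := by
    set c := B (i (h r₀)) f with hc
    have e1 : i (h r₀) = c • r := by
      rw [← sub_eq_zero]
      apply hnd
      intro v
      have hv : v = i (π v) + B r v • f := by rw [hiπ]; abel
      obtain ⟨w, hw⟩ := hsurj (π v)
      have h0 : B (i (h r₀)) (i (π v)) = 0 := by rw [← hw, hBh, hri]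
      have h1 : B (i (h r₀)) v = B r v * c := by
        conv_lhs => rw [hv]
        rw [map_add, h0, map_smul, smul_eq_mul, ← hc, zero_add]
      simp only [map_sub, LinearMap.sub_apply, map_smul, LinearMap.smul_apply, smul_eq_mul, h1]
      ring
    have h2 := hh r₀
    rw [e1, hQs, hr] at h2
    have h3 : (c - 1) ^ 2 = 0 := by linear_combination h2 + (1 - c) * two
    have h4 : c = 1 := sub_eq_zero.1 (pow_eq_zero_iff (two_ne_zero) |>.1 h3)
    rw [e1, h4, one_smul]
  have hBinj : Function.Injective B := by
    rw [← LinearMap.ker_eq_bot, LinearMap.ker_eq_bot']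
    intro v hv
    apply hnd
    intro w; rw [hv]; rfl
  have hBs : Function.Surjective B :=
    (LinearMap.injective_iff_surjective_of_finrank_eq_finrank
      (Subspace.dual_finrank_eq (K := k) (V := V)).symm).1 hBinj
  let e : W ≃ₗ[k] W := LinearEquiv.ofBijective h ⟨hinj, hsurj⟩
  have he : ∀ w, e.symm (h w) = w := fun w => e.symm_apply_apply w
  obtain ⟨f₁, hf₁⟩ := hBs ((B f).comp (i.comp (e.symm.toLinearMap.comp π)))
  have hf₁' : ∀ w, B f₁ (i (h w)) = B f (i w) := by
    intro w
    rw [hf₁]; simp [hπi, he]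
  have hf₁r : B f₁ r = 1 := by
    have := hf₁' r₀
    rw [hhr] at this
    rw [this, hsymm, hrf]
  obtain ⟨c, hc⟩ : ∃ c : k, c ^ 2 + c + (Q f₁ + Q f) = 0 := by
    have hdeg : (Polynomial.X ^ 2 + Polynomial.X + Polynomial.C (Q f₁ + Q f)).degree ≠
        (0 : WithBot ℕ) := by
      have : (Polynomial.X ^ 2 + Polynomial.X + Polynomial.C (Q f₁ + Q f)).degree =
        (2 : WithBot ℕ) := by compute_degree!
      rw [this]; decide
    obtain ⟨c, hc⟩ := IsAlgClosed.exists_root _ hdeg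
    exact ⟨c, by simpa [Polynomial.IsRoot] using hc⟩
  set f₂ := f₁ + c • r with hf₂
  have hf₂Q : Q f₂ = Q f := by
    rw [hf₂, hQ, hQs, hr, map_smul, hf₁r, smul_eq_mul]
    linear_combination hc - Q f * two
  have hf₂' : ∀ w, B f₂ (i (h w)) = B f (i w) := by
    intro w
    rw [hf₂, map_add, LinearMap.add_apply, hf₁', map_smul, LinearMap.smul_apply, hri]; simp
  let g : V →ₗ[k] V := i.comp (h.comp π) + (B r).smulRight f₂
  have hgv : ∀ v, g v = i (h (π v)) + B r v • f₂ := fun v => by simp [g]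
  have hgi : ∀ w, g (i w) = i (h w) := fun w => by rw [hgv, hπi, hri]; simp
  have hgQ : ∀ v, Q (g v) = Q v := by
    intro v
    have hv : v = i (π v) + B r v • f := by rw [hiπ]; abel
    rw [hgv]
    conv_rhs => rw [hv]
    rw [hQ, hQ, hh, hQs, hQs, hf₂Q, map_smul, map_smul, hsymm _ f₂, hsymm _ f, hf₂']
  have hgr : g r = r := by rw [hrdef, hgi, hhr]
  obtain ⟨g₂, hg₂, hpar⟩ := aux_parity Q B hQ hnd r hr g hgQ hgr
  rcases hpar with hpar | hpar
  · exact ⟨g, hgQ, hgi, hpar⟩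
  · refine ⟨g₂, ?_, ?_, hpar⟩
    · intro v
      have hBg : B (g v) (g r) = B v r := by
        have h1 := hQ v r
        have h2 := hQ (g v) (g r)
        rw [← map_add, hgQ, hgQ, hgQ] at h2
        linear_combination h1 - h2
      rw [hgr] at hBg
      rw [hg₂, hQ, hQs, hgQ, hr, map_smul, hBg, hsymm v r, smul_eq_mul]
      linear_combination (B r v) ^ 2 * two
    · intro w
      rw [hg₂, hgi, hri, zero_smul, add_zero]

lemma aux_stdQ_even {k : Type*} [CommRing k] (μ : ℕ) (v : Fin (2 * (μ + 1)) → k) :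
    stdQ k (2 * (μ + 1)) v =
      ∑ r : Fin (μ + 1), v ⟨2 * r.1, by omega⟩ * v ⟨2 * r.1 + 1, by omega⟩ := by
  unfold stdQ
  rw [dif_neg (by omega), add_zero]
  exact Fintype.sum_equiv (finCongr (by omega)) _ _ (fun r => rfl)

lemma aux_stdQ_odd {k : Type*} [CommRing k] (μ : ℕ) (v : Fin (2 * (μ + 1) - 1) → k) :
    stdQ k (2 * (μ + 1) - 1) v =
      ∑ r : Fin μ, v ⟨2 * r.1, by omega⟩ * v ⟨2 * r.1 + 1, by omega⟩ +
        v ⟨2 * μ, by omega⟩ ^ 2 := by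
  unfold stdQ
  rw [dif_pos (by omega)]
  congr 1
  exact Fintype.sum_equiv (finCongr (by omega)) _ _ (fun r => rfl)

/-- The polar form of `stdQ` in even dimension. -/
def auxB (k : Type*) [CommRing k] (μ : ℕ) :
    (Fin (2 * (μ + 1)) → k) →ₗ[k] (Fin (2 * (μ + 1)) → k) →ₗ[k] k :=
  LinearMap.mk₂ k (fun v w => ∑ r : Fin (μ + 1),
      (v ⟨2 * r.1, by omega⟩ * w ⟨2 * r.1 + 1, by omega⟩
        + v ⟨2 * r.1 + 1, by omega⟩ * w ⟨2 * r.1, by omega⟩))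
    (fun a b c => by
      rw [← Finset.sum_add_distrib]; exact Finset.sum_congr rfl fun r _ => by simp; ring)
    (fun a b c => by
      rw [smul_eq_mul, Finset.mul_sum]; exact Finset.sum_congr rfl fun r _ => by simp; ring)
    (fun a b c => by
      rw [← Finset.sum_add_distrib]; exact Finset.sum_congr rfl fun r _ => by simp; ring)
    (fun a b c => by
      rw [smul_eq_mul, Finset.mul_sum]; exact Finset.sum_congr rfl fun r _ => by simp; ring)

lemma auxB_apply (k : Type*) [CommRing k] (μ : ℕ) (v w : Fin (2 * (μ + 1)) → k) :
    auxB k μ v w = ∑ r : Fin (μ + 1),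
      (v ⟨2 * r.1, by omega⟩ * w ⟨2 * r.1 + 1, by omega⟩
        + v ⟨2 * r.1 + 1, by omega⟩ * w ⟨2 * r.1, by omega⟩) := rfl

lemma auxB_nondeg (k : Type*) [CommRing k] (μ : ℕ) (v : Fin (2 * (μ + 1)) → k)
    (h : ∀ w, auxB k μ v w = 0) : v = 0 := by
  funext j
  obtain ⟨j, hj⟩ := j
  rcases Nat.even_or_odd' j with ⟨s, rfl | rfl⟩
  · have h1 := h (Pi.single ⟨2 * s + 1, by omega⟩ 1)
    rw [auxB_apply, Finset.sum_eq_single ⟨s, by omega⟩] at h1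
    · simpa [Pi.single_apply] using h1
    · intro r _ hr
      have h2 : r.1 ≠ s := fun e => hr (Fin.ext e)
      have h3 : 2 * r.1 ≠ 2 * s + 1 := by omega
      simp [Pi.single_apply, h2, h3]
    · simp
  · have h1 := h (Pi.single ⟨2 * s, by omega⟩ 1)
    rw [auxB_apply, Finset.sum_eq_single ⟨s, by omega⟩] at h1
    · simpa [Pi.single_apply] using h1
    · intro r _ hr
      have h2 : r.1 ≠ s := fun e => hr (Fin.ext e)
      have h3 : 2 * r.1 + 1 ≠ 2 * s := by omega
      simp [Pi.single_apply, h2, h3]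
    · simp

/-- The matrix form of the extension. -/
lemma aux_matrix {k : Type*} [Field k] [IsAlgClosed k] [CharP k 2] (μ : ℕ)
    (g' : Matrix (Fin (2 * (μ + 1) - 1)) (Fin (2 * (μ + 1) - 1)) k) (hg' : inO g') :
    ∃ g : Matrix (Fin (2 * (μ + 1))) (Fin (2 * (μ + 1))) k, inSOeven g ∧
      ∀ (w : Fin (2 * (μ + 1) - 1) → k) (c : Fin (2 * (μ + 1))),
        g.mulVec (fun d => w ⟨min d.1 (2 * (μ + 1) - 2), by omega⟩) c =
          g'.mulVec w ⟨min c.1 (2 * (μ + 1) - 2), by omega⟩ := by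
  have two : (2 : k) = 0 := CharTwo.two_eq_zero
  let i : (Fin (2 * (μ + 1) - 1) → k) →ₗ[k] (Fin (2 * (μ + 1)) → k) :=
    LinearMap.funLeft k k (fun d => ⟨min d.1 (2 * (μ + 1) - 2), by omega⟩)
  let π : (Fin (2 * (μ + 1)) → k) →ₗ[k] (Fin (2 * (μ + 1) - 1) → k) :=
    LinearMap.funLeft k k (fun d => ⟨d.1, by omega⟩)
  have hi : ∀ w d, i w d = w ⟨min d.1 (2 * (μ + 1) - 2), by omega⟩ := fun _ _ => rfl
  have hπ : ∀ v d, π v d = v ⟨d.1, by omega⟩ := fun _ _ => rfl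
  let r₀ : Fin (2 * (μ + 1) - 1) → k := Pi.single ⟨2 * μ, by omega⟩ 1
  let f : Fin (2 * (μ + 1)) → k := Pi.single ⟨2 * μ + 1, by omega⟩ 1
  have hQi : ∀ w, stdQ k (2 * (μ + 1)) (i w) = stdQ k (2 * (μ + 1) - 1) w := by
    intro w
    rw [aux_stdQ_even, aux_stdQ_odd, Fin.sum_univ_castSucc]
    congr 1
    · refine Finset.sum_congr rfl fun r _ => ?_
      rw [hi, hi]
      congr 2 <;> apply Fin.ext <;> simp <;> omega
    · rw [hi, hi, sq]
      congr 2 <;> apply Fin.ext <;> simp <;> omega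
  have hB : ∀ v, auxB k μ (i r₀) v = v ⟨2 * μ, by omega⟩ + v ⟨2 * μ + 1, by omega⟩ := by
    intro v
    rw [auxB_apply, Fin.sum_univ_castSucc, Finset.sum_eq_zero]
    · simp only [hi, r₀, Pi.single_apply, Fin.mk.injEq, Fin.val_last]
      rw [if_pos (by omega), if_pos (by omega)]
      ring
    · intro r _
      have := r.2
      simp only [hi, r₀, Pi.single_apply, Fin.mk.injEq, Fin.val_castSucc]
      rw [if_neg (by omega), if_neg (by omega)]
      ring
  have hQadd : ∀ v w, stdQ k (2 * (μ + 1)) (v + w) =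
      stdQ k (2 * (μ + 1)) v + stdQ k (2 * (μ + 1)) w + auxB k μ v w := by
    intro v w
    rw [aux_stdQ_even, aux_stdQ_even, aux_stdQ_even, auxB_apply, ← Finset.sum_add_distrib,
      ← Finset.sum_add_distrib]
    exact Finset.sum_congr rfl fun r _ => by simp only [Pi.add_apply]; ring
  obtain ⟨g, hgQ, hgi, hev⟩ := aux_extend (stdQ k (2 * (μ + 1))) (auxB k μ) hQadd
    (by
      intro c v
      rw [aux_stdQ_even, aux_stdQ_even, Finset.mul_sum]
      exact Finset.sum_congr rfl fun r _ => by simp only [Pi.smul_apply, smul_eq_mul]; ring)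
    (auxB_nondeg k μ) i π
    (by
      intro w
      funext d
      rw [hπ, hi]
      congr 1; apply Fin.ext; simp; omega)
    r₀ f
    (by
      rw [hQi, aux_stdQ_odd, Finset.sum_eq_zero]
      · simp [r₀]
      · intro r _
        have := r.2
        simp only [r₀, Pi.single_apply, Fin.mk.injEq]
        rw [if_neg (by omega), zero_mul])
    (by
      intro w
      rw [hB, hi, hi]
      have : (⟨min (2 * μ + 1) (2 * (μ + 1) - 2), by omega⟩ : Fin (2 * (μ + 1) - 1)) =
        ⟨min (2 * μ) (2 * (μ + 1) - 2), by omega⟩ := by apply Fin.ext; simp; omega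
      rw [this]
      exact CharTwo.add_self_eq_zero _)
    (by
      rw [hB]
      simp [f, Pi.single_apply])
    (by
      intro v
      funext d
      rw [hi, hπ, hB]
      simp only [Pi.sub_apply, Pi.smul_apply, smul_eq_mul, f, Pi.single_apply]
      by_cases hd : d = ⟨2 * μ + 1, by omega⟩
      · subst hd
        have : (⟨min (2 * μ + 1) (2 * (μ + 1) - 2), by omega⟩ : Fin (2 * (μ + 1))) =
          ⟨2 * μ, by omega⟩ := by apply Fin.ext; simp; omega
        rw [this, if_pos rfl]
        linear_combination v ⟨2 * μ, by omega⟩ * two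
      · rw [if_neg hd, mul_zero, sub_zero]
        congr 1
        apply Fin.ext
        have : d.1 ≠ 2 * μ + 1 := fun e => hd (Fin.ext e)
        have := d.2
        simp; omega)
    (Matrix.mulVecLin g')
    (by
      have := Matrix.mulVec_injective_iff_isUnit.2 ((Matrix.isUnit_iff_isUnit_det g').2 hg'.1)
      exact this)
    (by
      intro w
      rw [hQi, hQi]
      exact hg'.2 w)
  refine ⟨LinearMap.toMatrix' g, ⟨⟨?_, ?_⟩, ?_⟩, ?_⟩
  · rw [← Matrix.isUnit_iff_isUnit_det, ← Matrix.mulVec_injective_iff_isUnit]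
    intro a b hab
    simp only [LinearMap.toMatrix'_mulVec] at hab
    have hinj : Function.Injective g := by
      rw [← LinearMap.ker_eq_bot, LinearMap.ker_eq_bot']
      intro v hv
      apply auxB_nondeg
      intro w
      have h1 := hQadd v w
      have h2 := hQadd (g v) (g w)
      rw [← map_add, hgQ, hgQ, hgQ, hv, map_zero] at h2
      simp only [LinearMap.zero_apply] at h2
      linear_combination h2 - h1
    exact hinj hab
  · intro v
    rw [LinearMap.toMatrix'_mulVec, hgQ]
  · have : (LinearMap.toMatrix' g - 1).rank =
        Module.finrank k (LinearMap.range (g - LinearMap.id)) := by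
      rw [← LinearMap.toMatrix'_id, ← map_sub, Matrix.rank, ← Matrix.toLin'_apply',
        Matrix.toLin'_toMatrix']
    rw [this]; exact hev
  · intro w c
    rw [LinearMap.toMatrix'_mulVec]
    exact congrFun (hgi w) c

/-- Substituting `z` for `x_ν` and `y_ν` maps every `SO(2ν)`-invariant polynomial over an
algebraically closed field of characteristic 2 to an `O(2ν−1)`-invariant polynomial, without
increasing the degree. -/
theorem substZ_invariant
    (k : Type*) [Field k] [IsAlgClosed k] [CharP k 2]
    (m ν : ℕ) (hν : 1 ≤ ν)
    (p : MvPolynomial (Fin m × Fin (2*ν)) k)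
    (hinv : ∀ g : Matrix (Fin (2*ν)) (Fin (2*ν)) k, inSOeven g → substAct g p = p) :
    (∀ g' : Matrix (Fin (2*ν-1)) (Fin (2*ν-1)) k, inO g' →
      substAct g' (substZ m ν hν p) = substZ m ν hν p) ∧
    (substZ m ν hν p).totalDegree ≤ p.totalDegree := by
  constructor
  · intro g' hg'
    obtain ⟨μ, rfl⟩ : ∃ μ, ν = μ + 1 := ⟨ν - 1, by omega⟩
    obtain ⟨g, hg, hcomm⟩ := aux_matrix μ g' hg'
    conv_rhs => rw [← hinv g hg]
    have key : (substAct g').comp (substZ m (μ + 1) hν) =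
        (substZ m (μ + 1) hν).comp (substAct (m := m) g) := by
      apply MvPolynomial.algHom_ext
      rintro ⟨a, c⟩
      have hcoef : ∀ e, g' ⟨min c.1 (2 * (μ + 1) - 2), by omega⟩ e =
          ∑ d, if (⟨min d.1 (2 * (μ + 1) - 2), by omega⟩ : Fin (2 * (μ + 1) - 1)) = e
            then g c d else 0 := by
        intro e
        have := hcomm (Pi.single e 1) c
        rw [Matrix.mulVec_single_one] at this
        simp only [Matrix.col_apply] at this
        rw [← this]
        simp [Matrix.mulVec, dotProduct, Pi.single_apply]
      simp only [AlgHom.comp_apply, substZ, substAct, aeval_X, map_sum, map_mul, algHom_C,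
        algebraMap_eq]
      simp only [hcoef, map_sum, Finset.sum_mul]
      rw [Finset.sum_comm]
      refine Finset.sum_congr rfl fun d _ => ?_
      rw [Finset.sum_eq_single ⟨min d.1 (2 * (μ + 1) - 2), by omega⟩]
      · rw [if_pos rfl]
      · intro b _ hb
        rw [if_neg (Ne.symm hb)]; simp
      · simp
    exact DFunLike.congr_fun key p
  · have : substZ m ν hν p = rename (fun ic : Fin m × Fin (2 * ν) =>
        ((ic.1, ⟨min ic.2.1 (2*ν-2), by have := ic.2.2; omega⟩) : Fin m × Fin (2*ν-1))) p := by
      refine DFunLike.congr_fun (f := substZ m ν hν) (g := rename _) ?_ p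
      apply MvPolynomial.algHom_ext
      intro ic
      simp [substZ]
    rw [this]
    exact totalDegree_rename_le _ _
end

section
/- Let m ≥ n ≥ 4 both be even. The m-linear SO(n)-invariant f over an algebraically closed field of characteristic 2, defined as the reduction mod 2 of (Pf − Σ_π sgn(π) D^{(π(1),…,π(n))} Pf^{(π(n+1),…,π(m))})/2^{μ−ν+1}, is indecomposable in R^{SO(n)}. -/
open MvPolynomial

/-- Permutations giving a canonical perfect matching: σ(2i) < σ(2i+1) and σ(2i) increasing. -/
def pfPerms (μ : ℕ) : Finset (Equiv.Perm (Fin (2*μ))) :=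
  Finset.univ.filter fun σ =>
    (∀ i : Fin μ, σ ⟨2*i.1, by have := i.2; omega⟩ < σ ⟨2*i.1+1, by have := i.2; omega⟩) ∧
    (∀ i j : Fin μ, i < j →
      σ ⟨2*i.1, by have := i.2; omega⟩ < σ ⟨2*j.1, by have := j.2; omega⟩)


/-- The Pfaffian of a `2μ × 2μ` matrix (intended for skew-symmetric matrices). -/
def pfaffian {R : Type*} [CommRing R] {μ : ℕ} (A : Matrix (Fin (2*μ)) (Fin (2*μ)) R) : R :=
  ∑ σ ∈ pfPerms μ, (Equiv.Perm.sign σ : ℤ) •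
    ∏ i : Fin μ, A (σ ⟨2*i.1, by have := i.2; omega⟩) (σ ⟨2*i.1+1, by have := i.2; omega⟩)


/-- The polarized scalar product `B⁽ⁱʲ⁾` of the generic vectors `v⁽ⁱ⁾` and `v⁽ʲ⁾`. -/
noncomputable def Bpoly (n m : ℕ) (i j : Fin m) : MvPolynomial (Fin m × Fin n) ℤ :=
  (∑ r : Fin (n/2),
      (X (i, ⟨2*r.1, by have := r.2; omega⟩) * X (j, ⟨2*r.1+1, by have := r.2; omega⟩)
       + X (i, ⟨2*r.1+1, by have := r.2; omega⟩) * X (j, ⟨2*r.1, by have := r.2; omega⟩)))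
  + if h : n % 2 = 1 then 2 * X (i, ⟨n-1, by omega⟩) * X (j, ⟨n-1, by omega⟩) else 0


/-- The `2μ × 2μ` skew-symmetric matrix of the `B⁽ⁱʲ⁾`. -/
noncomputable def Bmat (n μ : ℕ) :
    Matrix (Fin (2*μ)) (Fin (2*μ)) (MvPolynomial (Fin (2*μ) × Fin n) ℤ) :=
  fun i j => if i < j then Bpoly n (2*μ) i j else if j < i then -(Bpoly n (2*μ) j i) else 0


/-- The determinant `D^{(w(1),…,w(n))}` of the matrix whose columns are the generic vectors
`v^{(w 1)}, …, v^{(w n)}`. -/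
noncomputable def Dpoly (n m : ℕ) (w : Fin n → Fin m) : MvPolynomial (Fin m × Fin n) ℤ :=
  Matrix.det (Matrix.of fun a b : Fin n => (X (w b, a) : MvPolynomial (Fin m × Fin n) ℤ))


/-- The alternating sum `Σ_π sgn(π) · D^{(π(1),…,π(n))} · Pf^{(π(n+1),…,π(m))}` over permutations
`π` of `{1,…,m}` increasing on the first `n` and on the last `m−n` positions. -/
noncomputable def DPfSum (n m : ℕ) (hnm : n ≤ m) : MvPolynomial (Fin m × Fin n) ℤ :=
  ∑ σ ∈ (Finset.univ.filter fun σ : Equiv.Perm (Fin m) =>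
      (∀ i j : Fin m, i < j → j.1 < n → σ i < σ j) ∧
      (∀ i j : Fin m, i < j → n ≤ i.1 → σ i < σ j)),
    (Equiv.Perm.sign σ : ℤ) •
      (Dpoly n m (fun a => σ ⟨a.1, by have := a.2; omega⟩) *
       pfaffian (μ := (m - n)/2) (fun a b =>
         if a < b then
           Bpoly n m (σ ⟨n + a.1, by have := a.2; omega⟩) (σ ⟨n + b.1, by have := b.2; omega⟩)
         else if b < a then
           -(Bpoly n m (σ ⟨n + b.1, by have := b.2; omega⟩) (σ ⟨n + a.1, by have := a.2; omega⟩))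
         else 0))


namespace FInd

lemma pf_low {μ : ℕ} {σ : Equiv.Perm (Fin (2*μ))} (hσ : σ ∈ pfPerms μ) (y : Fin (2*μ))
    (hy : ∀ x, x < y → σ x = x) :
    (∀ e : Fin (2*μ), y ≤ e → y ≤ σ e) ∧
    (∀ e : Fin (2*μ), e.1 % 2 = 0 → e ≤ σ.symm y → σ e ≤ y) := by
  simp only [pfPerms, Finset.mem_filter, Finset.mem_univ, true_and] at hσ
  obtain ⟨h1, h2⟩ := hσ
  constructor
  · intro e he
    by_contra hlt
    push Not at hlt
    have h3 := hy _ hlt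
    have h4 := σ.injective h3
    rw [h4] at hlt
    exact absurd he (not_le.mpr hlt)
  · intro e he hle
    have hx : σ (σ.symm y) = y := by simp
    generalize σ.symm y = x at hle hx
    have hmono : ∀ a c : Fin (2*μ), a.1 % 2 = 0 → c.1 % 2 = 0 → a ≤ c → σ a ≤ σ c := by
      intro a c ha hc hac
      rcases eq_or_lt_of_le hac with h | h
      · rw [h]
      · have := h2 ⟨a.1/2, by omega⟩ ⟨c.1/2, by omega⟩ (by
          simp only [Fin.lt_def] at h ⊢; omega)
        have e1 : (⟨2*(a.1/2), by omega⟩ : Fin (2*μ)) = a := Fin.ext (by simp; omega)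
        have e2 : (⟨2*(c.1/2), by omega⟩ : Fin (2*μ)) = c := Fin.ext (by simp; omega)
        simp only [e1, e2] at this
        exact this.le
    rcases Nat.mod_two_eq_zero_or_one x.1 with h | h
    · rw [← hx]; exact hmono _ _ he h hle
    · have h3 := h1 ⟨x.1/2, by omega⟩
      have e2 : (⟨2*(x.1/2)+1, by omega⟩ : Fin (2*μ)) = x := Fin.ext (by simp; omega)
      simp only [e2] at h3
      have h4 := hmono e ⟨2*(x.1/2), by omega⟩ he (by simp) (by
        simp only [Fin.le_def] at hle ⊢; omega)
      rw [← hx]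
      exact h4.trans h3.le

/-- `i` is the first index at which the matching differs from the standard one. -/
def IsFirst {μ : ℕ} (σ : Equiv.Perm (Fin (2*μ))) (i : Fin μ) : Prop :=
  σ ⟨2*i.1+1, by omega⟩ ≠ ⟨2*i.1+1, by omega⟩ ∧
  ∀ j : Fin μ, j < i → σ ⟨2*j.1+1, by omega⟩ = ⟨2*j.1+1, by omega⟩

lemma isFirst_unique {μ : ℕ} {σ : Equiv.Perm (Fin (2*μ))} {i j : Fin μ}
    (hi : IsFirst σ i) (hj : IsFirst σ j) : i = j := by
  rcases lt_trichotomy i j with h | h | h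
  · exact absurd (hj.2 i h) hi.1
  · exact h
  · exact absurd (hi.2 j h) hj.1

lemma fix_below {μ : ℕ} {σ : Equiv.Perm (Fin (2*μ))} (hσ : σ ∈ pfPerms μ) (i : ℕ)
    (h : ∀ j : Fin μ, j.1 < i → σ ⟨2*j.1+1, by omega⟩ = ⟨2*j.1+1, by omega⟩) :
    ∀ y : ℕ, ∀ hy : y < 2*μ, y ≤ 2*i → σ ⟨y, hy⟩ = ⟨y, hy⟩ := by
  intro y
  induction y using Nat.strong_induction_on with
  | _ y ih =>
    intro hy hyi
    rcases Nat.mod_two_eq_zero_or_one y with h0 | h0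
    · have hlow : ∀ x, x < (⟨y, hy⟩ : Fin (2*μ)) → σ x = x := by
        intro x hx
        exact ih x.1 hx x.2 (by have : x.1 < y := hx; omega)
      obtain ⟨l1, l2⟩ := pf_low hσ ⟨y, hy⟩ hlow
      refine le_antisymm (l2 _ h0 ?_) (l1 _ le_rfl)
      by_contra hlt
      push Not at hlt
      have := hlow _ hlt
      rw [Equiv.apply_symm_apply] at this
      rw [← this] at hlt
      exact lt_irrefl _ hlt
    · have := h ⟨y/2, by omega⟩ (by simp; omega)
      have e2 : (⟨2*(y/2)+1, by omega⟩ : Fin (2*μ)) = ⟨y, hy⟩ := Fin.ext (by simp; omega)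
      simpa only [e2] using this

lemma exists_isFirst {μ : ℕ} {σ : Equiv.Perm (Fin (2*μ))} (hσ : σ ∈ pfPerms μ) (h1 : σ ≠ 1) :
    ∃ i, IsFirst σ i := by
  by_contra hno
  apply h1
  have key : ∀ j : Fin μ, σ ⟨2*j.1+1, by omega⟩ = ⟨2*j.1+1, by omega⟩ := by
    intro j
    induction j using WellFoundedLT.induction with
    | _ j ih =>
      by_contra hj
      exact hno ⟨j, hj, ih⟩
  ext x
  have := fix_below hσ μ (fun j _ => key j) x.1 x.2 (by omega)
  simp [this]

lemma isFirst_spec {μ : ℕ} {σ : Equiv.Perm (Fin (2*μ))} (hσ : σ ∈ pfPerms μ) {i : Fin μ}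
    (hi : IsFirst σ i) :
    ∃ h : i.1 + 1 < μ, σ ⟨2*i.1, by omega⟩ = ⟨2*i.1, by omega⟩ ∧
      σ ⟨2*(i.1+1), by omega⟩ = ⟨2*i.1+1, by omega⟩ := by
  have hb := fix_below hσ i.1 hi.2
  have hy : 2*i.1+1 < 2*μ := by omega
  have hlow : ∀ x, x < (⟨2*i.1+1, hy⟩ : Fin (2*μ)) → σ x = x := by
    intro x hx
    have : x.1 < 2*i.1+1 := hx
    exact hb x.1 x.2 (by omega)
  obtain ⟨l1, l2⟩ := pf_low hσ ⟨2*i.1+1, hy⟩ hlow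
  have hx : σ (σ.symm ⟨2*i.1+1, hy⟩) = ⟨2*i.1+1, hy⟩ := by simp
  generalize hxx : σ.symm ⟨2*i.1+1, hy⟩ = x at hx l2
  have hx2 : 2*i.1+1 < x.1 := by
    by_contra hlt
    rcases Nat.lt_or_ge x.1 (2*i.1+1) with h | h
    · have := hlow x h
      rw [this] at hx
      rw [hx] at h; simp at h
    · have : x = ⟨2*i.1+1, hy⟩ := Fin.ext (by simp; omega)
      rw [this] at hx
      exact hi.1 hx
  have hlt : i.1 + 1 < μ := by have := x.2; omega
  refine ⟨hlt, hb _ _ le_rfl, le_antisymm (l2 _ (by simp) ?_) (l1 _ ?_)⟩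
  · rw [Fin.le_def]; simp only; omega
  · rw [Fin.le_def]; simp only; omega

/-- Exchange the partners of the edges number `i` and `i+1`. -/
def flip {μ : ℕ} (σ : Equiv.Perm (Fin (2*μ))) (i : Fin μ) (h : i.1 + 1 < μ) :
    Equiv.Perm (Fin (2*μ)) :=
  σ * Equiv.swap ⟨2*i.1+1, by omega⟩ ⟨2*(i.1+1)+1, by omega⟩

lemma flip_even {μ : ℕ} (σ : Equiv.Perm (Fin (2*μ))) (i : Fin μ) (h : i.1 + 1 < μ) (j : Fin μ) :
    flip σ i h ⟨2*j.1, by omega⟩ = σ ⟨2*j.1, by omega⟩ := by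
  simp only [flip, Equiv.Perm.mul_apply]
  rw [Equiv.swap_apply_of_ne_of_ne] <;> (simp; try omega)

lemma flip_odd {μ : ℕ} (σ : Equiv.Perm (Fin (2*μ))) (i : Fin μ) (h : i.1 + 1 < μ) (j : Fin μ)
    (h1 : j.1 ≠ i.1) (h2 : j.1 ≠ i.1 + 1) :
    flip σ i h ⟨2*j.1+1, by omega⟩ = σ ⟨2*j.1+1, by omega⟩ := by
  simp only [flip, Equiv.Perm.mul_apply]
  rw [Equiv.swap_apply_of_ne_of_ne] <;> (simp; try omega)

lemma flip_left {μ : ℕ} (σ : Equiv.Perm (Fin (2*μ))) (i : Fin μ) (h : i.1 + 1 < μ) :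
    flip σ i h ⟨2*i.1+1, by omega⟩ = σ ⟨2*(i.1+1)+1, by omega⟩ := by
  simp [flip]

lemma flip_right {μ : ℕ} (σ : Equiv.Perm (Fin (2*μ))) (i : Fin μ) (h : i.1 + 1 < μ) :
    flip σ i h ⟨2*(i.1+1)+1, by omega⟩ = σ ⟨2*i.1+1, by omega⟩ := by
  simp [flip]

lemma gt_of_isFirst {μ : ℕ} {σ : Equiv.Perm (Fin (2*μ))} (hσ : σ ∈ pfPerms μ) {i : Fin μ}
    (hi : IsFirst σ i) (h : i.1 + 1 < μ) :
    2*i.1+1 < (σ ⟨2*i.1+1, by omega⟩).1 ∧ 2*i.1+1 < (σ ⟨2*(i.1+1)+1, by omega⟩).1 := by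
  obtain ⟨_, s1, s2⟩ := isFirst_spec hσ hi
  have hσ' := hσ
  simp only [pfPerms, Finset.mem_filter, Finset.mem_univ, true_and] at hσ'
  have a1 := hσ'.1 i
  have a2 := hσ'.1 ⟨i.1+1, h⟩
  have a3 := hi.1
  simp only [s1, s2, Fin.lt_def] at a1 a2
  rw [Ne, Fin.ext_iff] at a3
  simp only at a3
  exact ⟨by omega, a2⟩

lemma flip_mem {μ : ℕ} {σ : Equiv.Perm (Fin (2*μ))} (hσ : σ ∈ pfPerms μ) {i : Fin μ}
    (hi : IsFirst σ i) (h : i.1 + 1 < μ) : flip σ i h ∈ pfPerms μ := by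
  obtain ⟨g1, g2⟩ := gt_of_isFirst hσ hi h
  obtain ⟨_, s1, s2⟩ := isFirst_spec hσ hi
  have hσ' := hσ
  simp only [pfPerms, Finset.mem_filter, Finset.mem_univ, true_and] at hσ' ⊢
  refine ⟨fun j => ?_, fun j l hjl => ?_⟩
  · rw [flip_even]
    by_cases hj : j = i
    · subst hj
      rw [flip_left, s1, Fin.lt_def]
      exact lt_trans (by simp) g2
    by_cases hj' : j.1 = i.1 + 1
    · have : j = ⟨i.1+1, h⟩ := Fin.ext hj'
      subst this
      simp only
      rw [flip_right, s2, Fin.lt_def]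
      exact g1
    · rw [flip_odd σ i h j (fun hh => hj (Fin.ext hh)) hj']
      exact hσ'.1 j
  · rw [flip_even, flip_even]; exact hσ'.2 j l hjl

lemma flip_isFirst {μ : ℕ} {σ : Equiv.Perm (Fin (2*μ))} (hσ : σ ∈ pfPerms μ) {i : Fin μ}
    (hi : IsFirst σ i) (h : i.1 + 1 < μ) : IsFirst (flip σ i h) i := by
  obtain ⟨g1, g2⟩ := gt_of_isFirst hσ hi h
  refine ⟨?_, fun j hj => ?_⟩
  · rw [flip_left, Ne, Fin.ext_iff]
    exact g2.ne'
  · have : j.1 < i.1 := hj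
    rw [flip_odd σ i h j (by omega) (by omega)]
    exact hi.2 j hj

lemma flip_flip {μ : ℕ} (σ : Equiv.Perm (Fin (2*μ))) (i : Fin μ) (h : i.1 + 1 < μ) :
    flip (flip σ i h) i h = σ := by
  simp [flip, mul_assoc]

lemma flip_sign {μ : ℕ} (σ : Equiv.Perm (Fin (2*μ))) (i : Fin μ) (h : i.1 + 1 < μ) :
    Equiv.Perm.sign (flip σ i h) = - Equiv.Perm.sign σ := by
  rw [flip, Equiv.Perm.sign_mul, Equiv.Perm.sign_swap]
  · simp
  · simp

theorem pfaffian_eq_prod {R : Type*} [CommRing R] {μ : ℕ}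
    (A : Matrix (Fin (2*μ)) (Fin (2*μ)) R)
    (hA : ∀ i : Fin μ, ∀ a b : Fin (2*μ), 2*i.1+1 < a.1 → 2*i.1+1 < b.1 →
      A ⟨2*i.1, by omega⟩ a * A ⟨2*i.1+1, by omega⟩ b =
      A ⟨2*i.1, by omega⟩ b * A ⟨2*i.1+1, by omega⟩ a) :
    pfaffian A = ∏ i : Fin μ, A ⟨2*i.1, by omega⟩ ⟨2*i.1+1, by omega⟩ := by
  have h1 : (1 : Equiv.Perm (Fin (2*μ))) ∈ pfPerms μ := by
    simp only [pfPerms, Finset.mem_filter, Finset.mem_univ, true_and, Equiv.Perm.one_apply,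
      Fin.lt_def]
    constructor
    · intro i; omega
    · intro i j h; omega
  unfold pfaffian
  rw [← Finset.add_sum_erase _ _ h1]
  have hz : ∑ σ ∈ (pfPerms μ).erase 1, (Equiv.Perm.sign σ : ℤ) •
      ∏ i : Fin μ, A (σ ⟨2*i.1, by omega⟩) (σ ⟨2*i.1+1, by omega⟩) = 0 := by
    have hex : ∀ σ ∈ (pfPerms μ).erase 1, ∃ i, IsFirst σ i := fun σ hσ =>
      exists_isFirst (Finset.mem_of_mem_erase hσ) (Finset.ne_of_mem_erase hσ)
    choose idx hidx using hex
    have hlt : ∀ σ (hσ : σ ∈ (pfPerms μ).erase 1), (idx σ hσ).1 + 1 < μ := fun σ hσ =>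
      (isFirst_spec (Finset.mem_of_mem_erase hσ) (hidx σ hσ)).1
    have hmem : ∀ σ (hσ : σ ∈ (pfPerms μ).erase 1),
        flip σ (idx σ hσ) (hlt σ hσ) ∈ (pfPerms μ).erase 1 := by
      intro σ hσ
      refine Finset.mem_erase.mpr ⟨?_, flip_mem (Finset.mem_of_mem_erase hσ) (hidx σ hσ) _⟩
      intro h
      have := (flip_isFirst (Finset.mem_of_mem_erase hσ) (hidx σ hσ) (hlt σ hσ)).1
      rw [h] at this
      simp at this
    refine Finset.sum_involution (fun σ hσ => flip σ (idx σ hσ) (hlt σ hσ)) ?_ ?_ hmem ?_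
    · intro σ hσ
      have hσp := Finset.mem_of_mem_erase hσ
      suffices H : ∀ (i : Fin μ) (_ : IsFirst σ i) (hl : i.1 + 1 < μ),
          (Equiv.Perm.sign σ : ℤ) •
            ∏ i : Fin μ, A (σ ⟨2*i.1, by omega⟩) (σ ⟨2*i.1+1, by omega⟩) +
          (Equiv.Perm.sign (flip σ i hl) : ℤ) •
            ∏ j : Fin μ, A (flip σ i hl ⟨2*j.1, by omega⟩) (flip σ i hl ⟨2*j.1+1, by omega⟩) = 0
        from H _ (hidx σ hσ) (hlt σ hσ)
      intro i hi hl
      obtain ⟨g1, g2⟩ := gt_of_isFirst hσp hi hl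
      obtain ⟨_, s1, s2⟩ := isFirst_spec hσp hi
      have hp : ∏ j : Fin μ, A (flip σ i hl ⟨2*j.1, by omega⟩) (flip σ i hl ⟨2*j.1+1, by omega⟩)
          = ∏ j : Fin μ, A (σ ⟨2*j.1, by omega⟩) (σ ⟨2*j.1+1, by omega⟩) := by
        have hm : (⟨i.1+1, hl⟩ : Fin μ) ∈ Finset.univ.erase i := by
          simp [Fin.ext_iff]
        rw [← Finset.mul_prod_erase _ _ (Finset.mem_univ i), ← Finset.mul_prod_erase _ _ hm]
        rw [← Finset.mul_prod_erase (Finset.univ) (fun j : Fin μ =>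
          A (σ ⟨2*j.1, by omega⟩) (σ ⟨2*j.1+1, by omega⟩)) (Finset.mem_univ i),
          ← Finset.mul_prod_erase _ _ hm]
        rw [← mul_assoc, ← mul_assoc]
        congr 1
        · have e3 := flip_even σ i hl ⟨i.1+1, hl⟩
          simp only at e3
          rw [flip_even, flip_left, e3, flip_right, s1, s2]
          exact hA i _ _ g2 g1
        · refine Finset.prod_congr rfl fun j hj => ?_
          simp only [Finset.mem_erase, Finset.mem_univ, and_true, Ne, Fin.ext_iff] at hj
          rw [flip_even, flip_odd σ i hl j hj.2 hj.1]
      rw [hp, flip_sign]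
      simp
    · intro σ hσ _ heq
      have := congrArg Equiv.Perm.sign heq
      rw [flip_sign] at this
      rcases Int.units_eq_one_or (Equiv.Perm.sign σ) with h | h <;> simp [h] at this
    · intro σ hσ
      have hf := flip_isFirst (Finset.mem_of_mem_erase hσ) (hidx σ hσ) (hlt σ hσ)
      have he := isFirst_unique (hidx _ (hmem σ hσ)) hf
      have : ∀ (j : Fin μ) (hj : j.1 + 1 < μ), j = idx σ hσ →
          flip (flip σ (idx σ hσ) (hlt σ hσ)) j hj = σ := by
        intro j hj hji
        subst hji
        exact flip_flip _ _ _
      exact this _ _ he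
  rw [hz, add_zero]
  simp

end FInd
namespace FInd

/-- block number of position `p` -/
def rr (ν p : ℕ) : ℕ := min (p/2) (ν-2)

/-- the test vectors: `e_r` at the head `2r` of the block `r`, `e_r + f_r` elsewhere. -/
def tv (R : Type*) [CommRing R] (ν p : ℕ) : Fin (2*ν) → R := fun c =>
  if c.1/2 = rr ν p then (if c.1 % 2 = 0 then 1 else if p = 2 * rr ν p then 0 else 1) else 0

/-- evaluation of the generic vectors at `v i * X i`. -/
noncomputable def Phi {B : Type*} [CommRing B] {m n : ℕ} (v : Fin m → Fin n → B) :
    MvPolynomial (Fin m × Fin n) B →ₐ[B] MvPolynomial (Fin m) B :=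
  MvPolynomial.aeval fun ic => C (v ic.1 ic.2) * X ic.1

lemma Phi_X {B : Type*} [CommRing B] {m n : ℕ} (v : Fin m → Fin n → B) (ic) :
    Phi v (X ic) = C (v ic.1 ic.2) * X ic.1 := by simp [Phi]

/-- second coordinate of the test vector -/
def bb (ν p : ℕ) : ℤ := if p = 2 * rr ν p then 0 else 1

lemma Phi_Bpoly (ν μ : ℕ) (hν : 2 ≤ ν) (i j : Fin (2*μ)) :
    Phi (fun i : Fin (2*μ) => tv ℤ ν i.1) (Bpoly (2*ν) (2*μ) i j) =
      C (if rr ν i.1 = rr ν j.1 then bb ν i.1 + bb ν j.1 else 0) * (X i * X j) := by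
  have hr : rr ν i.1 < 2*ν/2 := by unfold rr; omega
  rw [Bpoly, dif_neg (by omega), add_zero, map_sum]
  rw [Finset.sum_eq_single (⟨rr ν i.1, hr⟩ : Fin (2*ν/2))]
  · simp only [map_add, map_mul, Phi_X]
    have h1 : (2 * rr ν i.1 + 1)/2 = rr ν i.1 := by omega
    have h2 : (2 * rr ν i.1 + 1) % 2 = 1 := by omega
    simp only [tv, h1, h2]
    by_cases h : rr ν i.1 = rr ν j.1
    · simp only [h, bb]
      simp only [if_true, Nat.mul_mod_right, Nat.mul_div_cancel_left _ (Nat.zero_lt_two)]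
      simp only [one_ne_zero, if_false, map_add, C_1]
      split_ifs <;> simp <;> ring
    · simp [h]
  · intro r _ hne
    have : r.1 ≠ rr ν i.1 := fun h => hne (Fin.ext h)
    have h1 : (2 * r.1 + 1)/2 = r.1 := by omega
    simp only [map_add, map_mul, Phi_X, tv, h1]
    simp [this]
  · intro h; exact absurd (Finset.mem_univ _) h

lemma Phi_Dpoly (ν μ : ℕ) (hν : 2 ≤ ν) (w : Fin (2*ν) → Fin (2*μ)) :
    Phi (fun i : Fin (2*μ) => tv ℤ ν i.1) (Dpoly (2*ν) (2*μ) w) = 0 := by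
  rw [Dpoly, AlgHom.map_det]
  apply Matrix.det_eq_zero_of_row_eq_zero (⟨2*ν-1, by omega⟩ : Fin (2*ν))
  intro j
  simp only [AlgHom.mapMatrix_apply, Matrix.map_apply, Matrix.of_apply, Phi_X, tv]
  rw [if_neg (by unfold rr; omega)]
  simp

lemma Phi_pfaffian (ν μ : ℕ) (hν : 2 ≤ ν) (hμν : ν ≤ μ) :
    Phi (fun i : Fin (2*μ) => tv ℤ ν i.1) (pfaffian (Bmat (2*ν) μ)) =
      2 ^ (μ - ν + 1) * ∏ i : Fin (2*μ), X i := by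
  have h1 : Phi (fun i : Fin (2*μ) => tv ℤ ν i.1) (pfaffian (Bmat (2*ν) μ)) =
      pfaffian (fun i j => Phi (fun i : Fin (2*μ) => tv ℤ ν i.1) (Bmat (2*ν) μ i j)) := by
    simp [pfaffian, map_sum, map_prod]
  have hup : ∀ i j : Fin (2*μ), i < j →
      Phi (fun i : Fin (2*μ) => tv ℤ ν i.1) (Bmat (2*ν) μ i j) =
      C (if rr ν i.1 = rr ν j.1 then bb ν i.1 + bb ν j.1 else 0) * (X i * X j) := by
    intro i j hij
    rw [Bmat, if_pos hij, Phi_Bpoly ν μ hν]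
  refine h1.trans ((pfaffian_eq_prod _ ?_).trans ?_)
  rotate_left
  · have h2 : ∀ i : Fin μ, Phi (fun i : Fin (2*μ) => tv ℤ ν i.1)
        (Bmat (2*ν) μ ⟨2*i.1, by omega⟩ ⟨2*i.1+1, by omega⟩) =
        (if i.1 < ν - 1 then 1 else 2) * (X ⟨2*i.1, by omega⟩ * X ⟨2*i.1+1, by omega⟩) := by
      intro i
      rw [hup _ _ (by simp [Fin.lt_def])]
      congr 1
      have e : rr ν (2*i.1) = rr ν (2*i.1+1) := by unfold rr; omega
      simp only [e, if_true, bb]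
      have e2 : ¬ (2*i.1+1 = 2 * rr ν (2*i.1+1)) := by omega
      rw [if_neg e2]
      by_cases h : i.1 < ν - 1
      · rw [if_pos (by unfold rr; omega), if_pos h]; simp
      · rw [if_neg (by unfold rr; omega), if_neg h]; norm_num
    rw [Finset.prod_congr rfl (fun i _ => h2 i), Finset.prod_mul_distrib]
    congr 1
    · rw [Finset.prod_ite, Finset.prod_const_one, one_mul, Finset.prod_const]
      congr 1
      have := Fin.card_filter_val_lt (n := μ) (m := ν - 1)
      have h3 := Finset.card_filter_add_card_filter_not (s := (Finset.univ : Finset (Fin μ)))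
        (fun i => i.1 < ν - 1)
      rw [Finset.card_univ, Fintype.card_fin] at h3
      omega
    · rw [Finset.prod_mul_distrib]
      have := (finProdFinEquiv (m := μ) (n := 2)).prod_comp
        (fun i : Fin (μ*2) => (X (Fin.cast (Nat.mul_comm _ _) i) : MvPolynomial (Fin (2*μ)) ℤ))
      have h4 := (finCongr (Nat.mul_comm μ 2)).prod_comp
        (fun i : Fin (2*μ) => (X i : MvPolynomial (Fin (2*μ)) ℤ))
      rw [← h4]
      simp only [finCongr_apply]
      rw [← this, Fintype.prod_prod_type, ← Finset.prod_mul_distrib]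
      refine Finset.prod_congr rfl fun i _ => ?_
      rw [Fin.prod_univ_two]
      congr 2 <;> (apply Fin.ext; simp [finProdFinEquiv]; try omega)
  · intro i a b ha hb
    have hia : (⟨2*i.1, by omega⟩ : Fin (2*μ)) < a := by rw [Fin.lt_def]; simp only; omega
    have hib : (⟨2*i.1, by omega⟩ : Fin (2*μ)) < b := by rw [Fin.lt_def]; simp only; omega
    rw [hup _ _ hia, hup _ _ hib, hup ⟨2*i.1+1, _⟩ a ha, hup ⟨2*i.1+1, _⟩ b hb]
    have e : rr ν (2*i.1) = rr ν (2*i.1+1) := by unfold rr; omega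
    simp only [e]
    by_cases h1 : rr ν (2*i.1+1) = rr ν a.1
    · by_cases h2 : rr ν (2*i.1+1) = rr ν b.1
      · rw [if_pos h1, if_pos h2, if_pos h1, if_pos h2]
        have ba : bb ν a.1 = 1 := by
          unfold bb; rw [if_neg]; unfold rr at *; omega
        have bb' : bb ν b.1 = 1 := by
          unfold bb; rw [if_neg]; unfold rr at *; omega
        rw [ba, bb']; ring
      · simp only [if_neg h2]; simp
    · simp only [if_neg h1]; simp

lemma Phi_ft (ν μ : ℕ) (hν : 2 ≤ ν) (hμν : ν ≤ μ)
    (ft : MvPolynomial (Fin (2*μ) × Fin (2*ν)) ℤ)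
    (hf : (2 ^ (μ - ν + 1) : MvPolynomial (Fin (2*μ) × Fin (2*ν)) ℤ) * ft =
      pfaffian (Bmat (2*ν) μ) - DPfSum (2*ν) (2*μ) (Nat.mul_le_mul_left 2 hμν)) :
    Phi (fun i : Fin (2*μ) => tv ℤ ν i.1) ft = ∏ i : Fin (2*μ), X i := by
  have h := congrArg (Phi (fun i : Fin (2*μ) => tv ℤ ν i.1)) hf
  rw [map_sub, Phi_pfaffian ν μ hν hμν, DPfSum, map_sum, Finset.sum_eq_zero, sub_zero, map_mul,
    map_pow] at h
  · have h2 : Phi (fun i : Fin (2*μ) => tv ℤ ν i.1) 2 = 2 := map_ofNat _ 2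
    rw [h2] at h
    exact mul_left_cancel₀ (pow_ne_zero _ (by norm_num)) h
  · intro σ _
    rw [map_zsmul, map_mul, Phi_Dpoly ν μ hν, zero_mul, smul_zero]

lemma Phi_map (k : Type*) [Field k] (ν μ : ℕ) (p : MvPolynomial (Fin (2*μ) × Fin (2*ν)) ℤ) :
    Phi (fun i : Fin (2*μ) => tv k ν i.1) (MvPolynomial.map (Int.castRingHom k) p) =
    MvPolynomial.map (Int.castRingHom k) (Phi (fun i : Fin (2*μ) => tv ℤ ν i.1) p) := by
  induction p using MvPolynomial.induction_on with
  | C a => simp [Phi]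
  | add p q hp hq => simp [hp, hq]
  | mul_X p ic hp =>
    rw [map_mul, map_mul, hp, map_mul, map_mul, map_X, Phi_X, Phi_X, map_mul, map_C, map_X]
    congr 3
    simp only [tv]
    split_ifs <;> simp

end FInd
namespace FInd

section Multi
variable {k : Type*} [Field k] {m n : ℕ}

lemma Phi_mulVec (g : Matrix (Fin n) (Fin n) k) (v : Fin m → Fin n → k)
    (p : MvPolynomial (Fin m × Fin n) k) :
    Phi (fun i => g.mulVec (v i)) p = Phi v (substAct g p) := by
  induction p using MvPolynomial.induction_on with
  | C a => simp [Phi, substAct]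
  | add p q hp hq => simp [hp, hq]
  | mul_X p ic hp =>
    rw [map_mul, map_mul, map_mul, hp, Phi_X]
    congr 1
    simp only [substAct, aeval_X, map_sum, map_mul, Phi_X, Matrix.mulVec, dotProduct]
    rw [Finset.sum_mul]
    refine Finset.sum_congr rfl fun c _ => ?_
    have : Phi v (C (g ic.2 c)) = C (g ic.2 c) := by simp [Phi]
    rw [this, mul_assoc]

lemma coeff_step (v : Fin m → Fin n → k) (p : MvPolynomial (Fin m × Fin n) k) (jc)
    (d : Fin m →₀ ℕ) :
    coeff d (Phi v (p * X jc)) =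
      if d jc.1 ≠ 0 then v jc.1 jc.2 * coeff (d - Finsupp.single jc.1 1) (Phi v p) else 0 := by
  rw [map_mul, Phi_X, ← mul_assoc, mul_comm _ (C _), mul_assoc, coeff_C_mul, coeff_mul_X']
  simp only [Finsupp.mem_support_iff]
  split_ifs <;> ring

lemma coeff_congr (p : MvPolynomial (Fin m × Fin n) k) (v v' : Fin m → Fin n → k) :
    ∀ d : Fin m →₀ ℕ, (∀ i, d i ≠ 0 → v i = v' i) → coeff d (Phi v p) = coeff d (Phi v' p) := by
  induction p using MvPolynomial.induction_on with
  | C a => intro d _; simp [Phi]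
  | add p q hp hq => intro d hd; simp [hp d hd, hq d hd]
  | mul_X p jc hp =>
    intro d hd
    rw [coeff_step, coeff_step]
    split_ifs with h
    · rw [hd _ h, hp]
      intro i hi
      apply hd
      intro h0
      apply hi
      simp [h0]
    · rfl

lemma coeff_lin (p : MvPolynomial (Fin m × Fin n) k) (v0 v1 v2 : Fin m → Fin n → k) (i : Fin m)
    (h1 : ∀ j, j ≠ i → v1 j = v0 j) (h2 : ∀ j, j ≠ i → v2 j = v0 j)
    (a b : k) (h0 : v0 i = a • v1 i + b • v2 i) :
    ∀ d : Fin m →₀ ℕ, d i = 1 →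
      coeff d (Phi v0 p) = a * coeff d (Phi v1 p) + b * coeff d (Phi v2 p) := by
  induction p using MvPolynomial.induction_on with
  | C c =>
    intro d hd
    have : (0 : Fin m →₀ ℕ) ≠ d := by intro h; rw [← h] at hd; simp at hd
    simp [Phi, coeff_C, this]
  | add p q hp hq => intro d hd; simp [hp d hd, hq d hd]; ring
  | mul_X p jc hp =>
    intro d hd
    rw [coeff_step, coeff_step, coeff_step]
    by_cases h : d jc.1 ≠ 0
    · rw [if_pos h, if_pos h, if_pos h]
      by_cases hj : jc.1 = i
      · have hz : ∀ j, (d - Finsupp.single jc.1 1 : Fin m →₀ ℕ) j ≠ 0 → j ≠ i := by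
          rintro j hj' rfl
          apply hj'
          simp [hj, hd]
        rw [coeff_congr p v1 v0 _ (fun j h' => h1 j (hz j h')),
          coeff_congr p v2 v0 _ (fun j h' => h2 j (hz j h')), hj, h0]
        simp only [Pi.add_apply, Pi.smul_apply, smul_eq_mul]
        ring
      · rw [hp _ (by simp [hd, hj]), h1 _ hj, h2 _ hj]
        ring
    · rw [if_neg h, if_neg h, if_neg h]; ring

lemma totalDegree_Phi (v : Fin m → Fin n → k) (p : MvPolynomial (Fin m × Fin n) k) :
    ∀ d : Fin m →₀ ℕ, p.totalDegree < d.degree → coeff d (Phi v p) = 0 := by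
  intro d hd
  conv_lhs => rw [p.as_sum]
  rw [map_sum, coeff_sum]
  apply Finset.sum_eq_zero
  intro s hs
  have hs' := le_totalDegree hs
  have hlt : s.degree < d.degree := by
    refine lt_of_le_of_lt ?_ hd
    rw [Finsupp.degree_apply]; exact hs'
  suffices H : ∀ (s : (Fin m × Fin n) →₀ ℕ) (a : k) (d : Fin m →₀ ℕ), s.degree ≠ d.degree →
      coeff d (Phi v (monomial s a)) = 0 from H s _ d hlt.ne
  intro s
  induction s using Finsupp.induction_linear with
  | zero =>
    intro a d hd
    have : (0 : Fin m →₀ ℕ) ≠ d := by intro h; rw [← h] at hd; simp at hd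
    have h2 : Phi v (C a) = C a := by simp [Phi]
    change coeff d (Phi v (C a)) = 0
    simp [h2, coeff_C, this]
  | add s t hs ht =>
    intro a d hd
    have : (monomial (s+t) a : MvPolynomial (Fin m × Fin n) k) = monomial s a * monomial t 1 := by
      simp [monomial_mul]
    rw [this, map_mul, coeff_mul]
    apply Finset.sum_eq_zero
    rintro ⟨x, y⟩ hxy
    rw [Finset.HasAntidiagonal.mem_antidiagonal] at hxy
    by_cases h : s.degree = x.degree
    · rw [ht, mul_zero]
      intro h'
      apply hd
      rw [← hxy, map_add, map_add, h, h']
    · rw [hs _ _ h, zero_mul]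
  | single jc e =>
    intro a d hd
    rw [← C_mul_X_pow_eq_monomial]
    have h2 : Phi v (C a * X jc ^ e) = C (a * v jc.1 jc.2 ^ e) * monomial (Finsupp.single jc.1 e) 1 := by
      rw [map_mul, map_pow, Phi_X, mul_pow, ← X_pow_eq_monomial]
      simp [Phi, mul_assoc]
    rw [h2, coeff_C_mul, coeff_monomial, if_neg, mul_zero]
    rintro rfl
    apply hd
    simp

/-- The multilinear component of `p` with respect to the positions in the support of `d`. -/
noncomputable def Lmap (p : MvPolynomial (Fin m × Fin n) k) (d : Fin m →₀ ℕ) (hd : ∀ i, d i ≤ 1) :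
    MultilinearMap k (fun _ : {i // d i ≠ 0} => Fin n → k) k where
  toFun w := coeff d (Phi (fun i => if h : d i ≠ 0 then w ⟨i, h⟩ else 0) p)
  map_update_add' := by
    intro inst w i x y
    have hi : d i.1 = 1 := by have := hd i.1; have := i.2; omega
    have := coeff_lin p
      (fun j => if h : d j ≠ 0 then Function.update w i (x + y) ⟨j, h⟩ else 0)
      (fun j => if h : d j ≠ 0 then Function.update w i x ⟨j, h⟩ else 0)
      (fun j => if h : d j ≠ 0 then Function.update w i y ⟨j, h⟩ else 0)
      i.1 (by
        intro j hj
        by_cases h : d j ≠ 0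
        · have : (⟨j, h⟩ : {i // d i ≠ 0}) ≠ i := fun h' => hj (by rw [← h'])
          simp [this]
        · simp [h]) (by
        intro j hj
        by_cases h : d j ≠ 0
        · have : (⟨j, h⟩ : {i // d i ≠ 0}) ≠ i := fun h' => hj (by rw [← h'])
          simp [this]
        · simp [h]) 1 1 (by simp [i.2]) d hi
    simpa using this
  map_update_smul' := by
    intro inst w i c x
    have hi : d i.1 = 1 := by have := hd i.1; have := i.2; omega
    have := coeff_lin p
      (fun j => if h : d j ≠ 0 then Function.update w i (c • x) ⟨j, h⟩ else 0)
      (fun j => if h : d j ≠ 0 then Function.update w i x ⟨j, h⟩ else 0)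
      (fun j => if h : d j ≠ 0 then Function.update w i x ⟨j, h⟩ else 0)
      i.1 (by
        intro j hj
        by_cases h : d j ≠ 0
        · have : (⟨j, h⟩ : {i // d i ≠ 0}) ≠ i := fun h' => hj (by rw [← h'])
          simp [this]
        · simp [h]) (by
        intro j hj
        by_cases h : d j ≠ 0
        · have : (⟨j, h⟩ : {i // d i ≠ 0}) ≠ i := fun h' => hj (by rw [← h'])
          simp [this]
        · simp [h]) c 0 (by simp [i.2]) d hi
    simpa using this

lemma Lmap_restrict (p : MvPolynomial (Fin m × Fin n) k) (d : Fin m →₀ ℕ) (hd : ∀ i, d i ≤ 1)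
    (v : Fin m → Fin n → k) : Lmap p d hd (fun i => v i.1) = coeff d (Phi v p) := by
  change coeff d (Phi _ p) = _
  apply coeff_congr
  intro i hi
  simp [hi]

lemma Lmap_inv (p : MvPolynomial (Fin m × Fin n) k) (d : Fin m →₀ ℕ) (hd : ∀ i, d i ≤ 1)
    (g : Matrix (Fin n) (Fin n) k) (hg : substAct g p = p) (w : {i // d i ≠ 0} → Fin n → k) :
    Lmap p d hd (fun i => g.mulVec (w i)) = Lmap p d hd w := by
  change coeff d (Phi _ p) = coeff d (Phi _ p)
  conv_rhs => rw [← hg]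
  rw [← Phi_mulVec]
  congr 2
  congr 1
  funext i
  split_ifs <;> simp

end Multi

/-- An element `x + τ x` among `τ`-fixed entries kills `τ`-invariant multilinear maps. -/
lemma tau_vanish {k V ι : Type*} [Field k] [CharP k 2] [AddCommGroup V] [Module k V]
    (L : MultilinearMap k (fun _ : ι => V) k) (τ : V → V)
    (hL : ∀ w : ι → V, L (fun i => τ (w i)) = L w) (w : ι → V) (i₀ : ι) (x : V)
    (h0 : w i₀ = x + τ x) (h : ∀ i, i ≠ i₀ → τ (w i) = w i) : L w = 0 := by
  classical
  have h1 : w = Function.update w i₀ (x + τ x) := by rw [← h0, Function.update_eq_self]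
  rw [h1, L.map_update_add]
  have h2 : L (Function.update w i₀ (τ x)) = L (Function.update w i₀ x) := by
    rw [← hL (Function.update w i₀ x)]
    congr 1
    funext i
    by_cases hi : i = i₀
    · subst hi; simp
    · simp [hi, h i hi]
  rw [h2]
  exact CharTwo.add_self_eq_zero _

/-- First-order consequence of invariance under a one-parameter family. -/
lemma deriv_vanish {k V ι : Type*} [Field k] [Infinite k] [AddCommGroup V] [Module k V]
    [Fintype ι] [DecidableEq ι]
    (L : MultilinearMap k (fun _ : ι => V) k) (v u : ι → V)
    (hL : ∀ c : k, L (v + c • u) = L v) :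
    ∑ i, L (Function.update v i (u i)) = 0 := by
  let P : Polynomial k := ∑ s : Finset ι, Polynomial.monomial s.card (L (s.piecewise u v))
  have hP : P = Polynomial.C (L v) := by
    apply Polynomial.funext
    intro c
    rw [Polynomial.eval_C, ← hL c, add_comm, L.map_add_univ]
    simp only [P, Polynomial.eval_finsetSum, Polynomial.eval_monomial]
    refine Finset.sum_congr rfl fun s _ => ?_
    have := L.map_piecewise_smul (fun _ => c) (s.piecewise u v) s
    rw [Finset.prod_const, smul_eq_mul] at this
    rw [mul_comm, ← this]
    congr 1
    funext i
    by_cases hi : i ∈ s <;> simp [hi]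
  have h1 := congrArg (fun Q => Polynomial.coeff Q 1) hP
  simp only [P, Polynomial.finsetSum_coeff, Polynomial.coeff_monomial, Polynomial.coeff_C] at h1
  rw [if_neg one_ne_zero, ← Finset.sum_filter] at h1
  rw [← h1]
  refine Finset.sum_bij (fun i _ => {i}) ?_ ?_ ?_ ?_
  · intro i _; simp
  · intro i _ j _ h; simpa using h
  · intro s hs
    simp only [Finset.mem_filter, Finset.mem_univ, true_and] at hs
    obtain ⟨i, hi⟩ := Finset.card_eq_one.mp hs
    exact ⟨i, Finset.mem_univ _, hi.symm⟩
  · intro i _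
    rw [Finset.piecewise_singleton]

end FInd
namespace FInd

section Grp
variable {k : Type*} [Field k] {ν : ℕ}

lemma inSO_of (ℓ : (Fin (2*ν) → k) →ₗ[k] (Fin (2*ν) → k)) (a b : Fin (2*ν) → k)
    (φ ψ : (Fin (2*ν) → k) → k) (hℓ : ∀ v, ℓ v = v + (φ v • a + ψ v • b))
    (x y : Fin (2*ν) → k) (hx1 : φ x = 1) (hx2 : ψ x = 0) (hy1 : φ y = 0) (hy2 : ψ y = 1)
    (hab : ∀ s t : k, s • a + t • b = 0 → s = 0 ∧ t = 0)
    (hinv : ∀ v, ℓ (ℓ v) = v) (hq : ∀ v, stdQ k (2*ν) (ℓ v) = stdQ k (2*ν) v) :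
    inSOeven (LinearMap.toMatrix' ℓ) := by
  refine ⟨⟨?_, ?_⟩, ?_⟩
  · have : LinearMap.toMatrix' ℓ * LinearMap.toMatrix' ℓ = 1 := by
      rw [← LinearMap.toMatrix'_comp, ← LinearMap.toMatrix'_id]
      congr 1
      exact LinearMap.ext hinv
    exact (Matrix.isUnit_iff_isUnit_det _).mp (IsUnit.of_mul_eq_one _ this)
  · intro v
    rw [LinearMap.toMatrix'_mulVec, hq]
  · have hli : LinearIndependent k ![a, b] := LinearIndependent.pair_iff.mpr hab
    have hrange : LinearMap.range (LinearMap.toMatrix' ℓ - 1).mulVecLin =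
        Submodule.span k (Set.range ![a, b]) := by
      have hM : ∀ v, (LinearMap.toMatrix' ℓ - 1).mulVec v = φ v • a + ψ v • b := by
        intro v
        rw [Matrix.sub_mulVec, LinearMap.toMatrix'_mulVec, Matrix.one_mulVec, hℓ]
        simp
      apply le_antisymm
      · rintro _ ⟨v, rfl⟩
        rw [Matrix.mulVecLin_apply, hM]
        exact Submodule.add_mem _
          (Submodule.smul_mem _ _ (Submodule.subset_span ⟨0, rfl⟩))
          (Submodule.smul_mem _ _ (Submodule.subset_span ⟨1, rfl⟩))
      · rw [Submodule.span_le]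
        rintro _ ⟨i, rfl⟩
        fin_cases i
        · refine ⟨x, ?_⟩
          rw [Matrix.mulVecLin_apply, hM]; simp [hx1, hx2]
        · refine ⟨y, ?_⟩
          rw [Matrix.mulVecLin_apply, hM]; simp [hy1, hy2]
    rw [Matrix.rank, hrange, finrank_span_eq_card hli]
    decide

/-- basis vectors -/
def ev (k : Type*) [Field k] (ν j : ℕ) : Fin (2*ν) → k := fun c => if c.1 = j then 1 else 0

/-- the vectors `e_r + f_r` -/
def wv (k : Type*) [Field k] (ν r : ℕ) : Fin (2*ν) → k := fun c => if c.1/2 = r then 1 else 0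

/-- the coordinate swap in the blocks `r` and `ν-1` -/
def sw (ν r : ℕ) (c : Fin (2*ν)) : Fin (2*ν) :=
  if c.1/2 = r ∨ c.1/2 = ν-1 then
    ⟨if c.1 % 2 = 0 then c.1 + 1 else c.1 - 1, by split_ifs <;> omega⟩ else c

/-- the swap as a linear map -/
def tauL (k : Type*) [Field k] (ν r : ℕ) : (Fin (2*ν) → k) →ₗ[k] (Fin (2*ν) → k) :=
  LinearMap.funLeft k k (sw ν r)

lemma tauL_apply (r : ℕ) (v : Fin (2*ν) → k) (c) : tauL k ν r v c = v (sw ν r c) := rfl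

lemma sw_sw (r : ℕ) (c : Fin (2*ν)) : sw ν r (sw ν r c) = c := by
  apply Fin.ext
  unfold sw
  by_cases h : c.1/2 = r ∨ c.1/2 = ν-1
  · simp only [h, if_true]
    rw [if_pos (by split_ifs <;> omega)]
    split_ifs <;> first | omega | (dsimp only at *; omega) | (simp at *; omega)
  · simp only [h, if_false]

lemma stdQ_tau (r : ℕ) (v : Fin (2*ν) → k) :
    stdQ k (2*ν) (tauL k ν r v) = stdQ k (2*ν) v := by
  unfold stdQ
  rw [dif_neg (by omega), dif_neg (by omega), add_zero, add_zero]
  refine Finset.sum_congr rfl fun j _ => ?_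
  rw [tauL_apply, tauL_apply]
  have h2 : (2*j.1+1)/2 = j.1 := by omega
  by_cases h : j.1 = r ∨ j.1 = ν-1
  · have e1 : sw ν r ⟨2*j.1, by omega⟩ = ⟨2*j.1+1, by omega⟩ := by
      simp [sw, h]
    have e2 : sw ν r ⟨2*j.1+1, by omega⟩ = ⟨2*j.1, by omega⟩ := by
      simp [sw, h2, h]
    rw [e1, e2, mul_comm]
  · have e1 : sw ν r ⟨2*j.1, by omega⟩ = ⟨2*j.1, by omega⟩ := by
      simp [sw, h]
    have e2 : sw ν r ⟨2*j.1+1, by omega⟩ = ⟨2*j.1+1, by omega⟩ := by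
      simp [sw, h2, h]
    rw [e1, e2]

lemma tau_formula [CharP k 2] (r : ℕ) (hr : r < ν - 1) (v : Fin (2*ν) → k) :
    tauL k ν r v = v + ((v ⟨2*r, by omega⟩ + v ⟨2*r+1, by omega⟩) • wv k ν r +
      (v ⟨2*(ν-1), by omega⟩ + v ⟨2*(ν-1)+1, by omega⟩) • wv k ν (ν-1)) := by
  have key : ∀ x y : k, x = y + (y + x) := fun x y => by
    rw [← add_assoc, CharTwo.add_self_eq_zero, zero_add]
  have key2 : ∀ x y : k, x = y + (x + y) := fun x y => by
    rw [add_comm x y]; exact key x y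
  funext c
  rw [tauL_apply]
  simp only [Pi.add_apply, Pi.smul_apply, wv, smul_eq_mul]
  by_cases h : c.1/2 = r
  · have hne : c.1/2 ≠ ν-1 := by omega
    rw [if_pos h, if_neg hne, mul_one, mul_zero, add_zero]
    rcases Nat.mod_two_eq_zero_or_one c.1 with h0 | h0
    · have e1 : c = ⟨2*r, by omega⟩ := Fin.ext (by simp only; omega)
      have e2 : sw ν r c = ⟨2*r+1, by omega⟩ := by
        apply Fin.ext; simp only [sw, h, true_or, if_true, h0]; omega
      rw [e2, congrArg v e1]; exact key _ _
    · have e1 : c = ⟨2*r+1, by omega⟩ := Fin.ext (by simp only; omega)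
      have e2 : sw ν r c = ⟨2*r, by omega⟩ := by
        apply Fin.ext; simp only [sw, h, true_or, if_true, h0, one_ne_zero, if_false]; omega
      rw [e2, congrArg v e1]; exact key2 _ _
  · by_cases h' : c.1/2 = ν-1
    · rw [if_neg h, if_pos h', mul_one, mul_zero, zero_add]
      rcases Nat.mod_two_eq_zero_or_one c.1 with h0 | h0
      · have e1 : c = ⟨2*(ν-1), by omega⟩ := Fin.ext (by simp only; omega)
        have e2 : sw ν r c = ⟨2*(ν-1)+1, by omega⟩ := by
          apply Fin.ext; simp only [sw, h', or_true, if_true, h0]; omega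
        rw [e2, congrArg v e1]; exact key _ _
      · have e1 : c = ⟨2*(ν-1)+1, by omega⟩ := Fin.ext (by simp only; omega)
        have e2 : sw ν r c = ⟨2*(ν-1), by omega⟩ := by
          apply Fin.ext; simp only [sw, h', or_true, if_true, h0, one_ne_zero, if_false]; omega
        rw [e2, congrArg v e1]; exact key2 _ _
    · rw [if_neg h, if_neg h']
      simp [sw, h, h']

lemma tau_SO [CharP k 2] (r : ℕ) (hr : r < ν - 1) :
    inSOeven (LinearMap.toMatrix' (tauL k ν r)) := by
  refine inSO_of (tauL k ν r) (wv k ν r) (wv k ν (ν-1)) _ _ (tau_formula r hr)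
    (ev k ν (2*r)) (ev k ν (2*(ν-1))) ?_ ?_ ?_ ?_ ?_ ?_ (stdQ_tau r)
  · simp [ev]
  · simp only [ev]
    rw [if_neg (by omega), if_neg (by omega), add_zero]
  · simp only [ev]
    rw [if_neg (by omega), if_neg (by omega), add_zero]
  · simp [ev]
  · intro s t h
    have h1 := congrFun h ⟨2*r, by omega⟩
    have h2 := congrFun h ⟨2*(ν-1), by omega⟩
    have n1 : r ≠ ν-1 := by omega
    simp [wv, n1] at h1
    simp [wv, n1.symm] at h2
    exact ⟨h1, h2⟩
  · intro v
    funext c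
    rw [tauL_apply, tauL_apply, sw_sw]

/-- the root element `e_s ↦ e_s + x e_b`, `f_b ↦ f_b + x f_s`. -/
def rootL (k : Type*) [Field k] (ν b s : ℕ) (hb : b < ν) (hs : s < ν) (x : k) :
    (Fin (2*ν) → k) →ₗ[k] (Fin (2*ν) → k) where
  toFun v := v + (v ⟨2*s, by omega⟩ • (x • ev k ν (2*b)) +
    v ⟨2*b+1, by omega⟩ • (x • ev k ν (2*s+1)))
  map_add' v w := by
    funext c; simp only [Pi.add_apply, Pi.smul_apply, smul_eq_mul]; ring
  map_smul' a v := by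
    funext c; simp only [Pi.add_apply, Pi.smul_apply, smul_eq_mul, RingHom.id_apply]; ring

lemma rootL_apply (b s : ℕ) (hb : b < ν) (hs : s < ν) (x : k) (v : Fin (2*ν) → k) :
    rootL k ν b s hb hs x v = v + (v ⟨2*s, by omega⟩ • (x • ev k ν (2*b)) +
    v ⟨2*b+1, by omega⟩ • (x • ev k ν (2*s+1))) := rfl

lemma root_SO [CharP k 2] (b s : ℕ) (hb : b < ν) (hs : s < ν) (hbs : b ≠ s) (x : k) (hx : x ≠ 0) :
    inSOeven (LinearMap.toMatrix' (rootL k ν b s hb hs x)) := by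
  refine inSO_of (rootL k ν b s hb hs x) (x • ev k ν (2*b)) (x • ev k ν (2*s+1)) _ _
    (rootL_apply b s hb hs x)
    (ev k ν (2*s)) (ev k ν (2*b+1)) ?_ ?_ ?_ ?_ ?_ ?_ ?_
  · simp [ev]
  · simp only [ev]; rw [if_neg (by omega)]
  · simp only [ev]; rw [if_neg (by omega)]
  · simp [ev]
  · intro u t h
    have h1 := congrFun h ⟨2*b, by omega⟩
    have h2 := congrFun h ⟨2*s+1, by omega⟩
    have n1 : 2*b ≠ 2*s+1 := by omega
    simp [ev, n1, hx] at h1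
    simp [ev, n1.symm, hx] at h2
    exact ⟨h1, h2⟩
  · intro v
    have e1 : rootL k ν b s hb hs x v ⟨2*s, by omega⟩ = v ⟨2*s, by omega⟩ := by
      have n1 : s ≠ b := hbs.symm
      have n2 : 2*s ≠ 2*s+1 := by omega
      simp [rootL_apply, ev, n1]
    have e2 : rootL k ν b s hb hs x v ⟨2*b+1, by omega⟩ = v ⟨2*b+1, by omega⟩ := by
      have n2 : 2*b+1 ≠ 2*b := by omega
      simp [rootL_apply, ev, hbs]
    rw [rootL_apply _ _ _ _ _ (rootL k ν b s hb hs x v), e1, e2, rootL_apply, add_assoc]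
    have hz : ∀ z : Fin (2*ν) → k, z + z = 0 := fun z => by
      funext c; exact CharTwo.add_self_eq_zero _
    rw [hz, add_zero]
  · intro v
    unfold stdQ
    rw [dif_neg (by omega), dif_neg (by omega), add_zero, add_zero]
    have hterm : ∀ j : Fin (2*ν/2),
        rootL k ν b s hb hs x v ⟨2*j.1, by omega⟩ * rootL k ν b s hb hs x v ⟨2*j.1+1, by omega⟩
        = v ⟨2*j.1, by omega⟩ * v ⟨2*j.1+1, by omega⟩ +
          ((if j = ⟨b, by omega⟩ then x * v ⟨2*s, by omega⟩ * v ⟨2*b+1, by omega⟩ else 0) +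
          (if j = ⟨s, by omega⟩ then x * v ⟨2*s, by omega⟩ * v ⟨2*b+1, by omega⟩ else 0)) := by
      intro j
      have n1 : 2*j.1+1 ≠ 2*b := by omega
      have n2 : 2*j.1 ≠ 2*s+1 := by omega
      by_cases hjb : j = ⟨b, by omega⟩
      · subst hjb
        simp [rootL_apply, ev, hbs, n1, n2]; ring
      · by_cases hjs : j = ⟨s, by omega⟩
        · subst hjs
          simp [rootL_apply, ev, hbs.symm, n1, n2]; ring
        · have h1 : j.1 ≠ b := fun h => hjb (Fin.ext h)
          have h2 : j.1 ≠ s := fun h => hjs (Fin.ext h)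
          simp [rootL_apply, ev, hjb, hjs, n1, n2, h1, h2]
    rw [Finset.sum_congr rfl (fun j _ => hterm j), Finset.sum_add_distrib,
      Finset.sum_add_distrib]
    simp [CharTwo.add_self_eq_zero]

end Grp

end FInd
namespace FInd

section Fin
variable {k : Type*} [Field k] {ν μ : ℕ}

lemma sw_div (r : ℕ) (c : Fin (2*ν)) : (sw ν r c).1/2 = c.1/2 := by
  unfold sw
  by_cases h : c.1/2 = r ∨ c.1/2 = ν-1
  · rw [if_pos h]; simp only; split_ifs <;> omega
  · rw [if_neg h]

lemma sw_of_ne (r : ℕ) (c : Fin (2*ν)) (h1 : c.1/2 ≠ r) (h2 : c.1/2 ≠ ν-1) : sw ν r c = c := by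
  simp [sw, h1, h2]

lemma tau_ev (r j : ℕ) (h1 : j/2 ≠ r) (h2 : j/2 ≠ ν-1) : tauL k ν r (ev k ν j) = ev k ν j := by
  funext c
  rw [tauL_apply]
  by_cases h : c.1/2 = j/2
  · rw [sw_of_ne _ _ (by omega) (by omega)]
  · have := sw_div r c
    unfold ev
    rw [if_neg (by intro h'; omega), if_neg (by intro h'; omega)]

lemma tau_tv (hν : 2 ≤ ν) (r p : ℕ) (h : rr ν p ≠ r ∨ p ≠ 2 * rr ν p) :
    tauL k ν r (tv k ν p) = tv k ν p := by
  funext c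
  rw [tauL_apply]
  have hp : rr ν p ≤ ν - 2 := min_le_right _ _
  unfold tv
  rw [sw_div]
  by_cases h1 : c.1/2 = rr ν p
  · rw [if_pos h1, if_pos h1]
    by_cases h2 : p = 2 * rr ν p
    · have h3 : rr ν p ≠ r := by tauto
      rw [sw_of_ne _ _ (by omega) (by omega)]
    · simp [h2]
  · rw [if_neg h1, if_neg h1]

lemma tv_head (p : ℕ) (h : p = 2 * rr ν p) : tv k ν p = ev k ν p := by
  funext c
  unfold tv ev
  rw [if_pos h]
  by_cases h1 : c.1 = p
  · rw [if_pos (by omega), if_pos (by omega), if_pos h1]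
  · rw [if_neg h1]
    by_cases h2 : c.1/2 = rr ν p
    · rw [if_pos h2, if_neg (by omega)]
    · rw [if_neg h2]

lemma tv_tail (hν : 2 ≤ ν) (p : ℕ) (h : p ≠ 2 * rr ν p) :
    tv k ν p = ev k ν (2 * rr ν p) + tauL k ν (rr ν p) (ev k ν (2 * rr ν p)) := by
  funext c
  rw [Pi.add_apply, tauL_apply]
  unfold tv ev
  rw [if_neg h]
  by_cases h2 : c.1/2 = rr ν p
  · have : (sw ν (rr ν p) c).1 = if c.1 % 2 = 0 then c.1 + 1 else c.1 - 1 := by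
      simp [sw, h2]
    rw [if_pos h2, this]
    by_cases h3 : c.1 % 2 = 0
    · rw [if_pos h3, if_pos h3, if_pos (by omega), if_neg (by omega), add_zero]
    · rw [if_neg h3, if_neg h3, if_neg (by omega), if_pos (by omega), zero_add]
  · have := sw_div (rr ν p) c
    rw [if_neg h2, if_neg (by omega), if_neg (by omega), add_zero]

/-- the head of the block of `p` -/
def hd (ν : ℕ) (p : Fin (2*μ)) : Fin (2*μ) := ⟨2 * rr ν p.1, by have := p.2; unfold rr; omega⟩

/-- Exponents which do not occur for products of invariants of lower degree. -/
def Bad (ν : ℕ) (d : Fin (2*μ) →₀ ℕ) : Prop :=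
  (∃ p, d p ≠ 0 ∧ d (hd ν p) = 0) ∨
  ((∀ p, d p ≠ 0 ↔ d (hd ν p) ≠ 0) ∧ ∃ p, d p ≠ 0 ∧ p.1 = 2 * (ν-2))

lemma gen_bad [Infinite k] [CharP k 2] (hν : 2 ≤ ν) (hμν : ν ≤ μ)
    (p : MvPolynomial (Fin (2*μ) × Fin (2*ν)) k)
    (hp : ∀ g : Matrix (Fin (2*ν)) (Fin (2*ν)) k, inSOeven g → substAct g p = p)
    (hdeg : p.totalDegree < 2*μ) (d : Fin (2*μ) →₀ ℕ) (hd1 : ∀ i, d i ≤ 1) (hbad : Bad ν d) :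
    coeff d (Phi (fun i : Fin (2*μ) => tv k ν i.1) p) = 0 := by
  have htau : ∀ r, r < ν - 1 → ∀ w : {i // d i ≠ 0} → Fin (2*ν) → k,
      Lmap p d hd1 (fun i => tauL k ν r (w i)) = Lmap p d hd1 w := by
    intro r hr w
    have := Lmap_inv p d hd1 _ (hp _ (tau_SO (k := k) r hr)) w
    simpa only [LinearMap.toMatrix'_mulVec] using this
  rcases hbad with ⟨i, hi, hhi⟩ | ⟨hcl, i0, hi0, hi0v⟩
  · rw [← Lmap_restrict p d hd1]
    have hr : rr ν i.1 ≤ ν - 2 := min_le_right _ _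
    refine tau_vanish _ (tauL k ν (rr ν i.1)) (htau _ (by omega)) _ ⟨i, hi⟩
      (ev k ν (2 * rr ν i.1)) ?_ ?_
    · apply tv_tail hν
      intro h
      have : hd ν i = i := Fin.ext h.symm
      rw [this] at hhi
      exact hi hhi
    · intro j _
      apply tau_tv hν
      by_contra hcon
      push Not at hcon
      have : hd ν i = j.1 := Fin.ext (by unfold hd; simp only; omega)
      rw [this] at hhi
      exact j.2 hhi
  · by_cases hall : ∀ q, d q ≠ 0
    · apply totalDegree_Phi
      have : d.degree = 2*μ := by
        rw [Finsupp.degree_eq_sum]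
        have h1 : ∀ q, d q = 1 := fun q => by have := hall q; have := hd1 q; omega
        simp [h1]
      omega
    push Not at hall
    obtain ⟨q, hq⟩ := hall
    have hhq : d (hd ν q) = 0 := by
      by_contra h
      exact (hcl q).mpr h hq
    generalize hs : rr ν q.1 = s
    have hsle : s ≤ ν - 2 := by rw [← hs]; exact min_le_right _ _
    have hsb : ν - 2 ≠ s := by
      intro h
      have : hd ν q = i0 := Fin.ext (by unfold hd; simp only; omega)
      rw [this] at hhq
      exact hi0 hhq
    have hnos : ∀ j, d j ≠ 0 → rr ν j.1 ≠ s := by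
      intro j hj h
      have h1 := (hcl j).mp hj
      have : hd ν j = hd ν q := Fin.ext (by unfold hd; simp only; omega)
      rw [this] at h1
      exact h1 hhq
    have rri0 : rr ν i0.1 = ν - 2 := by unfold rr; omega
    classical
    let v : {i // d i ≠ 0} → Fin (2*ν) → k := fun i =>
      if i.1 = i0 then ev k ν (2*s) else tv k ν i.1.1
    let u : {i // d i ≠ 0} → Fin (2*ν) → k := fun i =>
      if i.1 = i0 then ev k ν (2*(ν-2)) else if rr ν i.1.1 = ν-2 then ev k ν (2*s+1) else 0
    have hL : ∀ c : k, Lmap p d hd1 (v + c • u) = Lmap p d hd1 v := by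
      intro c
      by_cases hc : c = 0
      · rw [hc, zero_smul, add_zero]
      have hSO := root_SO (k := k) (ν := ν) (ν-2) s (by omega) (by omega) hsb c hc
      have := Lmap_inv p d hd1 _ (hp _ hSO) v
      simp only [LinearMap.toMatrix'_mulVec] at this
      rw [← this]
      congr 1
      funext i
      rw [rootL_apply, Pi.add_apply, Pi.smul_apply]
      congr 1
      simp only [v, u]
      by_cases h1 : i.1 = i0
      · rw [if_pos h1, if_pos h1]
        have z1 : ev k ν (2*s) ⟨2*s, by omega⟩ = 1 := by simp [ev]
        have z2 : ev k ν (2*s) ⟨2*(ν-2)+1, by omega⟩ = 0 := by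
          unfold ev; rw [if_neg (by simp only; omega)]
        rw [z1, z2, one_smul, zero_smul, add_zero]
      · rw [if_neg h1, if_neg h1]
        have hne := hnos i.1 i.2
        have z1 : tv k ν i.1.1 ⟨2*s, by omega⟩ = 0 := by
          unfold tv; rw [if_neg (by simp only; omega)]
        rw [z1, zero_smul, zero_add]
        by_cases h2 : rr ν i.1.1 = ν-2
        · have h3 : i.1.1 ≠ 2 * rr ν i.1.1 := fun h => h1 (Fin.ext (by omega))
          have z2 : tv k ν i.1.1 ⟨2*(ν-2)+1, by omega⟩ = 1 := by
            unfold tv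
            rw [if_pos (by simp only; omega), if_neg (by simp only; omega), if_neg h3]
          rw [if_pos h2, z2, one_smul]
        · have z2 : tv k ν i.1.1 ⟨2*(ν-2)+1, by omega⟩ = 0 := by
            unfold tv; rw [if_neg (by simp only; omega)]
          rw [if_neg h2, z2, zero_smul, smul_zero]
    have hsum := deriv_vanish (Lmap p d hd1) v u hL
    rw [Finset.sum_eq_single (⟨i0, hi0⟩ : {i // d i ≠ 0})] at hsum
    · rw [← Lmap_restrict p d hd1, ← hsum]
      congr 1
      funext i
      by_cases h1 : i = ⟨i0, hi0⟩
      · subst h1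
        simp only [Function.update_self, u, if_true]
        rw [tv_head _ (by omega), hi0v]
      · have h2 : i.1 ≠ i0 := fun h => h1 (Subtype.ext h)
        simp [Function.update_of_ne h1, v, h2]
    · intro i _ hne
      have h2 : i.1 ≠ i0 := fun h => hne (Subtype.ext h)
      by_cases h3 : rr ν i.1.1 = ν-2
      · obtain ⟨j, hj, hji, hjr, hjt⟩ : ∃ j : Fin (2*μ), d j ≠ 0 ∧ j ≠ i.1 ∧ rr ν j.1 = ν-2 ∧
            j.1 ≠ 2*(ν-2) := by
          have hclose : ∀ j : Fin (2*μ), rr ν j.1 = ν-2 → d j ≠ 0 := by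
            intro j hj
            apply (hcl j).mpr
            have : hd ν j = i0 := Fin.ext (by unfold hd; simp only; omega)
            rw [this]; exact hi0
          by_cases h4 : i.1.1 = 2*(ν-2)+1
          · have hr : rr ν (2*(ν-2)+2) = ν-2 := by unfold rr; omega
            exact ⟨⟨2*(ν-2)+2, by omega⟩, hclose _ hr,
              fun h => by rw [Fin.ext_iff] at h; simp only at h; omega, hr, by simp only; omega⟩
          · have hr : rr ν (2*(ν-2)+1) = ν-2 := by unfold rr; omega
            exact ⟨⟨2*(ν-2)+1, by omega⟩, hclose _ hr,
              fun h => by rw [Fin.ext_iff] at h; simp only at h; omega, hr, by simp only; omega⟩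
        have hji' : (⟨j, hj⟩ : {i // d i ≠ 0}) ≠ i := fun h => hji (by rw [← h])
        have hj0 : j ≠ i0 := fun h => hjt (by rw [h]; exact hi0v)
        refine tau_vanish _ (tauL k ν (ν-2)) (htau _ (by omega)) _ ⟨j, hj⟩
          (ev k ν (2*(ν-2))) ?_ ?_
        · rw [Function.update_of_ne hji']
          simp only [v]
          rw [if_neg hj0, tv_tail hν _ (by omega), hjr]
        · intro l _
          by_cases hli : l = i
          · subst hli
            rw [Function.update_self]
            simp only [u]
            rw [if_neg h2, if_pos h3]
            exact tau_ev _ _ (by omega) (by omega)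
          · rw [Function.update_of_ne hli]
            simp only [v]
            by_cases hl0 : l.1 = i0
            · rw [if_pos hl0]
              exact tau_ev _ _ (by omega) (by omega)
            · rw [if_neg hl0]
              apply tau_tv hν
              by_contra hcon
              push Not at hcon
              exact hl0 (Fin.ext (by omega))
      · apply MultilinearMap.map_coord_zero _ i
        rw [Function.update_self]
        simp only [u]
        rw [if_neg h2, if_neg h3]
    · intro h; exact absurd (Finset.mem_univ _) h

/-- polynomials without bad squarefree exponents -/
noncomputable def goodAlg (k : Type*) [Field k] (ν μ : ℕ) : Subalgebra k (MvPolynomial (Fin (2*μ)) k) where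
  carrier := {F | ∀ d : Fin (2*μ) →₀ ℕ, (∀ i, d i ≤ 1) → Bad ν d → coeff d F = 0}
  add_mem' := by
    intro F G hF hG d h1 h2
    rw [coeff_add, hF d h1 h2, hG d h1 h2, add_zero]
  algebraMap_mem' := by
    intro a d h1 h2
    rw [algebraMap_eq, coeff_C, if_neg]
    rintro rfl
    rcases h2 with ⟨p, hp, _⟩ | ⟨_, p, hp, _⟩ <;> simp at hp
  mul_mem' := by
    intro F G hF hG d h1 h2
    rw [coeff_mul]
    apply Finset.sum_eq_zero
    rintro ⟨x, y⟩ hxy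
    rw [Finset.HasAntidiagonal.mem_antidiagonal] at hxy
    simp only at hxy ⊢
    have hs : ∀ i, x i + y i = d i := fun i => by rw [← hxy]; rfl
    have hx1 : ∀ i, x i ≤ 1 := fun i => by have := hs i; have := h1 i; omega
    have hy1 : ∀ i, y i ≤ 1 := fun i => by have := hs i; have := h1 i; omega
    suffices Bad ν x ∨ Bad ν y by
      rcases this with h | h
      · rw [hF x hx1 h, zero_mul]
      · rw [hG y hy1 h, mul_zero]
    by_contra hno
    push Not at hno
    obtain ⟨nx, ny⟩ := hno
    have ax : ∀ p, x p ≠ 0 → x (hd ν p) ≠ 0 := fun p h h' => nx (Or.inl ⟨p, h, h'⟩)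
    have ay : ∀ p, y p ≠ 0 → y (hd ν p) ≠ 0 := fun p h h' => ny (Or.inl ⟨p, h, h'⟩)
    rcases h2 with ⟨p, hp, hp'⟩ | ⟨hcl, p, hp, hpv⟩
    · have e1 := hs p
      have e2 := hs (hd ν p)
      by_cases h : x p = 0
      · have := ay p (by omega); omega
      · have := ax p h; omega
    · have cx : ∀ p, x p ≠ 0 ↔ x (hd ν p) ≠ 0 := by
        intro p
        refine ⟨ax p, fun h h0 => ?_⟩
        have e1 := hs p
        have e2 := hs (hd ν p)
        have e3 := h1 (hd ν p)
        have := ay p (by have := (hcl p).mpr (by omega); omega)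
        omega
      have cy : ∀ p, y p ≠ 0 ↔ y (hd ν p) ≠ 0 := by
        intro p
        refine ⟨ay p, fun h h0 => ?_⟩
        have e1 := hs p
        have e2 := hs (hd ν p)
        have e3 := h1 (hd ν p)
        have := ax p (by have := (hcl p).mpr (by omega); omega)
        omega
      have e1 := hs p
      by_cases h : x p = 0
      · exact ny (Or.inr ⟨cy, p, by omega, hpv⟩)
      · exact nx (Or.inr ⟨cx, p, h, hpv⟩)

end Fin

end FInd
/-- For `m = 2μ ≥ n = 2ν ≥ 4` both even, the mod-2 reduction `f` of
`(Pf − Σ_π sgn π · D^{(π(1),…,π(n))} Pf^{(π(n+1),…,π(m))})/2^(μ−ν+1)` is an indecomposable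
`SO(n)`-invariant over an algebraically closed field `k` of characteristic 2: it does not lie
in the subalgebra generated by the `SO(n)`-invariants of degree strictly less than `m`. -/
theorem f_indecomposable_SO_even
    (k : Type*) [Field k] [IsAlgClosed k] [CharP k 2]
    (ν μ : ℕ) (hν : 2 ≤ ν) (hμν : ν ≤ μ)
    (ft : MvPolynomial (Fin (2*μ) × Fin (2*ν)) ℤ)
    (hf : (2 ^ (μ - ν + 1) : MvPolynomial (Fin (2*μ) × Fin (2*ν)) ℤ) * ft =
      pfaffian (Bmat (2*ν) μ) - DPfSum (2*ν) (2*μ) (by omega)) :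
    MvPolynomial.map (Int.castRingHom k) ft ∉
      Algebra.adjoin k {p : MvPolynomial (Fin (2*μ) × Fin (2*ν)) k |
        (∀ g : Matrix (Fin (2*ν)) (Fin (2*ν)) k, inSOeven g → substAct g p = p) ∧
        p.totalDegree < 2*μ} := by
  intro hmem
  have hle : Algebra.adjoin k {p : MvPolynomial (Fin (2*μ) × Fin (2*ν)) k |
        (∀ g : Matrix (Fin (2*ν)) (Fin (2*ν)) k, inSOeven g → substAct g p = p) ∧
        p.totalDegree < 2*μ} ≤
      (FInd.goodAlg k ν μ).comap (FInd.Phi (fun i : Fin (2*μ) => FInd.tv k ν i.1)) := by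
    apply Algebra.adjoin_le
    rintro p ⟨hp, hdeg⟩
    have : Infinite k := IsAlgClosed.instInfinite
    exact fun d h1 h2 => FInd.gen_bad hν hμν p hp hdeg d h1 h2
  have h1 := hle hmem
  rw [Subalgebra.mem_comap, FInd.Phi_map, FInd.Phi_ft ν μ hν hμν ft hf, map_prod] at h1
  simp only [map_X] at h1
  have h2 := h1 (∑ i, Finsupp.single i 1)
  have hval : ∀ j : Fin (2*μ), (∑ i, Finsupp.single i 1 : Fin (2*μ) →₀ ℕ) j = 1 := by
    intro j
    simp [Finsupp.finsetSum_apply, Finsupp.single_apply]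
  have h3 := h2 (fun i => (hval i).le) (Or.inr ⟨fun p => by simp only [hval],
    ⟨2*(ν-2), by omega⟩, by rw [hval]; exact one_ne_zero, rfl⟩)
  have h4 : (∏ i : Fin (2*μ), (X i : MvPolynomial (Fin (2*μ)) k)) =
      monomial (∑ i, Finsupp.single i 1) 1 := by
    rw [monomial_sum_one]
    rfl
  rw [h4, coeff_monomial, if_pos rfl] at h3
  exact one_ne_zero h3
end

section
/- The coefficient in the alternating sum Σ_π sgn(π)·D^{(π(1),…,π(n))}·Pf^{(π(n+1),…,π(m))} (over permutations π of {1,…,m} increasing on {1,…,n} and on {n+1,…,m}) of an m-linear monomial ρ as in (∗) is zero unless each m_r (r ≥ 1) is even and strictly positive with x_r, y_r alternating; in that case it equals 2^{μ−ν}·(−1)^{#{r ≥ 1 : y_r comes first}}·sgn(ρ). -/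
open MvPolynomial

/-- The exponent vector of the `m`-linear monomial in which vector `i` contributes
its coordinate `c i`. -/
noncomputable def expOf {m n : ℕ} (c : Fin m → Fin n) : (Fin m × Fin n) →₀ ℕ :=
  ∑ i : Fin m, Finsupp.single (i, c i) 1


/-- The number `m_r` of occurrences of letters from group `r` (the pair `x_r, y_r`,
coordinates `2r, 2r+1`; for `n` odd, group `n/2` is the letter `z`). -/
def cnt {m n : ℕ} (c : Fin m → Fin n) (r : ℕ) : ℕ :=
  (Finset.univ.filter fun i : Fin m => (c i).1 / 2 = r).card


/-- In the monomial encoded by `c`, the letters `x_r` (coordinate `2r`) and `y_r`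
(coordinate `2r+1`) occur in alternating order. -/
def Alt {m n : ℕ} (c : Fin m → Fin n) (r : ℕ) : Prop :=
  ∀ i j : Fin m, i < j → (c i).1 / 2 = r → (c j).1 / 2 = r →
    (∀ l : Fin m, i < l → l < j → (c l).1 / 2 ≠ r) → c i ≠ c j


/-- Ordering key for group-by-group reading: the `z` group (group `n/2`, present for odd `n`)
comes first, then the pair groups in order. -/
def grpKey {m n : ℕ} (c : Fin m → Fin n) (i : Fin m) : ℕ :=
  if (c i).1 / 2 = n / 2 then 0 else (c i).1 / 2 + 1


/-- `sgn ρ`: the sign of the permutation obtained by reading off the superscripts of the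
monomial group by group (z's first, then each pair group in increasing superscript order),
computed as `(-1)^(number of inversions)`. -/
def sgnMon {m n : ℕ} (c : Fin m → Fin n) : ℤ :=
  (-1) ^ (Finset.univ.filter fun p : Fin m × Fin m =>
      p.1 < p.2 ∧ grpKey c p.2 < grpKey c p.1).card


section helpers
open Equiv

theorem sum_transversal {α K : Type*} [Fintype α] [DecidableEq α] [Fintype K]
    (φ : K → Perm α) (P : Perm α → Prop) [DecidablePred P]
    (h : ∀ θ : Perm α, ∃! k, P (θ * φ k)) (f : Perm α → ℤ) :
    ∑ θ, f θ = ∑ t ∈ Finset.univ.filter P, ∑ k, f (t * (φ k)⁻¹) := by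
  classical
  have h1 : ∀ θ, f θ = ∑ k, if P (θ * φ k) then f θ else 0 := by
    intro θ
    obtain ⟨k, hk, hu⟩ := h θ
    rw [Finset.sum_eq_single k]
    · simp [hk]
    · intro b _ hb
      rw [if_neg]
      intro hP
      exact hb (hu b hP)
    · simp
  rw [Finset.sum_congr rfl fun θ _ => h1 θ, Finset.sum_comm, Finset.sum_comm (s := Finset.univ.filter P)]
  refine Finset.sum_congr rfl fun k _ => ?_
  rw [Finset.sum_filter]
  refine Fintype.sum_equiv (Equiv.mulRight (φ k)) _ _ fun θ => ?_
  simp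

theorem existsUnique_sort {N : ℕ} {β : Type*} [LinearOrder β] (h : Fin N → β)
    (hi : Function.Injective h) : ∃! π : Perm (Fin N), StrictMono (h ∘ π) := by
  refine ⟨Tuple.sort h, ?_, ?_⟩
  · exact (Tuple.monotone_sort h).strictMono_of_injective (hi.comp (Equiv.injective _))
  · intro τ hτ
    have := Tuple.unique_monotone hτ.monotone (Tuple.monotone_sort h)
    ext1 x
    exact hi (congrFun this x)

/-- pairs of positions -/
def pairEquiv (N : ℕ) : Fin N × Bool ≃ Fin (2 * N) where
  toFun p := ⟨2 * p.1.1 + p.2.toNat, by have := p.1.2; have := p.2.toNat_le; omega⟩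
  invFun i := (⟨i.1 / 2, by have := i.2; omega⟩, decide (i.1 % 2 = 1))
  left_inv p := by
    rcases p with ⟨k, b⟩
    cases b <;> ext <;> simp <;> omega
  right_inv i := by
    ext
    rcases Nat.mod_two_eq_zero_or_one i.1 with h | h <;> simp [h] <;> omega

theorem pairEquiv_false (N : ℕ) (k : Fin N) (h) : pairEquiv N (k, false) = ⟨2 * k.1, h⟩ := rfl
theorem pairEquiv_true (N : ℕ) (k : Fin N) (h) : pairEquiv N (k, true) = ⟨2 * k.1 + 1, h⟩ := rfl

/-- hyperoctahedral elements -/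
def hyp {N : ℕ} (p : (Fin N → Bool) × Perm (Fin N)) : Perm (Fin N × Bool) :=
  Equiv.prodCongrLeft (fun _ => p.2) *
    Equiv.prodCongrRight (fun k => if p.1 k then Equiv.swap false true else 1)

theorem hyp_false {N : ℕ} (p : (Fin N → Bool) × Perm (Fin N)) (k : Fin N) :
    hyp p (k, false) = (p.2 k, p.1 k) := by
  cases h : p.1 k <;> simp [hyp, h, Equiv.prodCongrLeft, Equiv.prodCongrRight]

theorem hyp_true {N : ℕ} (p : (Fin N → Bool) × Perm (Fin N)) (k : Fin N) :
    hyp p (k, true) = (p.2 k, !p.1 k) := by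
  cases h : p.1 k <;> simp [hyp, h, Equiv.prodCongrLeft, Equiv.prodCongrRight]

theorem sign_hyp {N : ℕ} (p : (Fin N → Bool) × Perm (Fin N)) :
    Perm.sign (hyp p) = ∏ k, if p.1 k then -1 else 1 := by
  unfold hyp
  rw [Perm.sign_mul, Perm.sign_prodCongrLeft, Perm.sign_prodCongrRight]
  simp only [Fintype.prod_bool, Int.units_mul_self, one_mul]
  refine Finset.prod_congr rfl fun k _ => ?_
  split_ifs <;> simp

/-- summand of the full Pfaffian sum -/
def pfTerm {N : ℕ} (A : Fin (2*N) → Fin (2*N) → ℤ) (ρ : Perm (Fin (2*N))) : ℤ :=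
  (Perm.sign ρ : ℤ) * ∏ k : Fin N, A (ρ (pairEquiv N (k, false))) (ρ (pairEquiv N (k, true)))

theorem pfTerm_hyp {N : ℕ} (A : Fin (2*N) → Fin (2*N) → ℤ) (hA : ∀ i j, A j i = - A i j)
    (ρ : Perm (Fin (2*N))) (p : (Fin N → Bool) × Perm (Fin N)) :
    pfTerm A (ρ * (pairEquiv N).permCongr (hyp p)) = pfTerm A ρ := by
  unfold pfTerm
  rw [Perm.sign_mul, Perm.sign_permCongr, sign_hyp]
  simp only [Perm.mul_apply, Equiv.permCongr_apply, Equiv.symm_apply_apply, hyp_false, hyp_true]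
  have : ∀ k, A (ρ (pairEquiv N (p.2 k, p.1 k))) (ρ (pairEquiv N (p.2 k, !p.1 k))) =
     (if p.1 k then -1 else 1) *
      A (ρ (pairEquiv N (p.2 k, false))) (ρ (pairEquiv N (p.2 k, true))) := by
    intro k
    cases p.1 k
    · simp
    · simp [hA (ρ (pairEquiv N (p.2 k, false)))]
  rw [Finset.prod_congr rfl fun k _ => this k, Finset.prod_mul_distrib]
  rw [Equiv.prod_comp p.2 fun k => A (ρ (pairEquiv N (k, false))) (ρ (pairEquiv N (k, true)))]
  have h2 : ((∏ k, (if p.1 k then (-1 : ℤ) else 1)) * ∏ k, (if p.1 k then (-1 : ℤ) else 1)) = 1 := by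
    rw [← Finset.prod_mul_distrib]
    apply Finset.prod_eq_one
    intro k _
    split_ifs <;> simp
  have h3 : ((∏ k, (if p.1 k then (-1 : ℤˣ) else 1) : ℤˣ) : ℤ) = ∏ k, (if p.1 k then (-1 : ℤ) else 1) := by
    rw [Units.coe_prod]
    refine Finset.prod_congr rfl fun k _ => ?_
    split_ifs <;> simp
  rw [Units.val_mul, h3]
  linear_combination ((Perm.sign ρ : ℤ) *
    (∏ k : Fin N, A (ρ (pairEquiv N (k, false))) (ρ (pairEquiv N (k, true))))) * h2

theorem hyp_unique {N : ℕ} (ρ : Perm (Fin (2*N))) :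
    ∃! p : (Fin N → Bool) × Perm (Fin N),
      ((∀ i : Fin N, (ρ * (pairEquiv N).permCongr (hyp p)) ⟨2*i.1, by have := i.2; omega⟩ <
        (ρ * (pairEquiv N).permCongr (hyp p)) ⟨2*i.1+1, by have := i.2; omega⟩) ∧
      (∀ i j : Fin N, i < j →
        (ρ * (pairEquiv N).permCongr (hyp p)) ⟨2*i.1, by have := i.2; omega⟩ <
        (ρ * (pairEquiv N).permCongr (hyp p)) ⟨2*j.1, by have := j.2; omega⟩)) := by
  simp only [← pairEquiv_false, ← pairEquiv_true, Perm.mul_apply, Equiv.permCongr_apply,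
    Equiv.symm_apply_apply, hyp_false, hyp_true]
  set δ : Fin N → Bool := fun j => decide (ρ (pairEquiv N (j, true)) < ρ (pairEquiv N (j, false)))
    with hδ
  have key : ∀ (j : Fin N) (b : Bool),
      ρ (pairEquiv N (j, b)) < ρ (pairEquiv N (j, !b)) ↔ b = δ j := by
    intro j b
    have hne : ρ (pairEquiv N (j, true)) ≠ ρ (pairEquiv N (j, false)) := by
      intro h
      simpa using (pairEquiv N).injective (ρ.injective h)
    cases b
    · simp only [hδ, Bool.not_false, eq_comm (a := false), decide_eq_false_iff_not, not_lt]
      exact ⟨le_of_lt, fun h => lt_of_le_of_ne h hne.symm⟩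
    · simp [hδ]
  have hinj : Function.Injective fun j => ρ (pairEquiv N (j, δ j)) := by
    intro i j h
    have := (pairEquiv N).injective (ρ.injective h)
    exact (Prod.ext_iff.mp this).1
  obtain ⟨π, hπ, hu⟩ := existsUnique_sort _ hinj
  refine ⟨(fun k => δ (π k), π), ⟨fun i => (key _ _).2 rfl, fun i j hij => hπ hij⟩, ?_⟩
  rintro ⟨ε, τ⟩ ⟨h1, h2⟩
  have h3 : ∀ i, ε i = δ (τ i) := fun i => (key _ _).1 (h1 i)
  have h4 : τ = π := by
    apply hu
    intro i j hij
    have := h2 i j hij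
    simp only [h3] at this
    exact this
  subst h4
  ext1
  · funext i; exact h3 i
  · rfl

theorem sum_pfTerm {N : ℕ} (A : Fin (2*N) → Fin (2*N) → ℤ) (hA : ∀ i j, A j i = - A i j) :
    ∑ ρ, pfTerm A ρ = (2 ^ N * N.factorial : ℤ) * pfaffian (μ := N) A := by
  rw [sum_transversal (fun p => (pairEquiv N).permCongr (hyp p))
    (fun σ => (∀ i : Fin N, σ ⟨2*i.1, by have := i.2; omega⟩ < σ ⟨2*i.1+1, by have := i.2; omega⟩) ∧
    (∀ i j : Fin N, i < j →
      σ ⟨2*i.1, by have := i.2; omega⟩ < σ ⟨2*j.1, by have := j.2; omega⟩)) hyp_unique]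
  have : ∀ (t : Perm (Fin (2*N))) p, pfTerm A (t * ((pairEquiv N).permCongr (hyp p))⁻¹) = pfTerm A t := by
    intro t p
    rw [← pfTerm_hyp A hA (t * ((pairEquiv N).permCongr (hyp p))⁻¹) p]
    simp
  simp only [this]
  unfold pfaffian pfPerms
  rw [Finset.mul_sum]
  refine Finset.sum_congr rfl fun t _ => ?_
  simp [pfTerm, Fintype.card_perm]
  left; rfl

end helpers

section helpers2
open Equiv

/-- block permutation -/
def blk {n M : ℕ} (p : Perm (Fin n) × Perm (Fin M)) : Perm (Fin (n + M)) :=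
  finSumFinEquiv.permCongr (Perm.sumCongr p.1 p.2)

theorem blk_castAdd {n M : ℕ} (p : Perm (Fin n) × Perm (Fin M)) (a : Fin n) :
    blk p (Fin.castAdd M a) = Fin.castAdd M (p.1 a) := by
  simp [blk, Equiv.permCongr_apply]

theorem blk_natAdd {n M : ℕ} (p : Perm (Fin n) × Perm (Fin M)) (a : Fin M) :
    blk p (Fin.natAdd n a) = Fin.natAdd n (p.2 a) := by
  simp [blk, Equiv.permCongr_apply]

theorem sign_blk {n M : ℕ} (p : Perm (Fin n) × Perm (Fin M)) :
    Perm.sign (blk p) = Perm.sign p.1 * Perm.sign p.2 := by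
  simp [blk]

theorem blk_inv {n M : ℕ} (p : Perm (Fin n) × Perm (Fin M)) : (blk p)⁻¹ = blk p⁻¹ := by
  rw [inv_eq_iff_mul_eq_one]
  ext1 x
  refine Fin.addCases (fun a => ?_) (fun a => ?_) x
  · simp [blk_castAdd]
  · simp [blk_natAdd]

/-- shuffle condition -/
def IsSh (n : ℕ) {m : ℕ} (σ : Perm (Fin m)) : Prop :=
  (∀ i j : Fin m, i < j → j.1 < n → σ i < σ j) ∧ (∀ i j : Fin m, i < j → n ≤ i.1 → σ i < σ j)

instance (n m : ℕ) : DecidablePred (IsSh n (m := m)) := fun σ => by unfold IsSh; infer_instance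

theorem isSh_iff {n M : ℕ} (σ : Perm (Fin (n + M))) :
    IsSh n σ ↔ StrictMono (fun a : Fin n => σ (Fin.castAdd M a)) ∧
      StrictMono (fun a : Fin M => σ (Fin.natAdd n a)) := by
  constructor
  · rintro ⟨h1, h2⟩
    refine ⟨fun a b hab => h1 _ _ hab (by simp), fun a b hab =>
      h2 _ _ (by simpa using hab) (by simp)⟩
  · rintro ⟨h1, h2⟩
    constructor
    · intro i j hij hj
      exact h1 (a := ⟨i.1, by have : i.1 < j.1 := hij; omega⟩) (b := ⟨j.1, hj⟩) hij
    · intro i j hij hi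
      have hj : i.1 < j.1 := hij
      have := h2 (a := ⟨i.1 - n, by have := i.2; omega⟩) (b := ⟨j.1 - n, by have := j.2; omega⟩)
        (by simp only [Fin.mk_lt_mk]; omega)
      have e1 : Fin.natAdd n ⟨i.1 - n, by have := i.2; omega⟩ = i := by ext; simp; omega
      have e2 : Fin.natAdd n ⟨j.1 - n, by have := j.2; omega⟩ = j := by ext; simp; omega
      simpa only [e1, e2] using this

theorem blk_unique {n M : ℕ} (θ : Perm (Fin (n + M))) :
    ∃! p : Perm (Fin n) × Perm (Fin M), IsSh n (θ * blk p) := by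
  simp only [isSh_iff, Perm.mul_apply, blk_castAdd, blk_natAdd]
  obtain ⟨τ, hτ, uτ⟩ := existsUnique_sort (fun a : Fin n => θ (Fin.castAdd M a))
    (θ.injective.comp (Fin.castAdd_injective n M))
  obtain ⟨ρ, hρ, uρ⟩ := existsUnique_sort (fun a : Fin M => θ (Fin.natAdd n a))
    (θ.injective.comp (Fin.natAdd_injective M n))
  refine ⟨(τ, ρ), ⟨hτ, hρ⟩, ?_⟩
  rintro ⟨τ', ρ'⟩ ⟨h1, h2⟩
  exact Prod.ext (uτ _ h1) (uρ _ h2)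

/-- letter scalar product -/
def Bn (n a b : ℕ) : ℤ := if a / 2 = b / 2 then (if a / 2 = n / 2 then 2 else if a = b then 0 else 1) else 0

theorem Bn_comm (n a b : ℕ) : Bn n a b = Bn n b a := by
  unfold Bn
  split_ifs <;> first | rfl | omega

/-- skew matrix of letters -/
def Sf (n : ℕ) (f : ℕ → ℕ) (i j : ℕ) : ℤ :=
  if i < j then Bn n (f i) (f j) else if j < i then - Bn n (f j) (f i) else 0

theorem Sf_skew (n : ℕ) (f : ℕ → ℕ) (i j : ℕ) : Sf n f j i = - Sf n f i j := by
  unfold Sf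
  split_ifs <;> omega

/-- product part of the summand -/
def PhProd (n N : ℕ) (f : ℕ → ℕ) (θ : Perm (Fin (n + 2 * N))) : ℤ :=
  (∏ a : Fin n, if f (θ (Fin.castAdd _ a)).1 = a.1 then 1 else 0) *
    ∏ k : Fin N, Sf n f (θ (Fin.natAdd n (pairEquiv N (k, false)))).1
      (θ (Fin.natAdd n (pairEquiv N (k, true)))).1

/-- the full antisymmetrized sum -/
def Ph (n N : ℕ) (f : ℕ → ℕ) : ℤ :=
  ∑ θ : Perm (Fin (n + 2 * N)), (Perm.sign θ : ℤ) * PhProd n N f θ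

/-- evaluated shuffle sum -/
def Fsum (n N : ℕ) (f : ℕ → ℕ) : ℤ :=
  ∑ σ ∈ (Finset.univ.filter fun σ : Equiv.Perm (Fin (n + 2 * N)) => IsSh n σ),
    (Equiv.Perm.sign σ : ℤ) *
      (Matrix.det (Matrix.of fun a b : Fin n => if f (σ (Fin.castAdd _ b)).1 = a.1 then (1 : ℤ) else 0) *
       pfaffian (μ := N) (fun a b => Sf n f (σ (Fin.natAdd n a)).1 (σ (Fin.natAdd n b)).1))

theorem Ph_eq (n N : ℕ) (f : ℕ → ℕ) : Ph n N f = (2 ^ N * N.factorial : ℤ) * Fsum n N f := by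
  unfold Ph Fsum
  rw [sum_transversal blk (IsSh n) blk_unique, Finset.mul_sum]
  refine Finset.sum_congr rfl fun σ _ => ?_
  have hpf := sum_pfTerm (N := N) (fun a b => Sf n f (σ (Fin.natAdd n a)).1 (σ (Fin.natAdd n b)).1)
    (fun i j => Sf_skew _ _ _ _)
  have e1 : ∑ p : Perm (Fin n) × Perm (Fin (2 * N)), (Perm.sign (σ * (blk p)⁻¹) : ℤ) *
      PhProd n N f (σ * (blk p)⁻¹) = ∑ p : Perm (Fin n) × Perm (Fin (2 * N)),
      (Perm.sign (σ * (blk p)) : ℤ) * PhProd n N f (σ * (blk p)) :=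
    Fintype.sum_equiv (Equiv.inv _) _ _ fun p => by simp only [blk_inv, Equiv.inv_apply]
  rw [e1]
  rw [← Matrix.det_transpose, Matrix.det_apply', mul_left_comm, mul_left_comm _ (Finset.sum _ _), ← hpf,
    Fintype.sum_mul_sum, Finset.mul_sum, Fintype.sum_prod_type]
  refine Finset.sum_congr rfl fun τ _ => ?_
  rw [Finset.mul_sum]
  refine Finset.sum_congr rfl fun ρ _ => ?_
  simp only [PhProd, pfTerm, Perm.sign_mul, sign_blk, Perm.mul_apply, blk_castAdd, blk_natAdd,
    Matrix.transpose_apply, Matrix.of_apply, Units.val_mul, Int.cast_id]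
  ring
end helpers2

section helpers3
open Equiv

theorem expOf_apply {m n : ℕ} (c : Fin m → Fin n) (q : Fin m × Fin n) :
    expOf c q = if q.2 = c q.1 then 1 else 0 := by
  rcases q with ⟨i, a⟩
  unfold expOf
  rw [Finsupp.finsetSum_apply, Finset.sum_eq_single i]
  · simp [Finsupp.single_apply, eq_comm]
  · intro b _ hb
    simp [Finsupp.single_apply, hb]
  · simp

/-- multidegree weight -/
def wt (m n : ℕ) (p : Fin m × Fin n) : Fin m → ℕ := Pi.single p.1 1

theorem coeff_eq_eval {m n : ℕ} (c : Fin m → Fin n) (p : MvPolynomial (Fin m × Fin n) ℤ)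
    (hp : IsWeightedHomogeneous (wt m n) p (fun _ => 1)) :
    coeff (expOf c) p = eval (fun q => if q.2 = c q.1 then (1 : ℤ) else 0) p := by
  rw [eval_eq', Finset.sum_eq_single (expOf c)]
  · rw [Finset.prod_eq_one, mul_one]
    intro q _
    rw [expOf_apply]
    split_ifs <;> simp
  · intro d hd hne
    have h1 := hp (mem_support_iff.mp hd)
    have h2 : ∀ i, ∑ a, d (i, a) = 1 := by
      intro i
      have := congrFun h1 i
      rw [Finsupp.weight_apply, Finsupp.sum_fintype _ _ (by simp), Finset.sum_apply,
        Fintype.sum_prod_type, Finset.sum_eq_single i] at this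
      · simpa [wt] using this
      · intro b _ hb
        simp [wt, Pi.single_apply, hb.symm]
      · simp
    have h3 : ∃ q : Fin m × Fin n, q.2 ≠ c q.1 ∧ d q ≠ 0 := by
      by_contra! hcon
      apply hne
      ext ⟨i, a⟩
      rw [expOf_apply]
      split_ifs with h
      · have := h2 i
        rw [Finset.sum_eq_single (c i)] at this
        · simp only at h; rw [h]; exact this
        · intro b _ hb
          exact hcon (i, b) hb
        · simp
      · exact hcon (i, a) h
    obtain ⟨q, hq1, hq2⟩ := h3
    rw [Finset.prod_eq_zero (Finset.mem_univ q), mul_zero]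
    rw [if_neg hq1, zero_pow hq2]
  · intro h
    rw [notMem_support_iff.mp h, zero_mul]

theorem map_pfaffian {R S : Type*} [CommRing R] [CommRing S] (φ : R →+* S) {N : ℕ}
    (A : Fin (2*N) → Fin (2*N) → R) :
    φ (pfaffian (μ := N) A) = pfaffian (μ := N) (fun i j => φ (A i j)) := by
  unfold pfaffian
  simp [map_sum, map_prod]

theorem wh_zsmul {m n : ℕ} {p : MvPolynomial (Fin m × Fin n) ℤ} {w : Fin m → ℕ} (z : ℤ)
    (hp : IsWeightedHomogeneous (wt m n) p w) : IsWeightedHomogeneous (wt m n) (z • p) w := by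
  rw [← mem_weightedHomogeneousSubmodule] at *
  exact Submodule.smul_mem _ _ hp

theorem wh_X {m n : ℕ} (i : Fin m) (a : Fin n) :
    IsWeightedHomogeneous (wt m n) (X (i, a) : MvPolynomial (Fin m × Fin n) ℤ) (Pi.single i 1) :=
  isWeightedHomogeneous_X _ _ _

theorem wh_Bpoly (n m : ℕ) (i j : Fin m) :
    IsWeightedHomogeneous (wt m n) (Bpoly n m i j) (Pi.single i 1 + Pi.single j 1) := by
  unfold Bpoly
  refine IsWeightedHomogeneous.add (IsWeightedHomogeneous.sum _ _ _ fun r _ => ?_) ?_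
  · exact ((wh_X _ _).mul (wh_X _ _)).add ((wh_X _ _).mul (wh_X _ _))
  · split_ifs with h
    · have := wh_zsmul 2 ((wh_X i ⟨n-1, by omega⟩).mul (wh_X j (⟨n-1, by omega⟩ : Fin n)))
      rw [zsmul_eq_mul, ← mul_assoc] at this
      exact_mod_cast this
    · exact isWeightedHomogeneous_zero _ _ _

theorem wh_Dpoly (n m : ℕ) (w : Fin n → Fin m) :
    IsWeightedHomogeneous (wt m n) (Dpoly n m w) (∑ b, Pi.single (w b) 1) := by
  unfold Dpoly
  rw [Matrix.det_apply]
  refine IsWeightedHomogeneous.sum _ _ _ fun τ _ => ?_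
  rw [Units.smul_def]
  refine wh_zsmul _ ?_
  exact IsWeightedHomogeneous.prod _ _ _ fun b _ => wh_X _ _

theorem wh_pfaffian (n m N : ℕ) (A : Fin (2*N) → Fin (2*N) → MvPolynomial (Fin m × Fin n) ℤ)
    (v : Fin (2*N) → Fin m)
    (hA : ∀ a b, IsWeightedHomogeneous (wt m n) (A a b) (Pi.single (v a) 1 + Pi.single (v b) 1)) :
    IsWeightedHomogeneous (wt m n) (pfaffian (μ := N) A) (∑ a, Pi.single (v a) 1) := by
  unfold pfaffian
  refine IsWeightedHomogeneous.sum _ _ _ fun ρ _ => wh_zsmul _ ?_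
  have : ∑ a, (Pi.single (v a) 1 : Fin m → ℕ) = ∑ k : Fin N,
      (Pi.single (v (ρ (pairEquiv N (k, false)))) 1 + Pi.single (v (ρ (pairEquiv N (k, true)))) 1) := by
    rw [← Equiv.sum_comp ρ, ← Equiv.sum_comp (pairEquiv N), Fintype.sum_prod_type]
    simp [add_comm]
  rw [this]
  exact IsWeightedHomogeneous.prod _ _ _ fun k _ => hA _ _

/-- extension of a word to all naturals -/
def ext0 {m n : ℕ} (c : Fin m → Fin n) (i : ℕ) : ℕ := if h : i < m then (c ⟨i, h⟩).1 else 0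

theorem ext0_val {m n : ℕ} (c : Fin m → Fin n) (i : Fin m) : ext0 c i.1 = (c i).1 := by
  simp [ext0]

theorem eval_Bpoly {n m : ℕ} (c : Fin m → Fin n) (i j : Fin m) :
    eval (fun q => if q.2 = c q.1 then (1 : ℤ) else 0) (Bpoly n m i j) = Bn n (c i).1 (c j).1 := by
  unfold Bpoly
  simp only [map_add, map_sum, map_mul, eval_X, Fin.ext_iff]
  have hi := (c i).2
  have hj := (c j).2
  by_cases hn : (c i).1 / 2 = n / 2
  · rw [Finset.sum_eq_zero]
    · have h : n % 2 = 1 := by omega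
      rw [dif_pos h]
      have h1 : (c i).1 = n - 1 := by omega
      simp only [map_mul, eval_X, Fin.ext_iff, map_ofNat]
      unfold Bn
      rw [if_pos h1.symm]
      by_cases h2 : n - 1 = (c j).1
      · rw [if_pos h2, if_pos (by omega), if_pos hn]; simp
      · rw [if_neg h2, if_neg (by omega)]; simp
    · intro r _
      have := r.2
      rw [if_neg (c := 2 * r.1 = (c i).1) (by omega), if_neg (c := 2 * r.1 + 1 = (c i).1) (by omega)]
      simp
  · have h0 : (eval (fun q : Fin m × Fin n => if q.2 = c q.1 then (1 : ℤ) else 0))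
      (if h : n % 2 = 1 then 2 * X (i, ⟨n-1, by omega⟩) * X (j, ⟨n-1, by omega⟩) else 0) = 0 := by
      split_ifs with h
      · simp only [map_mul, eval_X, Fin.ext_iff]
        rw [if_neg (by omega)]
        simp
      · simp
    simp only [Fin.ext_iff] at h0
    rw [h0, add_zero, Finset.sum_eq_single ⟨(c i).1 / 2, by omega⟩]
    · unfold Bn
      simp only
      split_ifs <;> first | omega | simp
    · intro r _ hr
      have : r.1 ≠ (c i).1 / 2 := fun h => hr (Fin.ext h)
      rw [if_neg (by omega), if_neg (c := 2 * r.1 + 1 = (c i).1) (by omega)]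
      simp
    · simp

theorem coeff_aux (n m N : ℕ) (h : m = n + 2 * N) (c : Fin m → Fin n) :
    coeff (expOf c) (∑ σ ∈ (Finset.univ.filter fun σ : Equiv.Perm (Fin m) =>
      (∀ i j : Fin m, i < j → j.1 < n → σ i < σ j) ∧
      (∀ i j : Fin m, i < j → n ≤ i.1 → σ i < σ j)),
    (Equiv.Perm.sign σ : ℤ) •
      (Dpoly n m (fun a => σ ⟨a.1, by have := a.2; omega⟩) *
       pfaffian (μ := N) (fun a b =>
         if a < b then
           Bpoly n m (σ ⟨n + a.1, by have := a.2; omega⟩) (σ ⟨n + b.1, by have := b.2; omega⟩)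
         else if b < a then
           -(Bpoly n m (σ ⟨n + b.1, by have := b.2; omega⟩) (σ ⟨n + a.1, by have := a.2; omega⟩))
         else 0))) = Fsum n N (ext0 c) := by
  subst h
  rw [coeff_eq_eval]
  · rw [map_sum]
    unfold Fsum
    refine Finset.sum_congr rfl fun σ hσ => ?_
    have hsh : IsSh n σ := (Finset.mem_filter.mp hσ).2
    rw [isSh_iff] at hsh
    rw [map_zsmul, map_mul, map_pfaffian, zsmul_eq_mul, Int.cast_id]
    congr 2
    · unfold Dpoly
      rw [RingHom.map_det]
      congr 1
      ext a b
      simp only [RingHom.mapMatrix_apply, Matrix.map_apply, Matrix.of_apply, eval_X, ext0_val]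
      refine if_congr ?_ rfl rfl
      rw [Fin.ext_iff, eq_comm]
      rfl
    · congr 1
      funext a b
      have e1 : a < b ↔ (σ (Fin.natAdd n a)).1 < (σ (Fin.natAdd n b)).1 := hsh.2.lt_iff_lt.symm
      have e2 : b < a ↔ (σ (Fin.natAdd n b)).1 < (σ (Fin.natAdd n a)).1 := hsh.2.lt_iff_lt.symm
      unfold Sf
      simp only [← e1, ← e2, ext0_val]
      split_ifs
      · rw [eval_Bpoly]; rfl
      · rw [map_neg, eval_Bpoly]; rfl
      · simp
  · refine IsWeightedHomogeneous.sum _ _ _ fun σ _ => wh_zsmul _ ?_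
    have e : (fun _ => 1 : Fin (n + 2 * N) → ℕ) = ∑ b : Fin n, Pi.single (σ (Fin.castAdd _ b)) 1 +
        ∑ a : Fin (2 * N), Pi.single (σ (Fin.natAdd n a)) 1 := by
      rw [← Fin.sum_univ_add (fun x => (Pi.single (σ x) 1 : Fin (n + 2 * N) → ℕ)),
        Equiv.sum_comp σ (fun x => (Pi.single x 1 : Fin (n + 2 * N) → ℕ))]
      exact (Finset.univ_sum_single (fun _ => 1)).symm
    rw [e]
    refine IsWeightedHomogeneous.mul (wh_Dpoly _ _ _) (wh_pfaffian _ _ _ _ (fun a => σ (Fin.natAdd n a)) ?_)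
    intro a b
    split_ifs
    · exact wh_Bpoly _ _ _ _
    · have := wh_zsmul (-1) (wh_Bpoly n (n + 2 * N) (σ (Fin.natAdd n b)) (σ (Fin.natAdd n a)))
      rw [neg_one_zsmul, add_comm (Pi.single _ _)] at this
      exact this
    · exact isWeightedHomogeneous_zero _ _ _

theorem coeff_eq_Fsum (n m : ℕ) (hnm : n ≤ m) (hpar : m % 2 = n % 2) (c : Fin m → Fin n) :
    coeff (expOf c) (DPfSum n m hnm) = Fsum n ((m - n) / 2) (ext0 c) :=
  coeff_aux n m ((m - n) / 2) (by omega) c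
end helpers3

section helpers4
open Equiv

theorem Sf_swap (n : ℕ) (f : ℕ → ℕ) (p i j : ℕ) :
    Sf n (f ∘ swap p (p+1)) (swap p (p+1) i) (swap p (p+1) j) =
      if (i = p ∧ j = p + 1) ∨ (i = p + 1 ∧ j = p) then - Sf n f i j else Sf n f i j := by
  have hlt : ∀ i j : ℕ, (swap p (p+1) i < swap p (p+1) j) ↔
      (i < j ∧ ¬ (i = p ∧ j = p + 1)) ∨ (i = p + 1 ∧ j = p) := by
    intro i j
    simp only [swap_apply_def]
    split_ifs <;> omega
  unfold Sf
  simp only [hlt, Function.comp, swap_apply_self]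
  by_cases h1 : i = p ∧ j = p + 1
  · obtain ⟨rfl, rfl⟩ := h1
    simp [Bn_comm]
  · by_cases h2 : i = p + 1 ∧ j = p
    · obtain ⟨rfl, rfl⟩ := h2
      simp [Bn_comm]
    · have h3 : ¬ (j = p ∧ i = p + 1) := fun h => h2 ⟨h.2, h.1⟩
      have h4 : ¬ (j = p + 1 ∧ i = p) := fun h => h1 ⟨h.2, h.1⟩
      simp [h1, h2, h3, h4]

theorem Sf_swap_zero (n : ℕ) (f : ℕ → ℕ) (p : ℕ) (h : Bn n (f p) (f (p+1)) = 0) (i j : ℕ) :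
    Sf n (f ∘ swap p (p+1)) (swap p (p+1) i) (swap p (p+1) j) = Sf n f i j := by
  rw [Sf_swap]
  split_ifs with h1
  · rcases h1 with ⟨rfl, rfl⟩ | ⟨rfl, rfl⟩
    · simp [Sf, h]
    · simp [Sf, h]
  · rfl

theorem val_swap {m p : ℕ} (hp : p + 1 < m) (i : Fin m) :
    (swap (⟨p, by omega⟩ : Fin m) ⟨p+1, hp⟩ i).1 = swap p (p+1) i.1 := by
  simp only [swap_apply_def, Fin.ext_iff]
  split_ifs <;> rfl

theorem Ph_swap (n N : ℕ) (f : ℕ → ℕ) (p : ℕ) (hp : p + 1 < n + 2 * N) :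
    Ph n N (f ∘ swap p (p+1)) = - ∑ θ : Perm (Fin (n + 2 * N)), (Perm.sign θ : ℤ) *
      PhProd n N (f ∘ swap p (p+1)) (swap ⟨p, by omega⟩ ⟨p+1, hp⟩ * θ) := by
  unfold Ph
  rw [← Equiv.sum_comp (Equiv.mulLeft (swap (⟨p, by omega⟩ : Fin (n + 2 * N)) ⟨p+1, hp⟩)),
    ← Finset.sum_neg_distrib]
  refine Finset.sum_congr rfl fun θ _ => ?_
  rw [Equiv.coe_mulLeft, Perm.sign_mul, Perm.sign_swap (by simp [Fin.ext_iff])]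
  simp

theorem Ph_anti (n N : ℕ) (f : ℕ → ℕ) (p : ℕ) (hp : p + 1 < n + 2 * N)
    (h : Bn n (f p) (f (p+1)) = 0 ∨ N = 0) :
    Ph n N (f ∘ swap p (p+1)) = - Ph n N f := by
  rw [Ph_swap n N f p hp, Ph]
  congr 1
  refine Finset.sum_congr rfl fun θ _ => ?_
  congr 1
  unfold PhProd
  simp only [Perm.mul_apply, val_swap]
  rcases h with h | rfl
  · simp only [Sf_swap_zero n f p h]
    simp
  · simp

theorem Ph_term_inv (n N : ℕ) (f : ℕ → ℕ) (q : (Fin N → Bool) × Perm (Fin N))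
    (θ : Perm (Fin (n + 2 * N))) :
    (Perm.sign (θ * blk (1, (pairEquiv N).permCongr (hyp q))) : ℤ) *
      PhProd n N f (θ * blk (1, (pairEquiv N).permCongr (hyp q))) =
    (Perm.sign θ : ℤ) * PhProd n N f θ := by
  have := pfTerm_hyp (fun a b => Sf n f (θ (Fin.natAdd n a)).1 (θ (Fin.natAdd n b)).1)
    (fun i j => Sf_skew _ _ _ _) 1 q
  unfold pfTerm at this
  simp only [one_mul, Perm.sign_one, Units.val_one, Perm.one_apply] at this
  unfold PhProd
  simp only [Perm.sign_mul, sign_blk, Perm.mul_apply, blk_castAdd, blk_natAdd, Perm.sign_one, one_mul,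
    Units.val_mul, Perm.one_apply]
  rw [← this]
  ring

theorem exists_blk {k : ℕ} (θ : Perm (Fin (k + 2))) (h0 : θ (Fin.natAdd k 0) = Fin.natAdd k 0)
    (h1 : θ (Fin.natAdd k 1) = Fin.natAdd k 1) :
    ∃ σ : Perm (Fin k), θ = blk (σ, 1) := by
  have h01 : ∀ x : Fin 2, θ (Fin.natAdd k x) = Fin.natAdd k x := by
    intro x; fin_cases x
    · exact h0
    · exact h1
  have hm : Set.MapsTo (finSumFinEquiv.symm.permCongr θ) (Set.range (Sum.inl : Fin k → Fin k ⊕ Fin 2))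
      (Set.range Sum.inl) := by
    rintro _ ⟨a, rfl⟩
    rcases hx : finSumFinEquiv.symm.permCongr θ (Sum.inl a) with b | b
    · exact ⟨b, rfl⟩
    · exfalso
      simp only [Equiv.permCongr_apply, Equiv.symm_symm, Equiv.symm_apply_eq, finSumFinEquiv_apply_left,
        finSumFinEquiv_apply_right] at hx
      rw [← h01 b] at hx
      have := congrArg Fin.val (θ.injective hx)
      simp at this
      omega
  obtain ⟨⟨σ, τ⟩, hστ⟩ := Perm.mem_sumCongrHom_range_of_perm_mapsTo_inl hm
  refine ⟨σ, ?_⟩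
  have hθ : θ = blk (σ, τ) := by
    have h2 : Perm.sumCongr σ τ = finSumFinEquiv.symm.permCongr θ := hστ
    unfold blk
    simp only [h2]
    ext x
    simp [Equiv.permCongr_apply]
  have hτ : τ = 1 := by
    ext1 x
    have := h01 x
    rw [hθ, blk_natAdd] at this
    exact Fin.natAdd_injective _ _ this
  rw [hθ, hτ]

theorem PhProd_blk (n N : ℕ) (f : ℕ → ℕ) (σ : Perm (Fin (n + 2 * N))) :
    PhProd n (N + 1) f (blk (n := n + 2 * N) (M := 2) (σ, 1)) =
      Bn n (f (n + 2 * N)) (f (n + 2 * N + 1)) * PhProd n N f σ := by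
  unfold PhProd
  rw [Fin.prod_univ_castSucc]
  have e1 : ∀ a : Fin n, blk (n := n + 2 * N) (M := 2) (σ, 1) (Fin.castAdd (2 * (N + 1)) a) =
      Fin.castAdd 2 (σ (Fin.castAdd (2 * N) a)) := fun a =>
    blk_castAdd (σ, 1) (Fin.castAdd (2 * N) a)
  have e2 : ∀ (k : Fin N) (b : Bool), blk (n := n + 2 * N) (M := 2) (σ, 1)
      (Fin.natAdd n (pairEquiv (N + 1) (k.castSucc, b))) =
      Fin.castAdd 2 (σ (Fin.natAdd n (pairEquiv N (k, b)))) := fun k b =>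
    blk_castAdd (σ, 1) (Fin.natAdd n (pairEquiv N (k, b)))
  have e3 : blk (n := n + 2 * N) (M := 2) (σ, 1)
      (Fin.natAdd n (pairEquiv (N + 1) (Fin.last N, false))) = Fin.natAdd (n + 2 * N) 0 :=
    blk_natAdd (σ, 1) 0
  have e4 : blk (n := n + 2 * N) (M := 2) (σ, 1)
      (Fin.natAdd n (pairEquiv (N + 1) (Fin.last N, true))) = Fin.natAdd (n + 2 * N) 1 :=
    blk_natAdd (σ, 1) 1
  have e5 : Sf n f (Fin.natAdd (n + 2 * N) (0 : Fin 2)).1 (Fin.natAdd (n + 2 * N) (1 : Fin 2)).1 =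
    Bn n (f (n + 2 * N)) (f (n + 2 * N + 1)) := by
    simp [Sf]
  simp only [e1, e2]
  rw [e3, e4, e5]
  simp only [Fin.val_castAdd]
  ring

theorem sum_fixed (n N : ℕ) (f : ℕ → ℕ) :
    (∑ θ : Perm (Fin (n + 2 * (N + 1))),
      if (θ (Fin.natAdd n (pairEquiv (N + 1) (Fin.last N, false)))).1 = n + 2 * N ∧
        (θ (Fin.natAdd n (pairEquiv (N + 1) (Fin.last N, true)))).1 = n + 2 * N + 1
      then (Perm.sign θ : ℤ) * PhProd n (N + 1) f θ else 0) =
    Bn n (f (n + 2 * N)) (f (n + 2 * N + 1)) * Ph n N f := by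
  rw [← Finset.sum_filter, Ph, Finset.mul_sum]
  symm
  refine Finset.sum_bij (fun σ _ => blk (n := n + 2 * N) (M := 2) (σ, 1)) ?_ ?_ ?_ ?_
  · intro σ _
    rw [Finset.mem_filter]
    refine ⟨Finset.mem_univ _, ?_, ?_⟩
    · exact congrArg Fin.val (blk_natAdd (n := n + 2 * N) (M := 2) (σ, 1) 0)
    · exact congrArg Fin.val (blk_natAdd (n := n + 2 * N) (M := 2) (σ, 1) 1)
  · intro σ _ σ' _ h
    ext1 x
    have := congrArg (fun g : Perm (Fin (n + 2 * N + 2)) => g (Fin.castAdd 2 x)) h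
    simp only [blk_castAdd] at this
    exact Fin.castAdd_injective _ _ this
  · intro θ hθ
    rw [Finset.mem_filter] at hθ
    obtain ⟨σ, hσ⟩ := exists_blk (k := n + 2 * N) θ (Fin.ext hθ.2.1) (Fin.ext hθ.2.2)
    exact ⟨σ, Finset.mem_univ _, hσ.symm⟩
  · intro σ _
    rw [PhProd_blk]
    have : Perm.sign (blk (n := n + 2 * N) (M := 2) (σ, 1)) = Perm.sign σ := by simp [sign_blk]
    have h2 : (Perm.sign (show Perm (Fin (n + 2 * (N + 1))) from blk (n := n + 2 * N) (M := 2) (σ, 1)) : ℤ)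
      = (Perm.sign σ : ℤ) := by exact congrArg _ this
    rw [h2]
    ring

theorem sum_fixed' (n N : ℕ) (f : ℕ → ℕ) (k : Fin (N + 1)) (b : Bool) :
    (∑ θ : Perm (Fin (n + 2 * (N + 1))),
      if (θ (Fin.natAdd n (pairEquiv (N + 1) (k, b)))).1 = n + 2 * N ∧
        (θ (Fin.natAdd n (pairEquiv (N + 1) (k, !b)))).1 = n + 2 * N + 1
      then (Perm.sign θ : ℤ) * PhProd n (N + 1) f θ else 0) =
    Bn n (f (n + 2 * N)) (f (n + 2 * N + 1)) * Ph n N f := by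
  rw [← sum_fixed]
  set q : (Fin (N + 1) → Bool) × Perm (Fin (N + 1)) := (fun _ => b, swap k (Fin.last N)) with hq
  refine Fintype.sum_equiv
    (Equiv.mulRight (blk (1, (pairEquiv (N + 1)).permCongr (hyp q)))) _ _ fun θ => ?_
  rw [Equiv.coe_mulRight, Ph_term_inv]
  simp only [Perm.mul_apply, blk_natAdd, Equiv.permCongr_apply, Equiv.symm_apply_apply, hyp_false, hyp_true,
    hq, swap_apply_right]

theorem Ph_rel (n N : ℕ) (f : ℕ → ℕ) :
    Ph n (N + 1) f + Ph n (N + 1) (f ∘ swap (n + 2 * N) (n + 2 * N + 1)) =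
      4 * (N + 1) * Bn n (f (n + 2 * N)) (f (n + 2 * N + 1)) * Ph n N f := by
  rw [Ph_swap n (N + 1) f (n + 2 * N) (by omega), Ph, ← sub_eq_add_neg, ← Finset.sum_sub_distrib]
  set p := n + 2 * N with hp
  have key : ∀ θ : Perm (Fin (n + 2 * (N + 1))),
      PhProd n (N + 1) f θ - PhProd n (N + 1) (f ∘ swap p (p+1))
        (swap ⟨p, by omega⟩ ⟨p+1, by omega⟩ * θ) =
      ∑ kb : Fin (N + 1) × Bool,
        if (θ (Fin.natAdd n (pairEquiv (N + 1) (kb.1, kb.2)))).1 = p ∧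
          (θ (Fin.natAdd n (pairEquiv (N + 1) (kb.1, !kb.2)))).1 = p + 1
        then 2 * PhProd n (N + 1) f θ else 0 := by
    intro θ
    have hinj : ∀ x y : Fin (N + 1) × Bool, (θ (Fin.natAdd n (pairEquiv (N + 1) x))).1 =
      (θ (Fin.natAdd n (pairEquiv (N + 1) y))).1 → x = y := by
      intro x y h
      exact (pairEquiv _).injective (Fin.natAdd_injective _ _ (θ.injective (Fin.ext h)))
    have e : PhProd n (N + 1) (f ∘ swap p (p+1))
        (swap ⟨p, by omega⟩ ⟨p+1, by omega⟩ * θ) =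
        PhProd n (N + 1) f θ * ∏ k : Fin (N + 1),
          if ((θ (Fin.natAdd n (pairEquiv (N + 1) (k, false)))).1 = p ∧
            (θ (Fin.natAdd n (pairEquiv (N + 1) (k, true)))).1 = p + 1) ∨
            ((θ (Fin.natAdd n (pairEquiv (N + 1) (k, false)))).1 = p + 1 ∧
            (θ (Fin.natAdd n (pairEquiv (N + 1) (k, true)))).1 = p) then (-1 : ℤ) else 1 := by
      unfold PhProd
      simp only [Perm.mul_apply, val_swap, Sf_swap]
      rw [mul_assoc, ← Finset.prod_mul_distrib]
      congr 1
      · simp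
      · refine Finset.prod_congr rfl fun k _ => ?_
        split_ifs <;> simp
    rw [e]
    by_cases hex : ∃ kb : Fin (N + 1) × Bool,
        (θ (Fin.natAdd n (pairEquiv (N + 1) (kb.1, kb.2)))).1 = p ∧
          (θ (Fin.natAdd n (pairEquiv (N + 1) (kb.1, !kb.2)))).1 = p + 1
    · obtain ⟨⟨k, b⟩, h1, h2⟩ := hex
      simp only at h1 h2
      rw [Finset.sum_eq_single (k, b), Finset.prod_eq_single k]
      · rw [if_pos, if_pos ⟨h1, h2⟩]
        · ring
        · cases b
          · left; exact ⟨h1, h2⟩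
          · right; exact ⟨h2, h1⟩
      · intro k' _ hk'
        rw [if_neg]
        rintro (⟨h3, _⟩ | ⟨_, h3⟩)
        · exact hk' (congrArg Prod.fst (hinj _ _ (h3.trans h1.symm)))
        · exact hk' (congrArg Prod.fst (hinj _ _ (h3.trans h1.symm)))
      · simp
      · intro kb _ hkb
        rw [if_neg]
        rintro ⟨h3, _⟩
        exact hkb (hinj _ _ (h3.trans h1.symm))
      · simp
    · rw [Finset.sum_eq_zero, Finset.prod_eq_one]
      · simp
      · intro k _
        rw [if_neg]
        rintro (h | h)
        · exact hex ⟨(k, false), h⟩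
        · exact hex ⟨(k, true), h.symm⟩
      · intro kb _
        rw [if_neg]
        intro h
        exact hex ⟨kb, h⟩
  have e2 : ∀ θ : Perm (Fin (n + 2 * (N + 1))),
      (Perm.sign θ : ℤ) * PhProd n (N + 1) f θ - (Perm.sign θ : ℤ) * PhProd n (N + 1) (f ∘ swap p (p+1))
        (swap ⟨p, by omega⟩ ⟨p+1, by omega⟩ * θ) =
      ∑ kb : Fin (N + 1) × Bool,
        2 * if (θ (Fin.natAdd n (pairEquiv (N + 1) (kb.1, kb.2)))).1 = p ∧
          (θ (Fin.natAdd n (pairEquiv (N + 1) (kb.1, !kb.2)))).1 = p + 1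
        then (Perm.sign θ : ℤ) * PhProd n (N + 1) f θ else 0 := by
    intro θ
    rw [← mul_sub, key, Finset.mul_sum]
    refine Finset.sum_congr rfl fun kb _ => ?_
    split_ifs <;> ring
  rw [Finset.sum_congr rfl fun θ _ => e2 θ, Finset.sum_comm]
  simp only [← Finset.mul_sum, sum_fixed', hp]
  simp
  ring

theorem Fsum_anti (n N : ℕ) (f : ℕ → ℕ) (p : ℕ) (hp : p + 1 < n + 2 * N)
    (h : Bn n (f p) (f (p+1)) = 0 ∨ N = 0) :
    Fsum n N (f ∘ swap p (p+1)) = - Fsum n N f := by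
  have := Ph_anti n N f p hp h
  rw [Ph_eq, Ph_eq] at this
  have h0 : (2 ^ N * N.factorial : ℤ) ≠ 0 := by positivity
  apply mul_left_cancel₀ h0
  linarith

theorem Fsum_rel (n N : ℕ) (f : ℕ → ℕ) :
    Fsum n (N + 1) f + Fsum n (N + 1) (f ∘ swap (n + 2 * N) (n + 2 * N + 1)) =
      2 * Bn n (f (n + 2 * N)) (f (n + 2 * N + 1)) * Fsum n N f := by
  have := Ph_rel n N f
  rw [Ph_eq, Ph_eq, Ph_eq, Nat.factorial_succ, pow_succ] at this
  have h0 : (2 ^ N * N.factorial * (2 * (N + 1)) : ℤ) ≠ 0 := by positivity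
  apply mul_left_cancel₀ h0
  push_cast at this
  linear_combination this

theorem Fsum_congr (n N : ℕ) (f g : ℕ → ℕ) (h : ∀ i < n + 2 * N, f i = g i) :
    Fsum n N f = Fsum n N g := by
  unfold Fsum Sf
  have : ∀ x : Fin (n + 2 * N), f x.1 = g x.1 := fun x => h _ x.2
  simp only [this]

theorem Fsum_missing (n N : ℕ) (f : ℕ → ℕ) (a : ℕ) (ha : a < n) (h : ∀ i < n + 2 * N, f i ≠ a) :
    Fsum n N f = 0 := by
  have h0 : (2 ^ N * N.factorial : ℤ) ≠ 0 := by positivity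
  apply mul_left_cancel₀ h0
  rw [← Ph_eq, Ph, mul_zero]
  refine Finset.sum_eq_zero fun θ _ => ?_
  unfold PhProd
  rw [Finset.prod_eq_zero (Finset.mem_univ (⟨a, ha⟩ : Fin n))]
  · simp
  · rw [if_neg]
    exact h _ (Fin.is_lt _)

theorem Fsum_id (n : ℕ) (f : ℕ → ℕ) (h : ∀ i < n, f i = i) : Fsum n 0 f = 1 := by
  have : Ph n 0 f = 1 := by
    unfold Ph
    rw [Finset.sum_eq_single 1]
    · simp [PhProd, h]
    · intro θ _ hθ
      have : ∃ a : Fin n, (θ a).1 ≠ a.1 := by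
        by_contra! hcon
        apply hθ
        ext x
        exact hcon x
      obtain ⟨a, ha⟩ := this
      unfold PhProd
      rw [Finset.prod_eq_zero (Finset.mem_univ a)]
      · simp
      · rw [if_neg]
        rw [h _ (Fin.is_lt (n := n) _)]
        exact ha
    · simp
  rw [Ph_eq] at this
  simpa using this
end helpers4

section helpers5
open Equiv

/-- contribution of one pair group -/
def tg (l : List ℕ) : ℤ :=
  if Even l.length ∧ l ≠ [] ∧ l.IsChain (· ≠ ·) then
    2 ^ (l.length / 2 - 1) * (if l.headD 0 % 2 = 1 then -1 else 1) else 0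

/-- group key of a letter -/
def keyN (n a : ℕ) : ℕ := if a / 2 = n / 2 then 0 else a / 2 + 1

/-- inversions of a word -/
def invL (n : ℕ) : List ℕ → ℕ
  | [] => 0
  | a :: l => l.countP (fun b => keyN n b < keyN n a) + invL n l

/-- letters of group r -/
def grp (r : ℕ) (l : List ℕ) : List ℕ := l.filter (fun a => a / 2 = r)

theorem grp_append (r : ℕ) (u v : List ℕ) : grp r (u ++ v) = grp r u ++ grp r v := by simp [grp]
theorem grp_cons_pos {r a : ℕ} (h : a / 2 = r) (v : List ℕ) : grp r (a :: v) = a :: grp r v := by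
  simp [grp, h]
theorem grp_cons_neg {r a : ℕ} (h : a / 2 ≠ r) (v : List ℕ) : grp r (a :: v) = grp r v := by
  simp [grp, h]
theorem grp_nil (r : ℕ) : grp r [] = [] := rfl
theorem mem_grp {r a : ℕ} {l : List ℕ} : a ∈ grp r l ↔ a ∈ l ∧ a / 2 = r := by simp [grp]

/-- the claimed value -/
def TT (n : ℕ) (l : List ℕ) : ℤ :=
  (-1) ^ (invL n l) * 2 ^ ((grp (n / 2) l).length / 2) * ∏ r ∈ Finset.range (n / 2), tg (grp r l)

theorem invL_swap (n a b : ℕ) (h : keyN n a ≠ keyN n b) (u v : List ℕ) :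
    (-1 : ℤ) ^ invL n (u ++ a :: b :: v) = - (-1) ^ invL n (u ++ b :: a :: v) := by
  induction u with
  | nil =>
    simp only [List.nil_append, invL, List.countP_cons]
    rcases lt_or_gt_of_ne h with h | h
    · simp [h, h.not_gt, pow_add]; ring
    · simp [h, h.not_gt, pow_add]; ring
  | cons c u ih =>
    simp only [List.cons_append, invL, pow_add, ih]
    have : (u ++ a :: b :: v).Perm (u ++ b :: a :: v) := (List.Perm.swap b a v).append_left u
    rw [this.countP_eq]
    ring

theorem invL_swap' (n a b : ℕ) (h : keyN n a = keyN n b) (u v : List ℕ) :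
    invL n (u ++ a :: b :: v) = invL n (u ++ b :: a :: v) := by
  induction u with
  | nil =>
    simp only [List.nil_append, invL, List.countP_cons, h]
  | cons c u ih =>
    simp only [List.cons_append, invL, ih]
    have : (u ++ a :: b :: v).Perm (u ++ b :: a :: v) := (List.Perm.swap b a v).append_left u
    rw [this.countP_eq]

theorem invL_tail (n a b : ℕ) (h : keyN n a = keyN n b) (u : List ℕ) :
    (-1 : ℤ) ^ invL n (u ++ [a, b]) = (-1) ^ invL n u := by
  induction u with
  | nil => simp [invL, h]
  | cons c u ih =>
    simp only [List.cons_append, invL, pow_add, ih, List.countP_append, List.countP_cons,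
      List.countP_nil, h]
    split_ifs <;> simp

theorem keyN_ne {n a b : ℕ} (h : a / 2 ≠ b / 2) : keyN n a ≠ keyN n b := by
  unfold keyN
  split_ifs <;> omega

theorem keyN_eq {n a b : ℕ} (h : a / 2 = b / 2) : keyN n a = keyN n b := by
  unfold keyN
  rw [h]

theorem grp_swap {r a b : ℕ} (h : a / 2 ≠ b / 2) (u v : List ℕ) :
    grp r (u ++ a :: b :: v) = grp r (u ++ b :: a :: v) := by
  rw [grp_append, grp_append]
  congr 1
  by_cases h1 : a / 2 = r
  · have h2 : b / 2 ≠ r := fun h' => h (h1.trans h'.symm)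
    rw [grp_cons_pos h1, grp_cons_neg h2, grp_cons_neg h2, grp_cons_pos h1]
  · by_cases h2 : b / 2 = r
    · rw [grp_cons_neg h1, grp_cons_pos h2, grp_cons_pos h2, grp_cons_neg h1]
    · rw [grp_cons_neg h1, grp_cons_neg h2, grp_cons_neg h2, grp_cons_neg h1]

theorem TT_swap (n a b : ℕ) (h : a / 2 ≠ b / 2) (u v : List ℕ) :
    TT n (u ++ a :: b :: v) = - TT n (u ++ b :: a :: v) := by
  unfold TT
  rw [invL_swap n a b (keyN_ne h)]
  simp only [grp_swap h]
  ring

theorem TT_double (n a : ℕ) (h : a / 2 < n / 2) (u v : List ℕ) : TT n (u ++ a :: a :: v) = 0 := by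
  unfold TT
  rw [Finset.prod_eq_zero (Finset.mem_range.mpr h), mul_zero]
  unfold tg
  rw [if_neg]
  rintro ⟨_, _, hc⟩
  rw [grp_append, grp_cons_pos rfl, grp_cons_pos rfl, List.isChain_append] at hc
  have := hc.2.1
  simp at this

theorem TT_zz (n a : ℕ) (h : a / 2 = n / 2) (u : List ℕ) : TT n (u ++ [a, a]) = 2 * TT n u := by
  unfold TT
  rw [invL_tail n a a rfl]
  have h1 : ∏ r ∈ Finset.range (n / 2), tg (grp r (u ++ [a, a])) = ∏ r ∈ Finset.range (n / 2), tg (grp r u) := by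
    refine Finset.prod_congr rfl fun r hr => ?_
    have : a / 2 ≠ r := by rw [Finset.mem_range] at hr; omega
    rw [grp_append, grp_cons_neg this, grp_cons_neg this, grp_nil, List.append_nil]
  rw [h1, grp_append, grp_cons_pos h, grp_cons_pos h, grp_nil, List.length_append]
  have : ((grp (n / 2) u).length + [a, a].length) / 2 = (grp (n / 2) u).length / 2 + 1 := by
    simp
  rw [this, pow_succ]
  ring

theorem tg_aba (a b : ℕ) (h : a ≠ b) (u : List ℕ) : tg (u ++ [a, b, a]) = 2 * tg (u ++ [a]) := by
  have hc : (u ++ [a, b, a]).IsChain (· ≠ ·) ↔ (u ++ [a]).IsChain (· ≠ ·) := by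
    simp [List.isChain_append, h, h.symm]
  have hl : (u ++ [a, b, a]).length = (u ++ [a]).length + 2 := by simp
  have hh : (u ++ [a, b, a]).headD 0 = (u ++ [a]).headD 0 := by cases u <;> simp
  unfold tg
  simp only [hc, hl, hh]
  by_cases hcond : Even (u ++ [a]).length ∧ u ++ [a] ≠ [] ∧ (u ++ [a]).IsChain (· ≠ ·)
  · rw [if_pos hcond, if_pos ⟨hcond.1.add (by decide), by simp, hcond.2.2⟩]
    have h1 : 1 ≤ (u ++ [a]).length := by simp
    obtain ⟨k, hk⟩ := hcond.1
    have : ((u ++ [a]).length + 2) / 2 - 1 = (u ++ [a]).length / 2 - 1 + 1 := by omega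
    rw [this, pow_succ]
    ring
  · rw [if_neg hcond, if_neg, mul_zero]
    rintro ⟨h1, h2, h3⟩
    exact hcond ⟨by simpa [Nat.even_add] using h1, by simp, h3⟩

theorem TT_aba (n a b : ℕ) (hab : a ≠ b) (hg : a / 2 = b / 2) (h : a / 2 < n / 2) (u : List ℕ) :
    TT n (u ++ [a, b, a]) = 2 * TT n (u ++ [a]) := by
  have e : u ++ [a, b, a] = (u ++ [a]) ++ [b, a] := by simp
  unfold TT
  have h1 : (-1 : ℤ) ^ invL n (u ++ [a, b, a]) = (-1) ^ invL n (u ++ [a]) := by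
    rw [e, invL_tail n b a (keyN_eq hg.symm)]
  have h2 : ∀ r, r ≠ a / 2 → grp r (u ++ [a, b, a]) = grp r (u ++ [a]) := by
    intro r hr
    simp only [grp_append]
    rw [grp_cons_neg hr.symm, grp_cons_neg (by omega), grp_cons_neg hr.symm]
  have h3 : tg (grp (a / 2) (u ++ [a, b, a])) = 2 * tg (grp (a / 2) (u ++ [a])) := by
    simp only [grp_append]
    rw [grp_cons_pos rfl, grp_cons_pos hg.symm, grp_cons_pos rfl, grp_nil, tg_aba a b hab]
  rw [h1, h2 _ (by omega), ← Finset.mul_prod_erase _ _ (Finset.mem_range.mpr h),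
    ← Finset.mul_prod_erase _ _ (Finset.mem_range.mpr h), h3,
    Finset.prod_congr rfl fun r hr => by rw [h2 r (Finset.ne_of_mem_erase hr)]]
  ring

/-- shuffle sum on words -/
def Fl (n N : ℕ) (l : List ℕ) : ℤ := Fsum n N (fun i => l.getD i 0)

theorem getD_swap (a b : ℕ) (u v : List ℕ) (i : ℕ) :
    (u ++ b :: a :: v).getD i 0 = (u ++ a :: b :: v).getD (swap u.length (u.length + 1) i) 0 := by
  rw [swap_apply_def]
  split_ifs with h1 h2
  · subst h1; simp [List.getD_eq_getElem?_getD]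
  · subst h2; simp [List.getD_eq_getElem?_getD]
  · simp only [List.getD_eq_getElem?_getD, List.getElem?_append]
    split_ifs with h3
    · rfl
    · have : ∃ j, i - u.length = j + 2 := ⟨i - u.length - 2, by omega⟩
      obtain ⟨j, hj⟩ := this
      rw [hj]
      simp

theorem Fl_swap (n N a b : ℕ) (u v : List ℕ) (hl : (u ++ a :: b :: v).length = n + 2 * N)
    (h : Bn n a b = 0 ∨ N = 0) : Fl n N (u ++ b :: a :: v) = - Fl n N (u ++ a :: b :: v) := by
  unfold Fl
  rw [← Fsum_anti n N _ u.length]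
  · congr 1
    funext i
    exact getD_swap a b u v i
  · simp at hl; omega
  · simpa [List.getD_eq_getElem?_getD] using h

theorem Fl_rel (n N a b : ℕ) (u : List ℕ) (hl : u.length = n + 2 * N) :
    Fl n (N + 1) (u ++ [a, b]) + Fl n (N + 1) (u ++ [b, a]) = 2 * Bn n a b * Fl n N u := by
  have := Fsum_rel n N (fun i => (u ++ [a, b]).getD i 0)
  rw [← hl] at this
  have e1 : (fun i => (u ++ [a, b]).getD i 0) ∘ swap u.length (u.length + 1) =
    fun i => (u ++ [b, a]).getD i 0 := by
    funext i
    exact (getD_swap a b u [] i).symm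
  rw [e1] at this
  unfold Fl
  rw [this]
  have e2 : Fsum n N (fun i => (u ++ [a, b]).getD i 0) = Fsum n N (fun i => u.getD i 0) := by
    apply Fsum_congr
    intro i hi
    simp only [List.getD_eq_getElem?_getD]
    rw [List.getElem?_append_left (by omega)]
  rw [e2]
  simp [List.getD_eq_getElem?_getD]

theorem move_aux (P : List ℕ → Prop)
    (hs : ∀ u a b v, a / 2 ≠ b / 2 → P (u ++ a :: b :: v) → P (u ++ b :: a :: v)) (a : ℕ) (v : List ℕ)
    (x : List ℕ) : (∀ y ∈ x, y / 2 ≠ a / 2) → ∀ u, P (u ++ (x ++ a :: v)) → P (u ++ a :: (x ++ v)) := by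
  induction x with
  | nil => intro _ u h; exact h
  | cons b x ih =>
    intro hx u h
    have h1 := ih (fun y hy => hx y (List.mem_cons_of_mem _ hy)) (u ++ [b]) (by simpa using h)
    have h2 : P (u ++ b :: a :: (x ++ v)) := by simpa using h1
    exact hs _ _ _ _ (hx b List.mem_cons_self) h2

theorem gather_aux (P : List ℕ → Prop)
    (hs : ∀ u a b v, a / 2 ≠ b / 2 → P (u ++ a :: b :: v) → P (u ++ b :: a :: v)) (r : ℕ)
    (l : List ℕ) : ∀ u, P (u ++ (l.filter (fun a => a / 2 ≠ r) ++ grp r l)) → P (u ++ l) := by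
  induction l with
  | nil => intro u h; simpa [grp] using h
  | cons a l ih =>
    intro u h
    by_cases ha : a / 2 = r
    · rw [grp_cons_pos ha, List.filter_cons_of_neg (by simpa using ha)] at h
      have h1 := move_aux P hs a (grp r l) _ (by
        intro y hy
        rw [List.mem_filter] at hy
        rw [ha]
        simpa using hy.2) u h
      have := ih (u ++ [a]) (by simpa using h1)
      simpa using this
    · rw [grp_cons_neg ha, List.filter_cons_of_pos (by simpa using ha)] at h
      have := ih (u ++ [a]) (by simpa using h)
      simpa using this

theorem length_eq_sum (k : ℕ) (l : List ℕ) (h : ∀ a ∈ l, a / 2 < k) :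
    l.length = ∑ r ∈ Finset.range k, (grp r l).length := by
  induction l with
  | nil => simp [grp]
  | cons a l ih =>
    have ha := h a List.mem_cons_self
    have : ∀ r, (grp r (a :: l)).length = (grp r l).length + if a / 2 = r then 1 else 0 := by
      intro r
      by_cases h : a / 2 = r
      · simp [grp_cons_pos h, h]
      · simp [grp_cons_neg h, h]
    simp only [this, Finset.sum_add_distrib, List.length_cons]
    rw [ih fun b hb => h b (List.mem_cons_of_mem _ hb)]
    simp [ha]

theorem split_last (l : List ℕ) (k : ℕ) (h : k ≤ l.length) : ∃ w x, l = w ++ x ∧ x.length = k :=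
  ⟨l.take (l.length - k), l.drop (l.length - k), by simp, by simp; omega⟩

theorem TT_missing (n N a : ℕ) (l : List ℕ) (hl : l.length = n + 2 * N) (hb : ∀ x ∈ l, x < n)
    (ha : a < n) (hm : a ∉ l) : TT n l = 0 := by
  by_contra hne
  unfold TT at hne
  have hprod := right_ne_zero_of_mul hne
  rw [Finset.prod_ne_zero_iff] at hprod
  have hcond : ∀ r < n / 2, Even (grp r l).length ∧ grp r l ≠ [] ∧ (grp r l).IsChain (· ≠ ·) := by
    intro r hr
    have := hprod r (Finset.mem_range.mpr hr)
    unfold tg at this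
    by_contra hcon
    rw [if_neg hcon] at this
    exact this rfl
  by_cases h : a / 2 < n / 2
  · obtain ⟨h1, h2, h3⟩ := hcond _ h
    have hmem : ∀ x ∈ grp (a / 2) l, x / 2 = a / 2 ∧ x ≠ a := by
      intro x hx
      rw [mem_grp] at hx
      exact ⟨hx.2, fun h => hm (h ▸ hx.1)⟩
    match hg : grp (a / 2) l with
    | [] => exact h2 hg
    | [x] => rw [hg] at h1; simp at h1
    | x :: y :: t =>
      rw [hg] at h3 hmem
      have hx := hmem x (by simp)
      have hy := hmem y (by simp)
      simp only [List.isChain_cons_cons] at h3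
      apply h3.1
      omega
  · have hlen := length_eq_sum (n / 2) l (by
      intro x hx
      have := hb x hx
      have : x ≠ a := fun h => hm (h ▸ hx)
      omega)
    have : Even l.length := by
      rw [hlen]
      exact Finset.even_sum _ fun r hr => (hcond r (Finset.mem_range.mp hr)).1
    rw [Nat.even_iff] at this
    omega

theorem exists_big (n N : ℕ) (l : List ℕ) (hl : l.length = n + 2 * (N + 1)) (hb : ∀ x ∈ l, x < n) :
    (∃ r < n / 2, 3 ≤ (grp r l).length) ∨ 2 ≤ (grp (n / 2) l).length := by
  by_contra! hcon
  obtain ⟨h1, h2⟩ := hcon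
  have hlen := length_eq_sum (n / 2 + 1) l (by intro x hx; have := hb x hx; omega)
  rw [Finset.sum_range_succ] at hlen
  have h3 : ∑ r ∈ Finset.range (n / 2), (grp r l).length ≤ ∑ r ∈ Finset.range (n / 2), 2 :=
    Finset.sum_le_sum fun r hr => by have := h1 r (Finset.mem_range.mp hr); omega
  simp at h3
  omega

theorem Bn_self {n a : ℕ} (h : a / 2 < n / 2) : Bn n a a = 0 := by
  unfold Bn; rw [if_pos rfl, if_neg (by omega), if_pos rfl]

theorem Fl_double (n N a : ℕ) (h : a / 2 < n / 2) (u v : List ℕ)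
    (hl : (u ++ a :: a :: v).length = n + 2 * N) : Fl n N (u ++ a :: a :: v) = 0 := by
  have := Fl_swap n N a a u v hl (Or.inl (Bn_self h))
  omega

theorem step (n N : ℕ) (ih : ∀ l : List ℕ, l.length = n + 2 * N → (∀ x ∈ l, x < n) → Fl n N l = TT n l)
    (l : List ℕ) (hl : l.length = n + 2 * (N + 1)) (hb : ∀ x ∈ l, x < n) :
    Fl n (N + 1) l = TT n l := by
  let P : List ℕ → Prop := fun l => l.length = n + 2 * (N + 1) → (∀ x ∈ l, x < n) → Fl n (N + 1) l = TT n l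
  have hs : ∀ u a b v, a / 2 ≠ b / 2 → P (u ++ a :: b :: v) → P (u ++ b :: a :: v) := by
    intro u a b v hab h hl hb
    have hl' : (u ++ a :: b :: v).length = n + 2 * (N + 1) := by simpa using hl
    rw [TT_swap n b a hab.symm, ← h hl' (by intro x hx; apply hb; simp at hx ⊢; tauto)]
    exact Fl_swap n (N + 1) a b u v hl' (Or.inl (by unfold Bn; rw [if_neg hab]))
  suffices h : ∃ r, P ([] ++ (l.filter (fun a => a / 2 ≠ r) ++ grp r l)) by
    obtain ⟨r, h⟩ := h
    exact gather_aux P hs r l [] h hl hb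
  rcases exists_big n N l hl hb with ⟨r, hr, h3⟩ | h2
  · refine ⟨r, ?_⟩
    obtain ⟨w, x, hwx, hx⟩ := split_last _ _ h3
    obtain ⟨a, b, c, rfl⟩ := List.length_eq_three.mp hx
    have hmem : ∀ y ∈ [a, b, c], y / 2 = r := by
      intro y hy
      have : y ∈ grp r l := by rw [hwx]; exact List.mem_append_right _ hy
      exact (mem_grp.mp this).2
    have ha := hmem a (by simp)
    have hbb := hmem b (by simp)
    have hcc := hmem c (by simp)
    rw [hwx, List.nil_append, ← List.append_assoc]
    generalize l.filter (fun a => a / 2 ≠ r) ++ w = u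
    intro hl hb
    by_cases hab : a = b
    · subst hab
      rw [Fl_double _ _ _ (by omega) _ _ hl, TT_double _ _ (by omega)]
    by_cases hbc : b = c
    · subst hbc
      have e : u ++ [a, b, b] = (u ++ [a]) ++ b :: b :: [] := by simp
      rw [e] at hl ⊢
      rw [Fl_double _ _ _ (by omega) _ _ hl, TT_double _ _ (by omega)]
    have hac : a = c := by omega
    subst hac
    rw [TT_aba n a b hab (by omega) (by omega)]
    have hl' : (u ++ [a]).length = n + 2 * N := by simp at hl ⊢; omega
    rw [← ih (u ++ [a]) hl' (by intro x hx; apply hb; simp at hx ⊢; tauto)]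
    have h1 := Fl_rel n N b a (u ++ [a]) hl'
    have e1 : (u ++ [a]) ++ [b, a] = u ++ [a, b, a] := by simp
    have e2 : (u ++ [a]) ++ [a, b] = u ++ a :: a :: [b] := by simp
    have hB : Bn n b a = 1 := by
      unfold Bn; rw [if_pos (by omega), if_neg (by omega), if_neg (by omega)]
    rw [e1, e2, Fl_double n (N + 1) a (by omega) u [b] (by simpa using hl), hB] at h1
    linarith
  · refine ⟨n / 2, ?_⟩
    obtain ⟨w, x, hwx, hx⟩ := split_last _ _ h2
    obtain ⟨a, b, rfl⟩ := List.length_eq_two.mp hx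
    have hmem : ∀ y ∈ [a, b], y < n ∧ y / 2 = n / 2 := by
      intro y hy
      have : y ∈ grp (n / 2) l := by rw [hwx]; exact List.mem_append_right _ hy
      exact ⟨hb y (mem_grp.mp this).1, (mem_grp.mp this).2⟩
    have ha := hmem a (by simp)
    have hbb := hmem b (by simp)
    have hab : a = b := by omega
    subst hab
    rw [hwx, List.nil_append, ← List.append_assoc]
    generalize l.filter (fun a => a / 2 ≠ n / 2) ++ w = u
    intro hl hb
    have hl' : u.length = n + 2 * N := by simp at hl; omega
    have h1 := Fl_rel n N a a u hl'
    have hB : Bn n a a = 2 := by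
      unfold Bn; rw [if_pos rfl, if_pos ha.2]
    rw [TT_zz n a ha.2, ← ih u hl' (by intro x hx; apply hb; simp [hx])]
    rw [hB] at h1
    linarith
end helpers5

section helpers6
open Equiv

theorem tg_pair (a b : ℕ) (hab : a ≠ b) (hg : a / 2 = b / 2) : tg [a, b] = - tg [b, a] := by
  have e1 : Even [a, b].length ∧ [a, b] ≠ [] ∧ [a, b].IsChain (· ≠ ·) := by simp [hab]
  have e2 : Even [b, a].length ∧ [b, a] ≠ [] ∧ [b, a].IsChain (· ≠ ·) := by simp [hab.symm]
  unfold tg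
  rw [if_pos e1, if_pos e2]
  simp only [List.headD_cons, List.length_cons, List.length_nil]
  rcases Nat.mod_two_eq_zero_or_one a with h | h
  · have : b % 2 = 1 := by omega
    simp [h, this]
  · have : b % 2 = 0 := by omega
    simp [h, this]

theorem TT_swap_nodup (n a b : ℕ) (u v : List ℕ) (hnd : (u ++ a :: b :: v).Nodup)
    (hb : ∀ x ∈ u ++ a :: b :: v, x < n) :
    TT n (u ++ a :: b :: v) = - TT n (u ++ b :: a :: v) := by
  by_cases hg : a / 2 = b / 2
  · have hab : a ≠ b := by
      rintro rfl
      simp [List.nodup_append] at hnd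
    have ha := hb a (by simp)
    have hbb := hb b (by simp)
    have hr : a / 2 < n / 2 := by omega
    have hin : ∀ x, x / 2 = a / 2 → x = a ∨ x = b := by intro x hx; omega
    have hu : ∀ x ∈ u, x ≠ a ∧ x ≠ b := by
      intro x hx
      rw [List.nodup_append] at hnd
      exact ⟨hnd.2.2 x hx a (by simp), hnd.2.2 x hx b (by simp)⟩
    have hv : ∀ x ∈ v, x ≠ a ∧ x ≠ b := by
      intro x hx
      have h2 := (List.nodup_append.mp hnd).2.1
      simp only [List.nodup_cons, List.mem_cons, not_or] at h2
      exact ⟨fun h => h2.1.2 (h ▸ hx), fun h => h2.2.1 (h ▸ hx)⟩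
    have gu : grp (a / 2) u = [] := by
      rw [List.eq_nil_iff_forall_not_mem]
      intro x hx
      rw [mem_grp] at hx
      have := hu x hx.1
      rcases hin x hx.2 with h | h <;> tauto
    have gv : grp (a / 2) v = [] := by
      rw [List.eq_nil_iff_forall_not_mem]
      intro x hx
      rw [mem_grp] at hx
      have := hv x hx.1
      rcases hin x hx.2 with h | h <;> tauto
    have h1 : tg (grp (a / 2) (u ++ a :: b :: v)) = - tg (grp (a / 2) (u ++ b :: a :: v)) := by
      rw [grp_append, grp_append, gu, grp_cons_pos rfl, grp_cons_pos hg.symm, grp_cons_pos hg.symm,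
        grp_cons_pos rfl, gv, List.nil_append, List.nil_append, tg_pair a b hab hg]
    have h2 : ∀ r, r ≠ a / 2 → grp r (u ++ a :: b :: v) = grp r (u ++ b :: a :: v) := by
      intro r hr
      have e1 : a / 2 ≠ r := hr.symm
      have e2 : b / 2 ≠ r := by omega
      rw [grp_append, grp_append, grp_cons_neg e1, grp_cons_neg e2, grp_cons_neg e2,
        grp_cons_neg e1]
    unfold TT
    rw [invL_swap' n a b (keyN_eq hg), h2 _ (by omega),
      ← Finset.mul_prod_erase _ _ (Finset.mem_range.mpr hr),
      ← Finset.mul_prod_erase _ _ (Finset.mem_range.mpr hr), h1,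
      Finset.prod_congr rfl fun r hr => by rw [h2 r (Finset.ne_of_mem_erase hr)]]
    ring
  · exact TT_swap n a b hg u v

theorem base_perm (n : ℕ) (l1 l2 : List ℕ) (hp : l1.Perm l2) : ∀ u : List ℕ, (u ++ l1).Nodup →
    (u ++ l1).length = n → (∀ x ∈ u ++ l1, x < n) →
    (Fl n 0 (u ++ l1) = TT n (u ++ l1) ↔ Fl n 0 (u ++ l2) = TT n (u ++ l2)) := by
  induction hp with
  | nil => intros; rfl
  | cons x _ ih =>
    intro u h1 h2 h3
    have := ih (u ++ [x]) (by simpa using h1) (by simpa using h2) (by simpa using h3)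
    simpa using this
  | swap b a l =>
    intro u h1 h2 h3
    rw [TT_swap_nodup n a b u l h1 h3, Fl_swap n 0 b a u l (by simpa using h2) (Or.inr rfl)]
    exact neg_inj
  | trans p1 p2 ih1 ih2 =>
    intro u h1 h2 h3
    have p := p1.append_left u
    rw [ih1 u h1 h2 h3]
    exact ih2 u (p.nodup_iff.mp h1) (by rw [← p.length_eq]; exact h2)
      (fun x hx => h3 x (p.mem_iff.mpr hx))

theorem invL_snoc (n a : ℕ) (l : List ℕ) :
    invL n (l ++ [a]) = invL n l + l.countP (fun b => keyN n a < keyN n b) := by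
  induction l with
  | nil => simp [invL]
  | cons b l ih =>
    simp only [List.cons_append, invL, ih, List.countP_append, List.countP_cons, List.countP_nil]
    simp only [decide_eq_true_eq]
    omega

theorem invL_range_even (n k : ℕ) (h : k ≤ 2 * (n / 2)) : invL n (List.range k) = 0 := by
  induction k with
  | zero => rfl
  | succ k ih =>
    rw [List.range_succ, invL_snoc, ih (by omega), zero_add, List.countP_eq_zero]
    intro b hb
    rw [List.mem_range] at hb
    simp only [decide_eq_true_eq, not_lt]
    unfold keyN
    rw [if_neg (by omega), if_neg (by omega)]
    omega

theorem invL_range (n : ℕ) : (-1 : ℤ) ^ invL n (List.range n) = 1 := by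
  rcases Nat.even_or_odd' n with ⟨k, hk | hk⟩
  · rw [invL_range_even n n (by omega), pow_zero]
  · have : List.range n = List.range (2 * k) ++ [2 * k] := by rw [hk, List.range_succ]
    rw [this, invL_snoc, invL_range_even n _ (by omega), zero_add, List.countP_eq_length.mpr]
    · simp
    · intro b hb
      rw [List.mem_range] at hb
      simp only [decide_eq_true_eq]
      unfold keyN
      rw [if_pos (by omega), if_neg (by omega)]
      omega

theorem grp_range (r k : ℕ) : grp r (List.range (2 * k)) = if r < k then [2 * r, 2 * r + 1] else [] := by
  induction k with
  | zero => simp [grp]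
  | succ k ih =>
    have : List.range (2 * (k + 1)) = List.range (2 * k) ++ [2 * k, 2 * k + 1] := by
      rw [show 2 * (k + 1) = 2 * k + 1 + 1 by ring, List.range_succ, List.range_succ]; simp
    rw [this, grp_append, ih]
    by_cases h : r = k
    · subst h
      rw [if_neg (by omega), if_pos (by omega), grp_cons_pos (by omega), grp_cons_pos (by omega), grp_nil]
      rfl
    · rw [grp_cons_neg (by omega), grp_cons_neg (by omega), grp_nil, List.append_nil]
      congr 1
      apply propext
      omega

theorem TT_range (n : ℕ) : TT n (List.range n) = 1 := by
  have hz : (grp (n / 2) (List.range n)).length / 2 = 0 ∧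
      ∀ r < n / 2, grp r (List.range n) = [2 * r, 2 * r + 1] := by
    rcases Nat.even_or_odd' n with ⟨k, hk | hk⟩
    · subst hk
      constructor
      · rw [grp_range, if_neg (by omega)]; rfl
      · intro r hr
        rw [grp_range, if_pos (by omega)]
    · have : List.range n = List.range (2 * k) ++ [2 * k] := by rw [hk, List.range_succ]
      rw [this]
      constructor
      · rw [grp_append, grp_range, if_neg (by omega), grp_cons_pos (by omega)]; simp [grp_nil]
      · intro r hr
        rw [grp_append, grp_range, if_pos (by omega), grp_cons_neg (by omega)]; rfl
  unfold TT
  rw [invL_range, hz.1, Finset.prod_congr rfl (g := fun _ => (1 : ℤ))]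
  · simp
  · intro r hr
    rw [hz.2 r (Finset.mem_range.mp hr)]
    unfold tg
    rw [if_pos (by simp)]
    simp

theorem base (n : ℕ) (l : List ℕ) (hl : l.length = n) (hb : ∀ x ∈ l, x < n) : Fl n 0 l = TT n l := by
  by_cases h : ∀ a < n, a ∈ l
  · have hp : (List.range n).Perm l := by
      have hs : (List.range n).Subperm l :=
        List.subperm_of_subset List.nodup_range fun x hx => h x (List.mem_range.mp hx)
      exact hs.perm_of_length_le (by simp [hl])
    have := base_perm n _ _ hp [] (by simpa using List.nodup_range) (by simp) (by simp)
    simp only [List.nil_append] at this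
    rw [← this, TT_range]
    apply Fsum_id
    intro i hi
    simp [List.getD_eq_getElem?_getD, hi]
  · push Not at h
    obtain ⟨a, ha, hm⟩ := h
    rw [TT_missing n 0 a l (by simpa using hl) hb ha hm]
    apply Fsum_missing n 0 _ a ha
    intro i hi he
    apply hm
    rw [← he]
    rw [List.getD_eq_getElem _ _ (by omega)]
    exact List.getElem_mem _

theorem Fl_eq_TT (n N : ℕ) : ∀ l : List ℕ, l.length = n + 2 * N → (∀ x ∈ l, x < n) →
    Fl n N l = TT n l := by
  induction N with
  | zero => intro l hl hb; exact base n l (by simpa using hl) hb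
  | succ N ih => intro l hl hb; exact step n N ih l hl hb

end helpers6

section helpers7
open Equiv

theorem countP_ofFn (p : ℕ → Prop) [DecidablePred p] (m : ℕ) : ∀ g : Fin m → ℕ,
    (List.ofFn g).countP (fun a => decide (p a)) = (Finset.univ.filter fun i => p (g i)).card := by
  induction m with
  | zero => intro g; simp
  | succ m ih =>
    intro g
    rw [List.ofFn_succ, List.countP_cons, ih, Fin.card_filter_univ_succ']
    simp only [decide_eq_true_eq, Function.comp_def]
    omega

theorem grp_length (r m : ℕ) (g : Fin m → ℕ) :
    (grp r (List.ofFn g)).length = (Finset.univ.filter fun i => g i / 2 = r).card := by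
  unfold grp
  rw [← List.countP_eq_length_filter]
  exact countP_ofFn (fun a => a / 2 = r) m g

theorem invL_ofFn (n m : ℕ) : ∀ g : Fin m → ℕ, invL n (List.ofFn g) =
    (Finset.univ.filter fun p : Fin m × Fin m =>
      p.1 < p.2 ∧ keyN n (g p.2) < keyN n (g p.1)).card := by
  induction m with
  | zero => intro g; simp [invL]
  | succ m ih =>
    intro g
    rw [List.ofFn_succ, invL, ih, countP_ofFn (fun b => keyN n b < keyN n (g 0))]
    simp only [Finset.card_filter, Fintype.sum_prod_type]
    rw [Fin.sum_univ_succ]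
    simp only [Fin.sum_univ_succ (n := m)]
    simp [Fin.succ_pos]

theorem head_ofFn (p : ℕ → Prop) [DecidablePred p] (x m : ℕ) : ∀ g : Fin m → ℕ,
    (x ∈ ((List.ofFn g).filter (fun a => decide (p a))).head? ↔
      ∃ i, g i = x ∧ p x ∧ ∀ j, j < i → ¬ p (g j)) := by
  induction m with
  | zero => intro g; simp
  | succ m ih =>
    intro g
    rw [List.ofFn_succ, Fin.exists_fin_succ]
    by_cases h : p (g 0)
    · rw [List.filter_cons_of_pos (by simpa using h)]
      simp only [List.head?_cons, Option.mem_def, Option.some.injEq]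
      constructor
      · rintro rfl
        left
        exact ⟨rfl, h, fun j hj => absurd hj (Fin.not_lt_zero j)⟩
      · rintro (⟨h1, _⟩ | ⟨i, _, _, h3⟩)
        · exact h1
        · exact absurd h (h3 0 (Fin.succ_pos i))
    · rw [List.filter_cons_of_neg (by simpa using h), ih]
      constructor
      · rintro ⟨i, h1, h2, h3⟩
        right
        refine ⟨i, h1, h2, ?_⟩
        intro j
        refine Fin.cases (fun _ => h) (fun j hj => h3 j (by simpa using hj)) j
      · rintro (⟨h1, h2, _⟩ | ⟨i, h1, h2, h3⟩)
        · exact absurd (h1 ▸ h2) h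
        · exact ⟨i, h1, h2, fun j hj => h3 j.succ (by simpa using hj)⟩

theorem chain_ofFn (r m : ℕ) : ∀ g : Fin m → ℕ,
    ((grp r (List.ofFn g)).IsChain (· ≠ ·) ↔
      ∀ i j : Fin m, i < j → g i / 2 = r → g j / 2 = r →
        (∀ l : Fin m, i < l → l < j → g l / 2 ≠ r) → g i ≠ g j) := by
  induction m with
  | zero => intro g; simp [grp]
  | succ m ih =>
    intro g
    have hstep : (∀ i j : Fin m, i < j → g i.succ / 2 = r → g j.succ / 2 = r →
        (∀ l : Fin m, i < l → l < j → g l.succ / 2 ≠ r) → g i.succ ≠ g j.succ) ↔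
        (∀ (i : Fin m) (j : Fin (m + 1)), i.succ < j → g i.succ / 2 = r → g j / 2 = r →
        (∀ l : Fin (m + 1), i.succ < l → l < j → g l / 2 ≠ r) → g i.succ ≠ g j) := by
      constructor
      · intro H i j hij h1 h2 h3
        obtain ⟨j, rfl⟩ := Fin.exists_succ_eq.mpr (Fin.ne_zero_of_lt hij)
        exact H i j (by simpa using hij) h1 h2 fun l hl hl' => h3 l.succ (by simpa using hl) (by simpa using hl')
      · intro H i j hij h1 h2 h3
        refine H i j.succ (by simpa using hij) h1 h2 fun l hl hl' => ?_
        obtain ⟨l, rfl⟩ := Fin.exists_succ_eq.mpr (Fin.ne_zero_of_lt hl)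
        exact h3 l (by simpa using hl) (by simpa using hl')
    have ih' := (ih (fun i => g i.succ)).trans hstep
    rw [List.ofFn_succ, Fin.forall_fin_succ, ← ih']
    by_cases h : g 0 / 2 = r
    · rw [grp_cons_pos h, List.isChain_cons]
      refine and_congr ?_ Iff.rfl
      have hd := fun x => head_ofFn (fun a => a / 2 = r) x m (fun i => g i.succ)
      constructor
      · intro H j hj _ h2 h3
        obtain ⟨j, rfl⟩ := Fin.exists_succ_eq.mpr (Fin.ne_zero_of_lt hj)
        exact H _ ((hd _).mpr ⟨j, rfl, h2, fun l hl => h3 l.succ (Fin.succ_pos l) (by simpa using hl)⟩)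
      · intro H y hy
        obtain ⟨j, h1, h2, h3⟩ := (hd y).mp hy
        subst h1
        refine H j.succ (Fin.succ_pos j) h h2 fun l hl hl' => ?_
        obtain ⟨l, rfl⟩ := Fin.exists_succ_eq.mpr (Fin.ne_zero_of_lt hl)
        exact h3 l (by simpa using hl')
    · rw [grp_cons_neg h]
      constructor
      · intro H
        exact ⟨fun j _ h0 => absurd h0 h, H⟩
      · intro H
        exact H.2

/-- the word of a monomial -/
def wordOf {m n : ℕ} (c : Fin m → Fin n) : List ℕ := List.ofFn fun i => (c i).1

theorem coeff_eq_TT (n m : ℕ) (hnm : n ≤ m) (hpar : m % 2 = n % 2) (c : Fin m → Fin n) :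
    MvPolynomial.coeff (expOf c) (DPfSum n m hnm) = TT n (wordOf c) := by
  rw [coeff_eq_Fsum n m hnm hpar c, ← Fl_eq_TT n ((m - n) / 2)]
  · apply Fsum_congr
    intro i hi
    have him : i < m := by omega
    simp [ext0, wordOf, him, List.getD_eq_getElem?_getD]
  · simp [wordOf]; omega
  · intro x hx
    rw [wordOf, List.mem_ofFn] at hx
    obtain ⟨i, rfl⟩ := hx
    exact (c i).2

theorem final_aux (n m : ℕ) (hnm : n ≤ m) (hpar : m % 2 = n % 2) (c : Fin m → Fin n) (Y : ℕ → Prop)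
    [DecidablePred Y]
    (hY : ∀ r, Y r ↔ ∃ i : Fin m, (c i).1 = 2*r + 1 ∧ ∀ j : Fin m, j < i → (c j).1 / 2 ≠ r) :
    (¬ (∀ r < n / 2, Even (cnt c r) ∧ 1 ≤ cnt c r ∧ Alt c r) →
      MvPolynomial.coeff (expOf c) (DPfSum n m hnm) = 0) ∧
    ((∀ r < n / 2, Even (cnt c r) ∧ 1 ≤ cnt c r ∧ Alt c r) →
      MvPolynomial.coeff (expOf c) (DPfSum n m hnm) =
        2 ^ (m / 2 - n / 2) * (-1) ^ ((Finset.range (n / 2)).filter Y).card * sgnMon c) := by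
  rw [coeff_eq_TT n m hnm hpar c]
  have hlen : ∀ r, (grp r (wordOf c)).length = cnt c r := fun r => grp_length r m _
  have halt : ∀ r, (grp r (wordOf c)).IsChain (· ≠ ·) ↔ Alt c r := by
    intro r
    unfold wordOf
    rw [chain_ofFn]
    simp only [Alt, ne_eq, Fin.ext_iff (n := n)]
  have hsgn : sgnMon c = (-1) ^ invL n (wordOf c) := by
    unfold wordOf
    rw [invL_ofFn]
    rfl
  have hcond : ∀ r, (Even (grp r (wordOf c)).length ∧ grp r (wordOf c) ≠ [] ∧
      (grp r (wordOf c)).IsChain (· ≠ ·)) ↔ (Even (cnt c r) ∧ 1 ≤ cnt c r ∧ Alt c r) := by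
    intro r
    rw [halt, ← hlen r, ← List.length_pos_iff]
    rfl
  constructor
  · intro h
    push Not at h
    obtain ⟨r, hr, h⟩ := h
    unfold TT
    rw [Finset.prod_eq_zero (Finset.mem_range.mpr hr), mul_zero]
    unfold tg
    rw [if_neg]
    rw [hcond]
    rintro ⟨h1, h2, h3⟩
    exact h h1 h2 h3
  · intro h
    have htg : ∀ r ∈ Finset.range (n / 2), tg (grp r (wordOf c)) =
        2 ^ (cnt c r / 2 - 1) * if Y r then -1 else 1 := by
      intro r hr
      have hr' := h r (Finset.mem_range.mp hr)
      unfold tg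
      rw [if_pos ((hcond r).mpr hr'), hlen]
      congr 1
      apply if_congr _ rfl rfl
      rw [hY]
      have hd := fun x => head_ofFn (fun a => a / 2 = r) x m (fun i => (c i).1)
      have hne : grp r (wordOf c) ≠ [] := ((hcond r).mpr hr').2.1
      obtain ⟨x, t, hxt⟩ := List.exists_cons_of_ne_nil hne
      have hx : x / 2 = r := (mem_grp.mp (hxt ▸ List.mem_cons_self : x ∈ grp r (wordOf c))).2
      have hdx : ∀ y, y = x ↔ _ := fun y => (show y = x ↔ y ∈ (grp r (wordOf c)).head? by
        rw [hxt]; simp [eq_comm]).trans (hd y)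
      rw [hxt, List.headD_cons]
      constructor
      · intro h1
        obtain ⟨i, h2, _, h3⟩ := (hdx x).mp rfl
        exact ⟨i, by rw [h2]; omega, h3⟩
      · rintro ⟨i, h1, h2⟩
        have := (hdx (2 * r + 1)).mpr ⟨i, h1, by omega, h2⟩
        omega
    unfold TT
    rw [Finset.prod_congr rfl htg, Finset.prod_mul_distrib, Finset.prod_pow_eq_pow_sum, hsgn, hlen,
      Finset.prod_ite]
    simp only [Finset.prod_const, one_pow, mul_one]
    have hl := length_eq_sum (n / 2 + 1) (wordOf c) (by
      intro x hx
      rw [wordOf, List.mem_ofFn] at hx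
      obtain ⟨i, rfl⟩ := hx
      have := (c i).2
      show (c i).1 / 2 < _
      omega)
    simp only [hlen] at hl
    rw [Finset.sum_range_succ] at hl
    have hlm : (wordOf c).length = m := by simp [wordOf]
    have hs : ∑ r ∈ Finset.range (n / 2), cnt c r =
        2 * (∑ r ∈ Finset.range (n / 2), (cnt c r / 2 - 1)) + 2 * (n / 2) := by
      have : ∀ r ∈ Finset.range (n / 2), cnt c r = 2 * (cnt c r / 2 - 1) + 2 := by
        intro r hr
        obtain ⟨⟨k, hk⟩, h1, _⟩ := h r (Finset.mem_range.mp hr)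
        omega
      rw [Finset.sum_congr rfl this, Finset.sum_add_distrib, Finset.mul_sum]
      simp [mul_comm]
    have he : m / 2 - n / 2 = cnt c (n / 2) / 2 + ∑ r ∈ Finset.range (n / 2), (cnt c r / 2 - 1) := by
      omega
    rw [he, pow_add]
    ring

end helpers7


open Classical in
/-- The coefficient in `Σ_π sgn π · D^{(π(1),…,π(n))} · Pf^{(π(n+1),…,π(m))}` of the `m`-linear
monomial encoded by `c` is zero unless each `m_r` (`r` a pair group, i.e. `r < ν = n/2`) is
even and strictly positive with `x_r, y_r` alternating; in that case it equals
`2^(μ−ν) · (−1)^(#{r : y_r comes first}) · sgn ρ`, where `μ = m/2`. -/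
theorem coeff_DPfSum (n m : ℕ) (hnm : n ≤ m) (hpar : m % 2 = n % 2) (c : Fin m → Fin n) :
    (¬ (∀ r < n / 2, Even (cnt c r) ∧ 1 ≤ cnt c r ∧ Alt c r) →
      MvPolynomial.coeff (expOf c) (DPfSum n m hnm) = 0) ∧
    ((∀ r < n / 2, Even (cnt c r) ∧ 1 ≤ cnt c r ∧ Alt c r) →
      MvPolynomial.coeff (expOf c) (DPfSum n m hnm) =
        2 ^ (m / 2 - n / 2) *
        (-1) ^ ((Finset.range (n / 2)).filter fun r =>
            ∃ i : Fin m, (c i).1 = 2*r + 1 ∧ ∀ j : Fin m, j < i → (c j).1 / 2 ≠ r).card *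
        sgnMon c) := by
  exact final_aux n m hnm hpar c _ (fun r => Iff.rfl)
end
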